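/- Let n ≥ 1, c > 0, and consider the density f(x) = exp(c|x|²) on ℝ^{n+1}. For V > 0 let B be the open round ball centered at the origin with weighted volume vol(B) = V. Then every open set Ω ⊆ ℝ^{n+1} with vol(Ω) = V satisfies P(Ω) ≥ P(B); moreover, if P(Ω) = P(B) then the symmetric difference of Ω and B has Lebesgue measure zero (i.e. round balls about the origin are the unique minimizers up to sets of measure zero). -/

import Mathlib

open Filter MeasureTheory Set
open scoped symmDiff

/-- Weighted volume of a set `Ω ⊆ ℝ^{n+1}` with respect to the density `f`. -/
noncomputable def wvol {n : ℕ} (f : EuclideanSpace ℝ (Fin (n + 1)) → ℝ)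
    (Ω : Set (EuclideanSpace ℝ (Fin (n + 1)))) : ENNReal :=
  ∫⁻ x in Ω, ENNReal.ofReal (f x)

/-- Weighted perimeter of a set `Ω ⊆ ℝ^{n+1}` with respect to the density `f`:
the integral of `f` over the topological boundary of `Ω` with respect to the
`n`-dimensional Hausdorff measure. -/
noncomputable def wper {n : ℕ} (f : EuclideanSpace ℝ (Fin (n + 1)) → ℝ)
    (Ω : Set (EuclideanSpace ℝ (Fin (n + 1)))) : ENNReal :=
  ∫⁻ x in frontier Ω, ENNReal.ofReal (f x) ∂(μH[n])


namespace BQ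
open scoped ENNReal Pointwise

/-- one-dimensional sum of compact sets -/
lemma compact_add (K L : Set ℝ) (hK : IsCompact K) (hL : IsCompact L) (hKn : K.Nonempty)
    (hLn : L.Nonempty) : volume K + volume L ≤ volume (K + L) := by
  obtain ⟨k, hk, hkm⟩ := hK.exists_isGreatest hKn
  obtain ⟨l, hl, hlm⟩ := hL.exists_isLeast hLn
  have h1 : volume K = volume ((fun x => l + x) '' K) := by
    rw [Set.image_add_left, measure_preimage_add]
  have h2 : volume L = volume ((fun x => k + x) '' L) := by
    rw [Set.image_add_left, measure_preimage_add]
  have hm : MeasurableSet ((fun x => k + x) '' L) :=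
    (hL.image (by fun_prop)).measurableSet
  have hd : AEDisjoint volume ((fun x => l + x) '' K) ((fun x => k + x) '' L) := by
    refine measure_mono_null (t := {k + l}) ?_ (by simp)
    rintro z ⟨⟨x, hx, rfl⟩, ⟨y, hy, hxy⟩⟩
    have a := hkm hx
    have b := hlm hy
    simp only [Set.mem_singleton_iff] at *
    linarith
  rw [h1, h2, ← measure_union₀ hm.nullMeasurableSet hd]
  apply measure_mono
  rintro z (⟨x, hx, rfl⟩ | ⟨y, hy, rfl⟩)
  · exact ⟨x, hx, l, hl, by simp [add_comm]⟩
  · exact ⟨k, hk, y, hy, rfl⟩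

lemma meas_add (A B C : Set ℝ) (hA : MeasurableSet A) (hB : MeasurableSet B)
    (hAn : A.Nonempty) (hBn : B.Nonempty) (hC : ∀ x ∈ A, ∀ y ∈ B, x + y ∈ C) :
    volume A + volume B ≤ volume C := by
  obtain ⟨a, ha⟩ := hAn
  obtain ⟨b, hb⟩ := hBn
  rw [hA.measure_eq_iSup_isCompact, hB.measure_eq_iSup_isCompact]
  simp only [iSup_and']
  refine ENNReal.biSup_add_biSup_le' (p := fun i => i ⊆ A ∧ IsCompact i)
    (q := fun i => i ⊆ B ∧ IsCompact i) ⟨∅, by simp⟩ ⟨∅, by simp⟩ ?_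
  intro K ⟨hKA, hK⟩ L ⟨hLB, hL⟩
  calc volume K + volume L ≤ volume (insert a K) + volume (insert b L) := by
        gcongr <;> exact Set.subset_insert _ _
    _ ≤ volume (insert a K + insert b L) :=
        compact_add _ _ (hK.insert a) (hL.insert b) (by simp) (by simp)
    _ ≤ volume C := by
        apply measure_mono
        rintro z ⟨x, hx, y, hy, rfl⟩
        exact hC x (Set.insert_subset ha hKA hx) y (Set.insert_subset hb hLB hy)

lemma meas_smul_add (l : ℝ) (h0 : 0 < l) (h1 : l < 1) (A B C : Set ℝ) (hA : MeasurableSet A)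
    (hB : MeasurableSet B) (hAn : A.Nonempty) (hBn : B.Nonempty)
    (hC : ∀ x ∈ A, ∀ y ∈ B, (1 - l) * x + l * y ∈ C) :
    ENNReal.ofReal (1 - l) * volume A + ENNReal.ofReal l * volume B ≤ volume C := by
  have e1 : ENNReal.ofReal (1 - l) * volume A = volume ((1 - l) • A) := by
    rw [Measure.addHaar_smul_of_nonneg _ (by linarith)]; simp
  have e2 : ENNReal.ofReal l * volume B = volume (l • B) := by
    rw [Measure.addHaar_smul_of_nonneg _ (by linarith)]; simp
  rw [e1, e2]
  refine meas_add _ _ _ (hA.const_smul_of_ne_zero (by linarith)) (hB.const_smul_of_ne_zero (by linarith))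
    (hAn.smul_set) (hBn.smul_set) ?_
  rintro _ ⟨x, hx, rfl⟩ _ ⟨y, hy, rfl⟩
  exact hC x hx y hy

/-- weighted AM-GM -/
lemma amgm (l : ℝ) (h0 : 0 < l) (h1 : l < 1) (a b : ℝ≥0∞) :
    a ^ (1 - l) * b ^ l ≤ ENNReal.ofReal (1 - l) * a + ENNReal.ofReal l * b := by
  have hl : (0:ℝ) < 1 - l := by linarith
  by_cases ha : a = ⊤
  · subst ha
    have : ENNReal.ofReal (1 - l) * ⊤ = ⊤ := ENNReal.mul_top (by simpa using hl)
    rw [this]; simp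
  by_cases hb : b = ⊤
  · subst hb
    have : ENNReal.ofReal l * ⊤ = ⊤ := ENNReal.mul_top (by simpa using h0)
    rw [this]; simp
  lift a to NNReal using ha
  lift b to NNReal using hb
  have := NNReal.geom_mean_le_arith_mean2_weighted (Real.toNNReal (1 - l)) (Real.toNNReal l) a b
    (by rw [← Real.toNNReal_add hl.le h0.le]; simp)
  rw [Real.coe_toNNReal _ hl.le, Real.coe_toNNReal _ h0.le] at this
  rw [← ENNReal.coe_rpow_of_nonneg _ hl.le, ← ENNReal.coe_rpow_of_nonneg _ h0.le]
  simp only [ENNReal.ofReal]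
  exact_mod_cast this

/-- normalised case -/
lemma pl1_norm (l : ℝ) (h0 : 0 < l) (h1 : l < 1) (f g h : ℝ → ℝ≥0∞) (hf : Measurable f)
    (hg : Measurable g) (hh : Measurable h) (sf : ⨆ x, f x = 1) (sg : ⨆ x, g x = 1)
    (H : ∀ x y, f x ^ (1 - l) * g y ^ l ≤ h ((1 - l) * x + l * y)) :
    (∫⁻ x, f x) ^ (1 - l) * (∫⁻ x, g x) ^ l ≤ ∫⁻ x, h x := by
  refine (amgm l h0 h1 _ _).trans ?_
  have lc : ∀ u : ℝ → ℝ≥0∞, Measurable u → (⨆ x, u x = 1) → ∫⁻ x, u x =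
      ∫⁻ t in Ioo (0:ℝ) 1, volume {x | ENNReal.ofReal t < u x} := by
    intro u hu su
    have hu1 : ∀ x, u x ≤ 1 := fun x => su ▸ le_iSup u x
    have hut : ∀ x, u x ≠ ⊤ := fun x => ((hu1 x).trans_lt (by simp)).ne
    have e : ∫⁻ x, u x = ∫⁻ x, ENNReal.ofReal ((u x).toReal) := by
      congr 1; ext x; rw [ENNReal.ofReal_toReal (hut x)]
    rw [e, lintegral_eq_lintegral_meas_lt _ (Eventually.of_forall fun x => by positivity)
      (hu.ennreal_toReal.aemeasurable)]
    have e2 : ∀ t ∈ Ioi (0:ℝ), volume {a | t < (u a).toReal} =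
        volume {x | ENNReal.ofReal t < u x} := by
      intro t ht
      congr 1; ext x
      simp only [Set.mem_ofPred_eq]
      rw [ENNReal.ofReal_lt_iff_lt_toReal (le_of_lt ht) (hut x)]
    rw [setLIntegral_congr_fun measurableSet_Ioi e2]
    rw [← Ioo_union_Ici_eq_Ioi (zero_lt_one (α := ℝ)), lintegral_union measurableSet_Ici
      (by rw [Set.disjoint_left]; intro x hx hx'; exact absurd hx.2 (not_lt.2 hx'))]
    have : ∫⁻ t in Ici (1:ℝ), volume {x | ENNReal.ofReal t < u x} = 0 := by
      rw [setLIntegral_congr_fun (g := fun _ => 0) measurableSet_Ici]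
      · simp
      intro t ht
      have : {x | ENNReal.ofReal t < u x} = ∅ := by
        ext x; simp only [Set.mem_ofPred_eq, Set.mem_empty_iff_false, iff_false, not_lt]
        refine (hu1 x).trans ?_
        simpa using ht
      simp [this]
    rw [this, add_zero]
  have lh : ∫⁻ t in Ioo (0:ℝ) 1, volume {x | ENNReal.ofReal t < h x} ≤ ∫⁻ x, h x := by
    have e3 : ∫⁻ x, ENNReal.ofReal ((min (h x) 1).toReal) ≤ ∫⁻ x, h x := by
      apply lintegral_mono; intro x
      simp only
      rw [ENNReal.ofReal_toReal (by simp)]; exact min_le_left _ _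
    refine le_trans ?_ e3
    rw [lintegral_eq_lintegral_meas_lt _ (Eventually.of_forall fun x => by positivity)
      ((hh.min measurable_const).ennreal_toReal.aemeasurable)]
    refine le_trans ?_ (lintegral_mono_set (Ioo_subset_Ioi_self : Ioo (0:ℝ) 1 ⊆ Ioi 0))
    apply setLIntegral_mono' measurableSet_Ioo
    intro t ht
    apply measure_mono
    intro x hx
    simp only [Set.mem_ofPred_eq] at *
    rw [← ENNReal.ofReal_lt_iff_lt_toReal ht.1.le (by simp)]
    refine lt_min hx ?_
    rw [← ENNReal.ofReal_one]; exact (ENNReal.ofReal_lt_ofReal_iff (by norm_num)).2 ht.2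
  refine le_trans ?_ lh
  rw [lc f hf sf, lc g hg sg]
  have mm : ∀ u : ℝ → ℝ≥0∞, Measurable (fun t : ℝ => volume {x | ENNReal.ofReal t < u x}) := by
    intro u
    apply Antitone.measurable
    intro s t hst
    apply measure_mono
    intro x hx
    exact lt_of_le_of_lt (ENNReal.ofReal_le_ofReal hst) hx
  rw [← lintegral_const_mul _ (mm f), ← lintegral_const_mul _ (mm g), ← lintegral_add_left
    ((mm f).const_mul _)]
  apply setLIntegral_mono' measurableSet_Ioo
  intro t ht
  have t1 : ENNReal.ofReal t < 1 := by
    rw [← ENNReal.ofReal_one]; exact (ENNReal.ofReal_lt_ofReal_iff (by norm_num)).2 ht.2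
  refine meas_smul_add l h0 h1 _ _ _ (measurableSet_lt measurable_const hf)
    (measurableSet_lt measurable_const hg) ?_ ?_ ?_
  · rw [← sf] at t1; exact lt_iSup_iff.1 t1
  · rw [← sg] at t1; exact lt_iSup_iff.1 t1
  · intro x hx y hy
    refine lt_of_lt_of_le ?_ (H x y)
    have tt : ENNReal.ofReal t = ENNReal.ofReal t ^ (1 - l) * ENNReal.ofReal t ^ l := by
      rw [← ENNReal.rpow_add _ _ (by simpa using ht.1) (by simp)]; simp
    rw [tt]
    exact ENNReal.mul_lt_mul (ENNReal.rpow_lt_rpow hx (by linarith)) (ENNReal.rpow_lt_rpow hy h0)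


/-- bounded case -/
lemma pl1_bdd (l : ℝ) (h0 : 0 < l) (h1 : l < 1) (f g h : ℝ → ℝ≥0∞) (hf : Measurable f)
    (hg : Measurable g) (hh : Measurable h) (sf : ⨆ x, f x ≠ ⊤) (sg : ⨆ x, g x ≠ ⊤)
    (H : ∀ x y, f x ^ (1 - l) * g y ^ l ≤ h ((1 - l) * x + l * y)) :
    (∫⁻ x, f x) ^ (1 - l) * (∫⁻ x, g x) ^ l ≤ ∫⁻ x, h x := by
  have hl : (0:ℝ) < 1 - l := by linarith
  by_cases zf : ⨆ x, f x = 0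
  · have : ∀ x, f x = 0 := by simpa using zf
    simp [this, ENNReal.zero_rpow_of_pos hl]
  by_cases zg : ⨆ x, g x = 0
  · have : ∀ x, g x = 0 := by simpa using zg
    simp [this, ENNReal.zero_rpow_of_pos h0]
  set a := ⨆ x, f x with ha
  set b := ⨆ x, g x with hb
  have key := pl1_norm l h0 h1 (fun x => a⁻¹ * f x) (fun x => b⁻¹ * g x)
    (fun x => (a⁻¹ ^ (1 - l) * b⁻¹ ^ l) * h x) (hf.const_mul _) (hg.const_mul _) (hh.const_mul _)
    (by rw [← ENNReal.mul_iSup, ← ha, ENNReal.inv_mul_cancel zf sf])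
    (by rw [← ENNReal.mul_iSup, ← hb, ENNReal.inv_mul_cancel zg sg])
    (by
      intro x y
      rw [ENNReal.mul_rpow_of_nonneg _ _ hl.le, ENNReal.mul_rpow_of_nonneg _ _ h0.le]
      calc _ = (a⁻¹ ^ (1 - l) * b⁻¹ ^ l) * (f x ^ (1 - l) * g y ^ l) := by ring
        _ ≤ _ := by gcongr; exact H x y)
  rw [lintegral_const_mul _ hf, lintegral_const_mul _ hg, lintegral_const_mul _ hh,
    ENNReal.mul_rpow_of_nonneg _ _ hl.le, ENNReal.mul_rpow_of_nonneg _ _ h0.le] at key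
  have k2 : (a⁻¹ ^ (1 - l) * b⁻¹ ^ l) * ((∫⁻ x, f x) ^ (1 - l) * (∫⁻ x, g x) ^ l) ≤
      (a⁻¹ ^ (1 - l) * b⁻¹ ^ l) * ∫⁻ x, h x := by
    refine le_trans (le_of_eq ?_) key; ring
  have ia : a⁻¹ ≠ 0 := ENNReal.inv_ne_zero.2 sf
  have ib : b⁻¹ ≠ 0 := ENNReal.inv_ne_zero.2 sg
  have ia' : a⁻¹ ≠ ⊤ := ENNReal.inv_ne_top.2 zf
  have ib' : b⁻¹ ≠ ⊤ := ENNReal.inv_ne_top.2 zg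
  refine (ENNReal.mul_le_mul_iff_right ?_ ?_).1 k2
  · exact mul_ne_zero (by simp [ENNReal.rpow_eq_zero_iff, ia, ia'])
      (by simp [ENNReal.rpow_eq_zero_iff, ib, ib'])
  · exact ENNReal.mul_ne_top (ENNReal.rpow_ne_top_of_nonneg hl.le ia')
      (ENNReal.rpow_ne_top_of_nonneg h0.le ib')

lemma lint_trunc (f : ℝ → ℝ≥0∞) (hf : Measurable f) :
    Tendsto (fun k : ℕ => ∫⁻ x, min (f x) k) atTop (nhds (∫⁻ x, f x)) := by
  apply lintegral_tendsto_of_tendsto_of_monotone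
  · intro k; exact (hf.min measurable_const).aemeasurable
  · refine Eventually.of_forall fun x => ?_
    intro i j hij
    exact min_le_min le_rfl (by exact_mod_cast hij)
  · refine Eventually.of_forall fun x => ?_
    have : Tendsto (fun k : ℕ => min (f x) (k : ℝ≥0∞)) atTop (nhds (min (f x) ⊤)) :=
      tendsto_const_nhds.min ENNReal.tendsto_nat_nhds_top
    simpa using this

/-- one-dimensional Prékopa–Leindler -/
lemma pl1 (l : ℝ) (h0 : 0 < l) (h1 : l < 1) (f g h : ℝ → ℝ≥0∞) (hf : Measurable f)
    (hg : Measurable g) (hh : Measurable h)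
    (H : ∀ x y, f x ^ (1 - l) * g y ^ l ≤ h ((1 - l) * x + l * y)) :
    (∫⁻ x, f x) ^ (1 - l) * (∫⁻ x, g x) ^ l ≤ ∫⁻ x, h x := by
  have hl : (0:ℝ) < 1 - l := by linarith
  by_cases zf : ∫⁻ x, f x = 0
  · simp [zf, ENNReal.zero_rpow_of_pos hl]
  by_cases zg : ∫⁻ x, g x = 0
  · simp [zg, ENNReal.zero_rpow_of_pos h0]
  have bb : ∀ u : ℝ → ℝ≥0∞, ∀ k : ℕ, ⨆ x, min (u x) (k : ℝ≥0∞) ≠ ⊤ := by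
    intro u k
    exact ((iSup_le fun x => min_le_right (u x) (k : ℝ≥0∞)).trans_lt (by simp)).ne
  have T : Tendsto (fun k : ℕ => (∫⁻ x, min (f x) k) ^ (1 - l) * (∫⁻ x, min (g x) k) ^ l) atTop
      (nhds ((∫⁻ x, f x) ^ (1 - l) * (∫⁻ x, g x) ^ l)) := by
    have nz : ∀ (a : ℝ≥0∞) (p : ℝ), 0 < p → a ≠ 0 → a ^ p ≠ 0 := by
      intro a p hp ha h
      rcases ENNReal.rpow_eq_zero_iff.1 h with h | h
      · exact ha h.1
      · linarith [h.2]
    refine ENNReal.Tendsto.mul ((ENNReal.continuous_rpow_const.tendsto _).comp (lint_trunc f hf))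
      (Or.inl (nz _ _ hl zf))
      ((ENNReal.continuous_rpow_const.tendsto _).comp (lint_trunc g hg)) (Or.inl (nz _ _ h0 zg))
  refine le_of_tendsto' T fun k => ?_
  refine pl1_bdd l h0 h1 _ _ h (hf.min measurable_const) (hg.min measurable_const) hh (bb f k)
    (bb g k) ?_
  intro x y
  refine le_trans ?_ (H x y)
  gcongr
  · exact min_le_left _ _
  · exact min_le_left _ _

/-- Prékopa–Leindler -/
lemma pl (l : ℝ) (h0 : 0 < l) (h1 : l < 1) (d : ℕ) : ∀ (f g h : (Fin d → ℝ) → ℝ≥0∞)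
    (_ : Measurable f) (_ : Measurable g) (_ : Measurable h)
    (_ : ∀ x y, f x ^ (1 - l) * g y ^ l ≤ h ((1 - l) • x + l • y)),
    (∫⁻ x, f x) ^ (1 - l) * (∫⁻ x, g x) ^ l ≤ ∫⁻ x, h x := by
  induction d with
  | zero =>
    intro f g h _ _ _ H
    have := H default default
    rw [Subsingleton.elim ((1 - l) • (default : Fin 0 → ℝ) + l • default) default] at this
    rw [Measure.volume_pi_eq_dirac default, lintegral_dirac, lintegral_dirac, lintegral_dirac]
    exact this
  | succ d ih =>
    intro f g h hf hg hh H
    let e := (MeasurableEquiv.piFinSuccAbove (fun _ : Fin (d+1) => ℝ) 0).symm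
    have he : MeasurePreserving e := 
      (volume_preserving_piFinSuccAbove (fun _ : Fin (d+1) => ℝ) 0).symm _
    have red : ∀ u : (Fin (d+1) → ℝ) → ℝ≥0∞, Measurable u →
        ∫⁻ x, u x = ∫⁻ s : ℝ, ∫⁻ y : Fin d → ℝ, u (e (s, y)) := by
      intro u hu
      rw [← he.lintegral_comp hu]
      exact lintegral_prod _ (hu.comp e.measurable).aemeasurable
    have mea : ∀ u : (Fin (d+1) → ℝ) → ℝ≥0∞, Measurable u →
        Measurable fun s : ℝ => ∫⁻ y : Fin d → ℝ, u (e (s, y)) := by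
      intro u hu
      exact (hu.comp e.measurable).lintegral_prod_right'
    have ms : ∀ u : (Fin (d+1) → ℝ) → ℝ≥0∞, Measurable u → ∀ s : ℝ,
        Measurable fun y : Fin d → ℝ => u (e (s, y)) := by
      intro u hu s
      exact hu.comp (e.measurable.comp measurable_prodMk_left)
    rw [red f hf, red g hg, red h hh]
    refine pl1 l h0 h1 _ _ _ (mea f hf) (mea g hg) (mea h hh) ?_
    intro s t
    refine ih _ _ _ (ms f hf s) (ms g hg t) (ms h hh _) ?_
    intro x y
    refine (H _ _).trans (le_of_eq ?_)
    congr 1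
    ext i
    refine Fin.cases ?_ (fun j => ?_) i
    · simp [e, MeasurableEquiv.piFinSuccAbove]
    · simp [e, MeasurableEquiv.piFinSuccAbove]

lemma bm_mult (l : ℝ) (h0 : 0 < l) (h1 : l < 1) (d : ℕ) (A B C : Set (EuclideanSpace ℝ (Fin d)))
    (hA : MeasurableSet A) (hB : MeasurableSet B) (hC : MeasurableSet C)
    (H : ∀ x ∈ A, ∀ y ∈ B, (1 - l) • x + l • y ∈ C) :
    volume A ^ (1 - l) * volume B ^ l ≤ volume C := by
  have hl : (0:ℝ) < 1 - l := by linarith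
  let e := (MeasurableEquiv.toLp 2 (Fin d → ℝ))
  have he : MeasurePreserving e := PiLp.volume_preserving_toLp (Fin d)
  have := pl l h0 h1 d ((e ⁻¹' A).indicator 1) ((e ⁻¹' B).indicator 1) ((e ⁻¹' C).indicator 1)
    (measurable_one.indicator (e.measurable hA)) (measurable_one.indicator (e.measurable hB))
    (measurable_one.indicator (e.measurable hC)) (by
      intro x y
      by_cases hx : x ∈ e ⁻¹' A
      · by_cases hy : y ∈ e ⁻¹' B
        · have := H _ hx _ hy
          have h2 : (1 - l) • x + l • y ∈ e ⁻¹' C := this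
          simp [Set.indicator_of_mem, hx, hy, h2]
        · simp [hy, ENNReal.zero_rpow_of_pos h0]
      · simp [hx, ENNReal.zero_rpow_of_pos hl])
  rw [lintegral_indicator_one (e.measurable hA), lintegral_indicator_one (e.measurable hB),
    lintegral_indicator_one (e.measurable hC), he.measure_preimage hA.nullMeasurableSet,
    he.measure_preimage hB.nullMeasurableSet, he.measure_preimage hC.nullMeasurableSet] at this
  exact this

end BQ

namespace BQ
open scoped ENNReal Pointwise

/-- unit ball volume -/
noncomputable def om (n : ℕ) : ℝ := (volume (Metric.ball (0 : EuclideanSpace ℝ (Fin (n + 1))) 1)).toReal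

lemma om_pos (n : ℕ) : 0 < om n :=
  ENNReal.toReal_pos (Metric.measure_ball_pos _ _ one_pos).ne' measure_ball_lt_top.ne

lemma vol_ball (n : ℕ) (r : ℝ) (hr : 0 ≤ r) :
    volume (Metric.ball (0 : EuclideanSpace ℝ (Fin (n + 1))) r) = ENNReal.ofReal (om n * r ^ (n + 1)) := by
  rw [Measure.addHaar_ball _ _ hr, mul_comm, om, ENNReal.ofReal_mul ENNReal.toReal_nonneg,
    ENNReal.ofReal_toReal measure_ball_lt_top.ne]
  simp

/-- isoperimetric constant -/
noncomputable def isoC (n : ℕ) : ℝ := (n + 1) * om n ^ ((1:ℝ) / (n + 1))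

lemma isoC_pos (n : ℕ) : 0 < isoC n := by
  have := om_pos n
  unfold isoC; positivity

lemma bernoulli (n : ℕ) (a b : ℝ) (ha : 0 < a) (hb : 0 ≤ b) :
    a ^ (n + 1) + (n + 1) * a ^ n * b ≤ (a + b) ^ (n + 1) := by
  have h := one_add_mul_le_pow (a := b / a) (by linarith [div_nonneg hb ha.le]) (n + 1)
  have : (a + b) ^ (n + 1) = a ^ (n + 1) * (1 + b / a) ^ (n + 1) := by
    rw [← mul_pow]; congr 1; field_simp
  rw [this]
  calc _ = a ^ (n + 1) * (1 + (n + 1 : ℕ) * (b / a)) := by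
        push_cast; field_simp; ring
    _ ≤ _ := by gcongr

lemma bm_ball (n : ℕ) (hn : 1 ≤ n) (A : Set (EuclideanSpace ℝ (Fin (n + 1)))) (hA : IsOpen A)
    (hfin : volume A ≠ ⊤) (δ : ℝ) (hδ : 0 < δ) :
    volume A + ENNReal.ofReal δ * (ENNReal.ofReal (isoC n) * volume A ^ ((n:ℝ) / (n + 1))) ≤
      volume (Metric.thickening δ A) := by
  have hn0 : (0:ℝ) < n := by exact_mod_cast hn
  by_cases hz : volume A = 0
  · rw [hz, ENNReal.zero_rpow_of_pos (by positivity)]; simp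
  set v := (volume A).toReal with hv
  have hvp : 0 < v := ENNReal.toReal_pos hz hfin
  have hvA : volume A = ENNReal.ofReal v := (ENNReal.ofReal_toReal hfin).symm
  have hop := om_pos n
  set p : ℝ := 1 / (n + 1) with hp
  have hp1 : p * (n + 1 : ℕ) = 1 := by rw [hp]; push_cast; field_simp
  set a := v ^ p with ha
  set w := om n ^ p with hw
  have ap : 0 < a := by positivity
  have wp : 0 < w := by positivity
  have aN : a ^ (n + 1) = v := by
    rw [ha, ← Real.rpow_natCast, ← Real.rpow_mul hvp.le, hp1, Real.rpow_one]
  have wN : w ^ (n + 1) = om n := by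
    rw [hw, ← Real.rpow_natCast, ← Real.rpow_mul hop.le, hp1, Real.rpow_one]
  set b := δ * w with hb
  have bp : 0 < b := by positivity
  have key := bm_mult (b / (a + b)) (by positivity) ((div_lt_one (by positivity)).2 (by linarith)) (n + 1)
    (a⁻¹ • A) (b⁻¹ • Metric.ball 0 δ) ((a + b)⁻¹ • Metric.thickening δ A)
    (hA.measurableSet.const_smul_of_ne_zero (by positivity))
    (Metric.isOpen_ball.measurableSet.const_smul_of_ne_zero (by positivity))
    (Metric.isOpen_thickening.measurableSet.const_smul_of_ne_zero (by positivity))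
    (by
      rintro _ ⟨x, hx, rfl⟩ _ ⟨y, hy, rfl⟩
      refine ⟨x + y, ?_, ?_⟩
      · rw [Metric.mem_thickening_iff]
        refine ⟨x, hx, ?_⟩
        simpa [dist_eq_norm] using hy
      · simp only [smul_smul, smul_add]
        congr 2
        · field_simp; ring
        · field_simp)
  rw [Measure.addHaar_smul_of_nonneg _ (by positivity), Measure.addHaar_smul_of_nonneg _ (by positivity),
    Measure.addHaar_smul_of_nonneg _ (by positivity)] at key
  rw [hvA, vol_ball n δ hδ.le] at key
  simp only [finrank_euclideanSpace, Fintype.card_fin] at key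
  rw [← ENNReal.ofReal_mul (by positivity), ← ENNReal.ofReal_mul (by positivity)] at key
  have e1 : a⁻¹ ^ (n + 1) * v = 1 := by rw [← aN, ← mul_pow, inv_mul_cancel₀ ap.ne', one_pow]
  have e2 : b⁻¹ ^ (n + 1) * (om n * δ ^ (n + 1)) = 1 := by
    rw [← wN, ← mul_pow, ← mul_pow, mul_comm w, ← hb, inv_mul_cancel₀ bp.ne', one_pow]
  rw [e1, e2] at key
  simp only [ENNReal.ofReal_one, ENNReal.one_rpow, mul_one] at key
  have k2 : ENNReal.ofReal ((a + b) ^ (n + 1)) ≤ volume (Metric.thickening δ A) := by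
    calc ENNReal.ofReal ((a + b) ^ (n + 1)) = ENNReal.ofReal ((a + b) ^ (n + 1)) * 1 := by simp
      _ ≤ ENNReal.ofReal ((a + b) ^ (n + 1)) * (ENNReal.ofReal ((a + b)⁻¹ ^ (n + 1)) *
          volume (Metric.thickening δ A)) := by gcongr
      _ = _ := by
          rw [← mul_assoc, ← ENNReal.ofReal_mul (by positivity), ← mul_pow,
            mul_inv_cancel₀ (by positivity)]; simp
  refine le_trans ?_ k2
  rw [hvA, ENNReal.ofReal_rpow_of_pos hvp, ← ENNReal.ofReal_mul (isoC_pos n).le,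
    ← ENNReal.ofReal_mul hδ.le, ← ENNReal.ofReal_add hvp.le (by have := isoC_pos n; positivity)]
  apply ENNReal.ofReal_le_ofReal
  refine le_trans (le_of_eq ?_) (bernoulli n a b ap bp.le)
  have an : v ^ ((n:ℝ) / (n + 1)) = a ^ n := by
    rw [ha, ← Real.rpow_natCast, ← Real.rpow_mul hvp.le, hp]; congr 1; field_simp
  rw [aN, an, isoC, hb]; ring

lemma sobolev (n : ℕ) (hn : 1 ≤ n) (g : EuclideanSpace ℝ (Fin (n + 1)) → ℝ) (L : NNReal)
    (hL : LipschitzWith L g) (g0 : ∀ y, 0 ≤ g y) (M : ℝ) (hM : ∀ y, M ≤ ‖y‖ → g y = 0)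
    (g' : EuclideanSpace ℝ (Fin (n + 1)) → (EuclideanSpace ℝ (Fin (n + 1)) →L[ℝ] ℝ))
    (hg' : ∀ᵐ y, HasFDerivAt g (g' y) y) :
    ∫⁻ t in Ioi (0:ℝ), ENNReal.ofReal (isoC n) * volume {y | t < g y} ^ ((n:ℝ) / (n + 1)) ≤
      ∫⁻ y, ENNReal.ofReal ‖g' y‖ := by
  set G : ℝ → EuclideanSpace ℝ (Fin (n + 1)) → ℝ := fun δ y => sSup (g '' Metric.ball y δ) with hG
  have bdd : ∀ δ y, BddAbove (g '' Metric.ball y δ) := by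
    intro δ y
    refine ⟨g y + L * δ, ?_⟩
    rintro _ ⟨z, hz, rfl⟩
    have := hL.dist_le_mul z y
    rw [Real.dist_eq] at this
    have h2 := le_abs_self (g z - g y)
    have h3 : (L:ℝ) * dist z y ≤ L * δ := by gcongr; exact (Metric.mem_ball.1 hz).le
    linarith
  have gG : ∀ δ, 0 < δ → ∀ y, g y ≤ G δ y := fun δ hδ y =>
    le_csSup (bdd δ y) ⟨y, Metric.mem_ball_self hδ, rfl⟩
  have Gle : ∀ δ, 0 < δ → ∀ y B, (∀ z ∈ Metric.ball y δ, g z ≤ B) → G δ y ≤ B := by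
    intro δ hδ y B h
    refine csSup_le ⟨_, y, Metric.mem_ball_self hδ, rfl⟩ ?_
    rintro _ ⟨z, hz, rfl⟩
    exact h z hz
  have Glip : ∀ δ, 0 < δ → ∀ y, G δ y - g y ≤ L * δ := by
    intro δ hδ y
    have := Gle δ hδ y (g y + L * δ) (by
      intro z hz
      have := hL.dist_le_mul z y
      rw [Real.dist_eq] at this
      have h2 := le_abs_self (g z - g y)
      have h3 : (L:ℝ) * dist z y ≤ L * δ := by gcongr; exact (Metric.mem_ball.1 hz).le
      linarith)
    linarith
  have Gset : ∀ δ, 0 < δ → ∀ t, {y | t < G δ y} = Metric.thickening δ {y | t < g y} := by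
    intro δ hδ t
    ext y
    rw [Metric.mem_thickening_iff]
    constructor
    · intro h
      obtain ⟨_, ⟨z, hz, rfl⟩, hlt⟩ := exists_lt_of_lt_csSup
        (⟨_, y, Metric.mem_ball_self hδ, rfl⟩ : (g '' Metric.ball y δ).Nonempty) h
      exact ⟨z, hlt, by rw [dist_comm]; exact hz⟩
    · rintro ⟨z, hz, hd⟩
      exact lt_of_lt_of_le hz (le_csSup (bdd δ y) ⟨z, by rw [Metric.mem_ball, dist_comm]; exact hd, rfl⟩)
  have Gm : ∀ δ, 0 < δ → Measurable (G δ) := by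
    intro δ hδ
    refine measurable_of_Ioi fun t => ?_
    have : G δ ⁻¹' Ioi t = {y | t < G δ y} := rfl
    rw [this, Gset δ hδ]
    exact Metric.isOpen_thickening.measurableSet
  have gm : Measurable g := hL.continuous.measurable
  have Gsupp : ∀ δ, 0 < δ → δ ≤ 1 → ∀ y, M + 1 ≤ ‖y‖ → G δ y = 0 := by
    intro δ hδ h1 y hy
    refine le_antisymm ?_ ((g0 y).trans (gG δ hδ y))
    refine Gle δ hδ y 0 ?_
    intro z hz
    refine (hM z ?_).le
    have := norm_sub_norm_le y z
    rw [← dist_eq_norm, dist_comm] at this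
    have h2 := Metric.mem_ball.1 hz
    linarith
  have fing : ∫⁻ y, ENNReal.ofReal (g y) ≠ ⊤ := by
    have hcs : HasCompactSupport g := HasCompactSupport.intro (isCompact_closedBall 0 M) (by
      intro x hx
      apply hM
      simp at hx; exact hx.le)
    have := (hL.continuous.integrable_of_hasCompactSupport (μ := volume) hcs).lintegral_lt_top
    exact this.ne
  set X := ∫⁻ t in Ioi (0:ℝ), ENNReal.ofReal (isoC n) * volume {y | t < g y} ^ ((n:ℝ) / (n + 1)) with hX
  have mX : Measurable fun t : ℝ => volume {y | t < g y} := by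
    apply Antitone.measurable
    intro s t hst
    exact measure_mono fun y hy => lt_of_le_of_lt hst hy
  have step : ∀ δ, 0 < δ → X ≤ ∫⁻ y, ENNReal.ofReal ((G δ y - g y) / δ) := by
    intro δ hδ
    have h1 : (∫⁻ y, ENNReal.ofReal (g y)) + ENNReal.ofReal δ * X ≤ ∫⁻ y, ENNReal.ofReal (G δ y) := by
      rw [lintegral_eq_lintegral_meas_lt _ (Eventually.of_forall g0) gm.aemeasurable,
        lintegral_eq_lintegral_meas_lt _ (Eventually.of_forall fun y => (g0 y).trans (gG δ hδ y))
        (Gm δ hδ).aemeasurable, hX, ← lintegral_const_mul _ (by fun_prop), ← lintegral_add_left mX]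
      apply setLIntegral_mono' measurableSet_Ioi
      intro t ht
      rw [Gset δ hδ]
      refine bm_ball n hn _ (isOpen_lt continuous_const hL.continuous) ?_ δ hδ
      refine ((measure_mono (?_ : {y | t < g y} ⊆ Metric.closedBall 0 M)).trans_lt
        (measure_closedBall_lt_top (μ := volume))).ne
      intro y hy
      by_contra hc
      have : g y = 0 := hM y (by simp at hc; exact hc.le)
      have h2 : t < g y := hy
      rw [this] at h2
      exact absurd h2 (not_lt.2 (le_of_lt ht))
    have h2 : ∫⁻ y, ENNReal.ofReal (G δ y) = (∫⁻ y, ENNReal.ofReal (g y)) +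
        ENNReal.ofReal δ * ∫⁻ y, ENNReal.ofReal ((G δ y - g y) / δ) := by
      rw [← lintegral_const_mul _ (by have := Gm δ hδ; fun_prop), ← lintegral_add_left (by fun_prop)]
      congr 1; ext y
      have := gG δ hδ y
      rw [← ENNReal.ofReal_mul hδ.le, ← ENNReal.ofReal_add (g0 y) (by
        have := div_nonneg (sub_nonneg.2 this) hδ.le; positivity)]
      congr 1; field_simp; ring
    rw [h2] at h1
    have h3 := (ENNReal.add_le_add_iff_left fing).1 h1
    exact (ENNReal.mul_le_mul_iff_right (by simpa using hδ) (by simp)).1 h3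
  set d : ℕ → ℝ := fun k => 1 / ((k:ℝ) + 1) with hd
  have dpos : ∀ k, 0 < d k := fun k => by positivity
  have d1 : ∀ k, d k ≤ 1 := fun k => by
    rw [hd]; exact (div_le_one (by positivity)).2 (by linarith [Nat.cast_nonneg (α := ℝ) k])
  have dt : Tendsto d atTop (nhds 0) := tendsto_one_div_add_atTop_nhds_zero_nat
  have lim := limsup_lintegral_le (μ := (volume : Measure (EuclideanSpace ℝ (Fin (n + 1)))))
    (f := fun k y => ENNReal.ofReal ((G (d k) y - g y) / d k))
    ((Metric.closedBall 0 (M + 1)).indicator fun _ => (L : ℝ≥0∞))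
    (fun k => by have := Gm (d k) (dpos k); fun_prop)
    (fun k => Eventually.of_forall fun y => by
      by_cases hy : y ∈ Metric.closedBall (0 : EuclideanSpace ℝ (Fin (n + 1))) (M + 1)
      · rw [Set.indicator_of_mem hy]
        rw [← ENNReal.ofReal_coe_nnreal]
        apply ENNReal.ofReal_le_ofReal
        rw [div_le_iff₀ (dpos k)]
        exact Glip _ (dpos k) y
      · have h1 : M + 1 ≤ ‖y‖ := by simp at hy; exact hy.le
        simp only []
        rw [Gsupp _ (dpos k) (d1 k) y h1, hM y (by linarith)]
        simp)
    (by
      rw [lintegral_indicator Metric.isClosed_closedBall.measurableSet]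
      simp only [lintegral_const, Measure.restrict_apply_univ]
      exact ENNReal.mul_ne_top (by simp) measure_closedBall_lt_top.ne)
  have hx : X ≤ limsup (fun k => ∫⁻ y, ENNReal.ofReal ((G (d k) y - g y) / d k)) atTop := by
    refine le_limsup_of_frequently_le (Eventually.of_forall fun k => step _ (dpos k)).frequently ?_
    isBoundedDefault
  refine (hx.trans lim).trans ?_
  apply lintegral_mono_ae
  filter_upwards [hg'] with y hy
  refine ENNReal.le_of_forall_pos_le_add ?_
  intro ε hε _
  have hb := hy.isLittleO.def (c := ε) (by exact_mod_cast hε)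
  rw [Metric.eventually_nhds_iff] at hb
  obtain ⟨r, hr, hb⟩ := hb
  refine limsup_le_of_le (by isBoundedDefault) ?_
  filter_upwards [dt.eventually (gt_mem_nhds hr)] with k hk
  rw [← ENNReal.ofReal_coe_nnreal, ← ENNReal.ofReal_add (norm_nonneg (g' y)) ε.coe_nonneg]
  apply ENNReal.ofReal_le_ofReal
  rw [div_le_iff₀ (dpos k), sub_le_iff_le_add]
  refine Gle _ (dpos k) y _ ?_
  intro z hz
  have hz' := Metric.mem_ball.1 hz
  have h1 := hb (y := z) (hz'.trans hk)
  rw [Real.norm_eq_abs] at h1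
  have h2 := (abs_le.1 h1).2
  have h3 := (le_abs_self _).trans ((g' y).le_opNorm (z - y))
  rw [← dist_eq_norm] at h2 h3
  have : (‖g' y‖ + ε) * dist z y ≤ (‖g' y‖ + ε) * d k := by gcongr
  nlinarith

end BQ

namespace BQ
open Real

lemma mono_of_hasDeriv (g g' : ℝ → ℝ) (a b : ℝ) (hab : a ≤ b) (hc : ContinuousOn g (Icc a b))
    (hd : ∀ x ∈ Ioo a b, HasDerivAt g (g' x) x) (hp : ∀ x ∈ Ioo a b, 0 ≤ g' x) : g a ≤ g b := by
  have := monotoneOn_of_hasDerivWithinAt_nonneg (f := g) (f' := g') (convex_Icc a b) hc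
    (by rw [interior_Icc]; exact fun x hx => (hd x hx).hasDerivWithinAt)
    (by rw [interior_Icc]; exact hp)
  exact this ⟨le_rfl, hab⟩ ⟨hab, le_rfl⟩ hab

/-- `(1+2v) e^{-3v}` is antitone on `v ≥ 0`. -/
lemma gam_anti (v w : ℝ) (hv : 0 ≤ v) (hvw : v ≤ w) :
    (1 + 2 * w) * exp (-(3 * w)) ≤ (1 + 2 * v) * exp (-(3 * v)) := by
  have h := add_one_le_exp (3 * (w - v))
  have e : exp (-(3 * v)) = exp (-(3 * w)) * exp (3 * (w - v)) := by rw [← exp_add]; ring_nf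
  rw [e]
  have := exp_pos (-(3 * w))
  have h2 : (1 + 2 * w) ≤ (1 + 2 * v) * exp (3 * (w - v)) := by nlinarith
  nlinarith

lemma sq_exp (v : ℝ) (hv : 0 ≤ v) : (1 + 2 * v) ^ 2 * exp (-(4 * v)) ≤ 1 := by
  have h := add_one_le_exp (2 * v)
  have e : exp (-(4 * v)) * (exp (2 * v)) ^ 2 = 1 := by
    rw [sq, ← exp_add, ← exp_add]; ring_nf; simp
  have h2 : (1 + 2 * v) ^ 2 ≤ (exp (2 * v)) ^ 2 := by gcongr; linarith
  have := exp_pos (-(4 * v))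
  nlinarith

/-- `0 ≤ D ≤ 2u`. -/
lemma D_nonneg (v : ℝ) (hv : 0 ≤ v) : (1 + 2 * v) * exp (-(4 * v)) ≤ 1 := by
  have h := add_one_le_exp (4 * v)
  have e : exp (-(4 * v)) * (exp (4 * v)) = 1 := by rw [← exp_add]; simp
  have := exp_pos (-(4 * v))
  nlinarith

lemma D_le (v : ℝ) (hv : 0 ≤ v) : 1 - (1 + 2 * v) * exp (-(4 * v)) ≤ 2 * v := by
  have key : (1 - 2 * v) ≤ (1 + 2 * v) * exp (-(4 * v)) := by
    have := mono_of_hasDeriv (fun v => (1 + 2 * v) * exp (-(4 * v)) - (1 - 2 * v))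
      (fun v => 2 * exp (-(4 * v)) + (1 + 2 * v) * (exp (-(4 * v)) * (-(4 * 1))) - (-(2 * 1))) 0 v hv
      (by fun_prop)
      (by
        intro x _
        have h1 : HasDerivAt (fun v : ℝ => 1 + 2 * v) (2 * 1) x :=
          ((hasDerivAt_id x).const_mul 2).const_add 1
        have h2 : HasDerivAt (fun v : ℝ => exp (-(4 * v))) (exp (-(4 * x)) * (-(4 * 1))) x :=
          (((hasDerivAt_id x).const_mul 4).neg).exp
        have h3 : HasDerivAt (fun v : ℝ => 1 - 2 * v) (-(2 * 1)) x :=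
          ((hasDerivAt_id x).const_mul 2).const_sub 1
        convert! (h1.mul h2).sub h3 using 1
        ring)
      (by
        intro x hx
        have h := add_one_le_exp (4 * x)
        have e : exp (-(4 * x)) * (exp (4 * x)) = 1 := by rw [← exp_add]; simp
        have := exp_pos (-(4 * x))
        nlinarith)
    simp at this
    linarith
  linarith

/-- the profile data outside the ball -/
structure Out (n : ℕ) (k R : ℝ) (φ Z : ℝ → ℝ) : Prop where
  hn : 1 ≤ n
  hk : 0 < k
  hR : 0 < R
  φR : φ R = R * exp (k * R ^ 2)
  ZR : Z R = R ^ n * (exp ((n + 4) * (k * R ^ 2)) - exp (n * (k * R ^ 2)))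
  φp : ∀ r, R ≤ r → 0 < φ r
  dφ : ∀ r, R ≤ r → HasDerivAt φ ((1 + 2 * (k * R ^ 2)) * exp (-(3 * (k * R ^ 2))) *
    exp ((n + 4) * (k * r ^ 2)) * r ^ n / φ r ^ n) r
  dZ : ∀ r, R ≤ r → HasDerivAt Z ((n * (1 - (1 + 2 * (k * R ^ 2)) * exp (-(4 * (k * R ^ 2)))) +
    2 * (n + 4) * (k * R ^ 2)) / R * exp ((n + 4) * (k * r ^ 2)) * r ^ n) r

lemma du (k r : ℝ) : HasDerivAt (fun r : ℝ => k * r ^ 2) (2 * (k * r)) r := by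
  have := ((hasDerivAt_id r).pow 2).const_mul k
  convert! this using 1
  simp; ring

lemma dexp (a k r : ℝ) : HasDerivAt (fun r : ℝ => exp (a * (k * r ^ 2)))
    (exp (a * (k * r ^ 2)) * (a * (2 * (k * r)))) r :=
  ((du k r).const_mul a).exp

namespace Out
variable {n : ℕ} {k R : ℝ} {φ Z : ℝ → ℝ}

lemma dφN (h : Out n k R φ Z) (r : ℝ) (hr : R ≤ r) : HasDerivAt (fun r => φ r ^ (n + 1))
    ((n + 1) * ((1 + 2 * (k * R ^ 2)) * exp (-(3 * (k * R ^ 2))) *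
    exp ((n + 4) * (k * r ^ 2)) * r ^ n)) r := by
  have := (h.dφ r hr).pow (n + 1)
  have hp := h.φp r hr
  convert! this using 1
  push_cast; field_simp

lemma F1 (h : Out n k R φ Z) (r : ℝ) (hr : R ≤ r) : r * exp (k * r ^ 2) ≤ φ r := by
  have hR := h.hR
  have hk := h.hk
  have key := mono_of_hasDeriv (fun r => φ r ^ (n + 1) - r ^ (n + 1) * exp ((n + 1) * (k * r ^ 2)))
    (fun r => (n + 1) * r ^ n * (((1 + 2 * (k * R ^ 2)) * exp (-(3 * (k * R ^ 2)))) *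
    exp ((n + 4) * (k * r ^ 2)) - exp ((n + 1) * (k * r ^ 2)) * (1 + 2 * (k * r ^ 2)))) R r hr
    (by
      refine ContinuousOn.sub (fun x hx => ?_) (by fun_prop)
      exact (h.dφN x hx.1).continuousAt.continuousWithinAt)
    (by
      intro x hx
      convert! (h.dφN x hx.1.le).sub (((hasDerivAt_id x).pow (n + 1)).mul (dexp (n + 1) k x)) using 1
      push_cast; simp; ring)
    (by
      intro x hx
      have hx0 : 0 < x := hR.trans hx.1
      have h1 := gam_anti (k * R ^ 2) (k * x ^ 2) (by positivity)
        (by have := hx.1; gcongr)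
      have e : exp ((n + 4) * (k * x ^ 2)) * exp (-(3 * (k * x ^ 2))) = exp ((n + 1) * (k * x ^ 2)) := by
        rw [← exp_add]; ring_nf
      have : 0 ≤ ((1 + 2 * (k * R ^ 2)) * exp (-(3 * (k * R ^ 2)))) *
          exp ((n + 4) * (k * x ^ 2)) - exp ((n + 1) * (k * x ^ 2)) * (1 + 2 * (k * x ^ 2)) := by
        rw [← e]
        have := exp_pos ((n + 4) * (k * x ^ 2))
        nlinarith
      positivity)
  rw [h.φR] at key
  have e : ∀ r, (r * exp (k * r ^ 2)) ^ (n + 1) = r ^ (n + 1) * exp ((n + 1) * (k * r ^ 2)) := by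
    intro r; rw [mul_pow, ← exp_nat_mul]; push_cast; rfl
  rw [e R, sub_self, ← e r] at key
  exact le_of_pow_le_pow_left₀ (n := n + 1) (by simp) (h.φp r hr).le (by linarith)

lemma F2 (h : Out n k R φ Z) (r : ℝ) (hr : R ≤ r) : (1 + 2 * (k * r ^ 2)) * φ r ^ (n + 1) ≤
    (1 + 2 * (k * R ^ 2)) * exp (-(3 * (k * R ^ 2))) * exp ((n + 4) * (k * r ^ 2)) * r ^ (n + 1) := by
  have hR := h.hR
  have hk := h.hk
  set γ := (1 + 2 * (k * R ^ 2)) * exp (-(3 * (k * R ^ 2))) with hγ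
  have γp : 0 < γ := by positivity
  have key := mono_of_hasDeriv (fun r => γ * (exp ((n + 4) * (k * r ^ 2)) * r ^ (n + 1)) / (1 + 2 * (k * r ^ 2)) 
      - φ r ^ (n + 1))
    (fun r => γ * exp ((n + 4) * (k * r ^ 2)) * r ^ n * (2 * (k * r ^ 2) + 12 * (k * r ^ 2) ^ 2) / 
      (1 + 2 * (k * r ^ 2)) ^ 2) R r hr
    (by
      refine ContinuousOn.sub (ContinuousOn.div (by fun_prop) (by fun_prop) ?_) (fun x hx => ?_)
      · intro x _; positivity
      exact (h.dφN x hx.1).continuousAt.continuousWithinAt)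
    (by
      intro x hx
      have hx0 : 0 < x := hR.trans hx.1
      convert! ((((dexp (n + 4) k x).mul ((hasDerivAt_id x).pow (n + 1))).const_mul γ).div
        (((du k x).const_mul 2).const_add 1) (by positivity)).sub (h.dφN x hx.1.le) using 1
      push_cast; simp; rw [← hγ]; field_simp; ring)
    (by
      intro x hx
      have hx0 : 0 < x := hR.trans hx.1
      positivity)
  have e0 : γ * (exp ((n + 4) * (k * R ^ 2)) * R ^ (n + 1)) / (1 + 2 * (k * R ^ 2)) 
      - φ R ^ (n + 1) = 0 := by
    rw [h.φR, mul_pow, ← exp_nat_mul, hγ]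
    have e : exp ((n + 4) * (k * R ^ 2)) = exp (3 * (k * R ^ 2)) * exp ((n + 1 : ℕ) * (k * R ^ 2)) := by
      rw [← exp_add]; push_cast; ring_nf
    rw [e, exp_neg]
    field_simp; simp
  rw [e0, sub_nonneg, le_div_iff₀ (by positivity)] at key
  linarith

/-- `b = γ r/φ` bound -/
lemma b_le (h : Out n k R φ Z) (r : ℝ) (hr : R ≤ r) :
    (1 + 2 * (k * R ^ 2)) * exp (-(3 * (k * R ^ 2))) * r / φ r ≤
    (1 + 2 * (k * R ^ 2)) * exp (-(3 * (k * R ^ 2))) * exp (-(k * r ^ 2)) := by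
  have hR := h.hR
  have hk := h.hk
  have hr0 : 0 < r := hR.trans_le hr
  rw [div_le_iff₀ (h.φp r hr)]
  have h1 := h.F1 r hr
  have e : exp (-(k * r ^ 2)) * exp (k * r ^ 2) = 1 := by rw [← exp_add]; simp
  have : r ≤ exp (-(k * r ^ 2)) * φ r := by
    calc r = exp (-(k * r ^ 2)) * (r * exp (k * r ^ 2)) := by linear_combination (-r) * e
      _ ≤ _ := by gcongr
  rw [mul_assoc _ (exp (-(k * r ^ 2)))]
  gcongr

lemma b_le' (h : Out n k R φ Z) (r : ℝ) (hr : R ≤ r) :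
    (1 + 2 * (k * R ^ 2)) * exp (-(3 * (k * R ^ 2))) * r / φ r ≤
    (1 + 2 * (k * R ^ 2)) * exp (-(4 * (k * R ^ 2))) := by
  have hR := h.hR
  have hk := h.hk
  refine (h.b_le r hr).trans ?_
  rw [mul_assoc]
  gcongr
  rw [← exp_add]
  apply exp_le_exp.2
  have : k * R ^ 2 ≤ k * r ^ 2 := by gcongr
  linarith

lemma I1 (h : Out n k R φ Z) (r : ℝ) (hr : R ≤ r) :
    φ r ^ n + Z r ≤ exp ((n + 4) * (k * r ^ 2)) * r ^ n := by
  have hR := h.hR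
  have hk := h.hk
  have hn := h.hn
  obtain ⟨m, rfl⟩ : ∃ m, n = m + 1 := ⟨n - 1, by omega⟩
  set γ := (1 + 2 * (k * R ^ 2)) * exp (-(3 * (k * R ^ 2))) with hγ
  set D := 1 - (1 + 2 * (k * R ^ 2)) * exp (-(4 * (k * R ^ 2))) with hD
  have D2 : D ≤ 2 * (k * R ^ 2) := D_le _ (by positivity)
  have key := mono_of_hasDeriv (fun r => exp (((m + 1 : ℕ) + 4) * (k * r ^ 2)) * r ^ (m + 1) - (φ r ^ (m + 1) + Z r))
    (fun r => exp (((m + 1 : ℕ) + 4) * (k * r ^ 2)) * r ^ m * 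
      ((m + 1 : ℕ) + 2 * ((m + 1 : ℕ) + 4) * (k * r ^ 2) - (m + 1 : ℕ) * (γ * r / φ r) 
        - ((m + 1 : ℕ) * D + 2 * ((m + 1 : ℕ) + 4) * (k * R ^ 2)) / R * r)) R r hr
    (by
      refine ContinuousOn.sub (by fun_prop) (fun x hx => ?_)
      exact (((h.dφ x hx.1).pow _).add (h.dZ x hx.1)).continuousAt.continuousWithinAt)
    (by
      intro x hx
      have hx0 : 0 < x := hR.trans hx.1
      have hp := h.φp x hx.1.le
      convert! ((dexp ((m + 1 : ℕ) + 4) k x).mul ((hasDerivAt_id x).pow (m + 1))).sub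
        (((h.dφ x hx.1.le).pow _).add (h.dZ x hx.1.le)) using 1
      push_cast; simp; rw [hγ, hD]; field_simp; ring)
    (by
      intro x hx
      have hx0 : 0 < x := hR.trans hx.1
      have hb := h.b_le' x hx.1.le
      rw [← hγ] at hb
      have hb' : γ * x / φ x ≤ 1 - D := by rw [hD]; linarith
      have h1 : 0 ≤ ((m + 1 : ℕ) + 2 * ((m + 1 : ℕ) + 4) * (k * x ^ 2) - (m + 1 : ℕ) * (1 - D)
        - ((m + 1 : ℕ) * D + 2 * ((m + 1 : ℕ) + 4) * (k * R ^ 2)) / R * x) := by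
        have : ((m + 1 : ℕ) + 2 * ((m + 1 : ℕ) + 4) * (k * x ^ 2) - (m + 1 : ℕ) * (1 - D)
          - ((m + 1 : ℕ) * D + 2 * ((m + 1 : ℕ) + 4) * (k * R ^ 2)) / R * x) =
          (x / R - 1) * (2 * ((m + 1 : ℕ) + 4) * (k * R ^ 2) * (x / R) - (m + 1 : ℕ) * D) := by
          field_simp; ring
        rw [this]
        have hx1 : 1 ≤ x / R := (one_le_div hR).2 hx.1.le
        apply mul_nonneg (by linarith)
        have a1 : 2 * ((m + 1 : ℕ) + 4) * (k * R ^ 2) ≤ 2 * ((m + 1 : ℕ) + 4) * (k * R ^ 2) * (x / R) :=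
          le_mul_of_one_le_right (by positivity) hx1
        have a2 : ((m + 1 : ℕ):ℝ) * D ≤ (m + 1 : ℕ) * (2 * (k * R ^ 2)) := by gcongr
        have a3 : 0 < k * R ^ 2 := by positivity
        nlinarith
      have h2 : ((m + 1 : ℕ):ℝ) * (γ * x / φ x) ≤ (m + 1 : ℕ) * (1 - D) := by gcongr
      apply mul_nonneg (by positivity)
      linarith)
  have e0 : exp (((m + 1 : ℕ) + 4) * (k * R ^ 2)) * R ^ (m + 1) - (φ R ^ (m + 1) + Z R) = 0 := by
    rw [h.φR, h.ZR, mul_pow, ← exp_nat_mul]; ring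
  rw [e0] at key
  linarith

end Out
end BQ

namespace BQ
open Real

noncomputable def gm (k R : ℝ) : ℝ := (1 + 2 * (k * R ^ 2)) * exp (-(3 * (k * R ^ 2)))
noncomputable def dd (k R : ℝ) : ℝ := 1 - (1 + 2 * (k * R ^ 2)) * exp (-(4 * (k * R ^ 2)))
noncomputable def bb (k R : ℝ) (φ : ℝ → ℝ) (r : ℝ) : ℝ := gm k R * r / φ r
noncomputable def la (n : ℕ) (k R : ℝ) (φ : ℝ → ℝ) (r : ℝ) : ℝ :=
  gm k R * exp ((n + 4) * (k * r ^ 2)) * r ^ (n + 1) / φ r ^ (n + 1)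

lemma one_sub_sq (b : ℝ) (h0 : 0 < b) (h1 : b < 1) : 0 ≤ 1 - b ^ 2 := by nlinarith

lemma four_sub (u U D : ℝ) (h0 : 0 < U) (h1 : U ≤ u) (h2 : 0 ≤ D) (h3 : D ≤ 2 * U) :
    0 ≤ 4 * u * U - D ^ 2 := by nlinarith

namespace Out
variable {n : ℕ} {k R : ℝ} {φ Z : ℝ → ℝ}

lemma gm_pos (h : Out n k R φ Z) : 0 < gm k R := by
  have := h.hk; have := h.hR; unfold gm; positivity

lemma dbb (h : Out n k R φ Z) (r : ℝ) (hr : R ≤ r) :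
    HasDerivAt (bb k R φ) (bb k R φ r * (1 - la n k R φ r) / r) r := by
  have hr0 : 0 < r := h.hR.trans_le hr
  have hp := h.φp r hr
  have := ((hasDerivAt_id r).const_mul (gm k R)).div (h.dφ r hr) hp.ne'
  convert! this using 1
  rw [bb, la, gm]; simp only [id]; field_simp; ring

lemma dla (h : Out n k R φ Z) (r : ℝ) (hr : R ≤ r) :
    HasDerivAt (la n k R φ) (la n k R φ r * (2 * (n + 4) * (k * r ^ 2) - (n + 1) * (la n k R φ r - 1)) / r) r := by
  have hr0 : 0 < r := h.hR.trans_le hr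
  have hp := h.φp r hr
  have := (((dexp (n + 4) k r).const_mul (gm k R)).mul ((hasDerivAt_id r).pow (n + 1))).div
    (h.dφN r hr) (by positivity)
  convert! this using 1
  rw [la, gm]; push_cast; simp only [id]; field_simp; simp; ring

lemma la_ge (h : Out n k R φ Z) (r : ℝ) (hr : R ≤ r) : 1 + 2 * (k * r ^ 2) ≤ la n k R φ r := by
  have hp := h.φp r hr
  rw [la, le_div_iff₀ (by positivity)]
  exact h.F2 r hr

lemma bb_pos (h : Out n k R φ Z) (r : ℝ) (hr : R ≤ r) : 0 < bb k R φ r := by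
  have hr0 : 0 < r := h.hR.trans_le hr
  have hp := h.φp r hr
  have := h.gm_pos
  unfold bb; positivity

lemma upos (h : Out n k R φ Z) (r : ℝ) (hr : R ≤ r) : 0 < k * r ^ 2 := by
  have hr0 : 0 < r := h.hR.trans_le hr
  have := h.hk; positivity

lemma uU (h : Out n k R φ Z) (r : ℝ) (hr : R ≤ r) : k * R ^ 2 ≤ k * r ^ 2 := by
  have := h.hk; have := h.hR; gcongr

lemma e4 (v : ℝ) (hv : 0 < v) : exp (-(4 * v)) < 1 := by
  rw [exp_lt_one_iff]; linarith

/-- b < 1 -/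
lemma bb_lt (h : Out n k R φ Z) (r : ℝ) (hr : R ≤ r) : bb k R φ r < 1 := by
  refine lt_of_le_of_lt (h.b_le' r hr) ?_
  have U := h.upos R le_rfl
  have h1 := sq_exp (k * R ^ 2) U.le
  have := exp_pos (-(4 * (k * R ^ 2)))
  nlinarith

lemma la_R (h : Out n k R φ Z) : la n k R φ R = 1 + 2 * (k * R ^ 2) := by
  have hR := h.hR
  rw [la, h.φR, mul_pow, ← exp_nat_mul, gm]
  have e : exp ((n + 4) * (k * R ^ 2)) = exp (3 * (k * R ^ 2)) * exp ((n + 1 : ℕ) * (k * R ^ 2)) := by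
    rw [← exp_add]; push_cast; ring_nf
  rw [e, exp_neg]
  field_simp

lemma bb_R (h : Out n k R φ Z) : bb k R φ R = (1 + 2 * (k * R ^ 2)) * exp (-(4 * (k * R ^ 2))) := by
  have hR := h.hR
  rw [bb, h.φR, gm]
  have e : exp (-(4 * (k * R ^ 2))) = exp (-(3 * (k * R ^ 2))) / exp (k * R ^ 2) := by
    rw [← exp_sub]; ring_nf
  rw [e]
  field_simp

lemma a_ge (h : Out n k R φ Z) (r : ℝ) (hr : R ≤ r) :
    R ^ 2 * (1 - ((la n k R φ r)⁻¹) ^ 2) ≤ r ^ 2 * (1 - bb k R φ r ^ 2) := by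
  have hR := h.hR
  have hk := h.hk
  have lap : ∀ x, R ≤ x → 0 < la n k R φ x := fun x hx => by
    have := h.la_ge x hx; have := h.upos x hx; linarith
  have key := mono_of_hasDeriv (fun r => r ^ 2 * (1 - bb k R φ r ^ 2) - R ^ 2 * (1 - ((la n k R φ r)⁻¹) ^ 2))
    (fun r => 2 * r * (1 - bb k R φ r ^ 2 + bb k R φ r ^ 2 * (la n k R φ r - 1)) 
      - 2 * R ^ 2 * ((la n k R φ r)⁻¹) ^ 2 * (2 * (n + 4) * (k * r ^ 2) - (n + 1) * (la n k R φ r - 1)) / r) R r hr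
    (by
      intro x hx
      have := (h.dbb x hx.1).continuousAt
      have := (h.dla x hx.1).continuousAt
      have := (lap x hx.1).ne'
      apply ContinuousAt.continuousWithinAt
      fun_prop (disch := assumption))
    (by
      intro x hx
      have hx0 : 0 < x := hR.trans hx.1
      have hl := lap x hx.1.le
      convert! (((hasDerivAt_id x).pow 2).mul (((h.dbb x hx.1.le).pow 2).const_sub 1)).sub
        (((((h.dla x hx.1.le).inv hl.ne').pow 2).const_sub 1).const_mul (R ^ 2)) using 1
      simp; field_simp; ring)
    (by
      intro x hx
      have hx0 : 0 < x := hR.trans hx.1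
      have hl := lap x hx.1.le
      have hlu := h.la_ge x hx.1.le
      have hU := h.upos R le_rfl
      have hu := h.upos x hx.1.le
      have huU := h.uU x hx.1.le
      have hb := h.bb_pos x hx.1.le
      have hb' : bb k R φ x ≤ (1 + 2 * (k * R ^ 2)) * exp (-(4 * (k * R ^ 2))) := h.b_le' x hx.1.le
      have hb1 := h.bb_lt x hx.1.le
      set b := bb k R φ x
      set l := la n k R φ x
      set U := k * R ^ 2
      have hz : (l⁻¹) ^ 2 ≤ ((1 + 2 * U)⁻¹) ^ 2 := by gcongr; linarith
      have main : 6 * U * (l⁻¹) ^ 2 ≤ 1 - b ^ 2 + b ^ 2 * (l - 1) := by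
        rcases le_or_gt 2 l with h2 | h2
        · have a1 : 6 * U * (l⁻¹) ^ 2 ≤ 6 * U * ((1 + 2 * U)⁻¹) ^ 2 := by gcongr
          have a2 : 6 * U * ((1 + 2 * U)⁻¹) ^ 2 ≤ 1 := by
            rw [inv_pow, ← div_eq_mul_inv, div_le_one (by positivity)]; nlinarith [sq_nonneg (2 * U - 1)]
          have a3 : b ^ 2 ≤ b ^ 2 * (l - 1) := le_mul_of_one_le_right (by positivity) (by linarith)
          linarith
        · have T1 : 2 * U < 1 := by linarith
          have s := sq_exp U hU.le
          have a1 : b ^ 2 ≤ ((1 + 2 * U)⁻¹) ^ 2 := by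
            gcongr
            refine hb'.trans ?_
            rw [inv_eq_one_div, le_div_iff₀ (by positivity)]; linarith
          have a2 : 6 * U * (l⁻¹) ^ 2 ≤ 6 * U * ((1 + 2 * U)⁻¹) ^ 2 := by gcongr
          have a3 : b ^ 2 * (2 - l) ≤ ((1 + 2 * U)⁻¹) ^ 2 * (1 - 2 * U) := by
            apply mul_le_mul a1 (by linarith) (by linarith) (by positivity)
          have a4 : ((1 + 2 * U)⁻¹) ^ 2 * (1 - 2 * U) + 6 * U * ((1 + 2 * U)⁻¹) ^ 2 ≤ 1 := by
            have : ((1 + 2 * U)⁻¹) ^ 2 * (1 - 2 * U) + 6 * U * ((1 + 2 * U)⁻¹) ^ 2 = (1 + 4 * U) / (1 + 2 * U) ^ 2 := by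
              field_simp; ring
            rw [this, div_le_one (by positivity)]; nlinarith
          nlinarith
      have m2 : 2 * (n + 4) * (k * x ^ 2) - (n + 1) * (l - 1) ≤ 6 * (k * x ^ 2) := by
        have : ((n:ℝ) + 1) * (2 * (k * x ^ 2)) ≤ (n + 1) * (l - 1) := by gcongr; linarith
        linarith
      rw [sub_nonneg, div_le_iff₀ hx0]
      calc 2 * R ^ 2 * (l⁻¹) ^ 2 * (2 * (n + 4) * (k * x ^ 2) - (n + 1) * (l - 1)) ≤
          2 * R ^ 2 * (l⁻¹) ^ 2 * (6 * (k * x ^ 2)) := by gcongr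
        _ = 2 * x * (6 * U * (l⁻¹) ^ 2) * x := by simp only [U]; ring
        _ ≤ _ := by gcongr)
  have e0 : 0 ≤ R ^ 2 * (1 - bb k R φ R ^ 2) - R ^ 2 * (1 - ((la n k R φ R)⁻¹) ^ 2) := by
    have : bb k R φ R ≤ (la n k R φ R)⁻¹ := by
      have hU := h.upos R le_rfl
      rw [h.bb_R, h.la_R, inv_eq_one_div, le_div_iff₀ (by positivity)]
      have := sq_exp (k * R ^ 2) hU.le
      linarith
    have h2 : bb k R φ R ^ 2 ≤ ((la n k R φ R)⁻¹) ^ 2 := by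
      have := h.bb_pos R le_rfl
      gcongr
    nlinarith [sq_nonneg R]
  linarith

set_option maxHeartbeats 600000 in
/-- the `n`-part: squared form -/
lemma n_part (h : Out n k R φ Z) (r : ℝ) (hr : R ≤ r) (hbl : 1 < bb k R φ r * la n k R φ r) :
    (r / R) ^ 2 * (dd k R + 2 * (k * R ^ 2)) ^ 2 * (1 - ((la n k R φ r)⁻¹) ^ 2) ≤
    (1 - bb k R φ r ^ 2) * (1 - (la n k R φ r)⁻¹ + 2 * (k * r ^ 2)) ^ 2 := by
  have hR := h.hR
  have hk := h.hk
  have hr0 : 0 < r := hR.trans_le hr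
  have hlu := h.la_ge r hr
  have hU := h.upos R le_rfl
  have hu := h.upos r hr
  have huU := h.uU r hr
  have hb := h.bb_pos r hr
  have hb1 := h.bb_lt r hr
  have hb' : bb k R φ r ≤ 1 - dd k R := by rw [dd]; have := h.b_le' r hr; rw [bb, gm]; linarith
  have hbeta : bb k R φ r ≤ gm k R * exp (-(k * r ^ 2)) := h.b_le r hr
  have hD0 : 0 ≤ dd k R := by have := D_nonneg _ hU.le; rw [dd]; linarith
  have hD2 : dd k R ≤ 2 * (k * R ^ 2) := D_le _ hU.le
  have hx2 : (r / R) ^ 2 * (k * R ^ 2) = k * r ^ 2 := by field_simp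
  set b := bb k R φ r
  set l := la n k R φ r
  set U := k * R ^ 2
  set u := k * r ^ 2 
  set D := dd k R
  set z := l⁻¹ with hzdef
  have hl : 0 < l := by linarith
  have hz : 0 < z := by positivity
  have hzl : z * l = 1 := inv_mul_cancel₀ hl.ne'
  have hzb : z < b := by
    have : z * 1 < z * (b * l) := by gcongr
    nlinarith
  have hzu : z * (1 + 2 * u) ≤ 1 := by nlinarith
  have hz1 : z < 1 := hzb.trans hb1
  -- reduce to (D + 2u)-type inequalities
  have red : (r / R) ^ 2 * (D + 2 * U) ^ 2 ≤ (D + 2 * u) ^ 2 := by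
    have : U * ((r / R) ^ 2 * (D + 2 * U) ^ 2) ≤ U * (D + 2 * u) ^ 2 := by
      have e : U * ((r / R) ^ 2 * (D + 2 * U) ^ 2) = u * (D + 2 * U) ^ 2 := by rw [← hx2]; ring
      rw [e]
      have : 0 ≤ (u - U) * (4 * u * U - D ^ 2) :=
        mul_nonneg (by linarith) (four_sub u U D hU huU hD0 hD2)
      linarith
    exact le_of_mul_le_mul_left this hU
  rcases le_or_gt (b * (1 + 2 * u)) 1 with hc | hc
  · have mono : (1 - b + 2 * u) ^ 2 * (1 - z ^ 2) ≤ (1 - b ^ 2) * (1 - z + 2 * u) ^ 2 := by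
      have : (1 - b ^ 2) * (1 - z + 2 * u) ^ 2 - (1 - b + 2 * u) ^ 2 * (1 - z ^ 2) =
        (b - z) * ((1 + 2 * u - z) * (1 - b * (1 + 2 * u)) + (1 + 2 * u - b) * (1 - z * (1 + 2 * u))) := by
        ring
      have : 0 ≤ (b - z) * ((1 + 2 * u - z) * (1 - b * (1 + 2 * u)) + (1 + 2 * u - b) * (1 - z * (1 + 2 * u))) := by
        apply mul_nonneg (by linarith)
        apply add_nonneg <;> apply mul_nonneg <;> linarith
      linarith
    refine le_trans ?_ mono
    apply mul_le_mul_of_nonneg_right _ (one_sub_sq _ hz hz1)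
    refine red.trans ?_
    gcongr
    linarith
  · -- second case
    have q : 4 * u * (1 + u) * (1 - z ^ 2) ≤ (1 - z + 2 * u) ^ 2 := by
      nlinarith [sq_nonneg (1 - (1 + 2 * u) * z)]
    have hgm := h.gm_pos
    obtain ⟨v, ⟨hv1, hv2⟩, hv⟩ : ∃ v ∈ Icc U u, (1 + 2 * v) * (gm k R * exp (-v)) = 1 := by
      have ic := intermediate_value_Icc (f := fun v => (1 + 2 * v) * (gm k R * exp (-v))) huU
        (by fun_prop)
      apply ic
      constructor
      · have := sq_exp U hU.le
        have e : (1 + 2 * U) * (gm k R * exp (-U)) = (1 + 2 * U) ^ 2 * exp (-(4 * U)) := by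
          have : exp (-(4 * U)) = exp (-(3 * U)) * exp (-U) := by rw [← exp_add]; ring_nf
          rw [this, gm]; ring
        rw [e]; exact this
      · have : b * (1 + 2 * u) ≤ gm k R * exp (-u) * (1 + 2 * u) := by gcongr
        linarith
    have hv0 : 0 < v := by linarith
    set β := gm k R * exp (-v) with hβ
    have hβp : 0 < β := by positivity
    have hβD : β ≤ 1 - D := by
      have : gm k R * exp (-v) ≤ gm k R * exp (-U) := by gcongr
      refine this.trans (le_of_eq ?_)
      have : exp (-(4 * U)) = exp (-(3 * U)) * exp (-U) := by rw [← exp_add]; ring_nf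
      simp only [D]; rw [dd, this, gm]; ring
    have hbβ : b ≤ β := by
      refine hbeta.trans ?_
      rw [hβ]; gcongr
    have hβv : β = 1 / (1 + 2 * v) := by rw [eq_div_iff (by positivity)]; linarith
    have id1 : 4 * (1 - β ^ 2) * (1 + v) * v = (1 - β + 2 * v) ^ 2 := by
      rw [hβv]; field_simp; ring
    have i2 : (D + 2 * U) ^ 2 * v ≤ (1 - β + 2 * v) ^ 2 * U := by
      have a1 : (D + 2 * v) ^ 2 ≤ (1 - β + 2 * v) ^ 2 := by gcongr; linarith
      have : 0 ≤ (v - U) * (4 * v * U - D ^ 2) :=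
        mul_nonneg (by linarith) (four_sub v U D hU hv1 hD0 hD2)
      have a2 := mul_le_mul_of_nonneg_right a1 hU.le
      linarith
    have i3 : (D + 2 * U) ^ 2 ≤ 4 * (1 - β ^ 2) * (1 + v) * U := by
      have : (D + 2 * U) ^ 2 * v ≤ 4 * (1 - β ^ 2) * (1 + v) * U * v := by
        rw [← id1] at i2; linarith
      exact le_of_mul_le_mul_right this hv0
    have hβ1 : β < 1 := by rw [hβv, div_lt_one (by positivity)]; linarith
    have i4 : 4 * (1 - β ^ 2) * (1 + v) * U ≤ 4 * (1 - b ^ 2) * (1 + u) * U := by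
      have : 0 ≤ 1 - β ^ 2 := one_sub_sq _ hβp hβ1
      have : 0 ≤ 1 - b ^ 2 := one_sub_sq _ hb hb1
      gcongr
    have z2 : 0 ≤ 1 - z ^ 2 := one_sub_sq _ hz hz1
    have b2 : 0 ≤ 1 - b ^ 2 := one_sub_sq _ hb hb1
    calc (r / R) ^ 2 * (D + 2 * U) ^ 2 * (1 - z ^ 2) 
        ≤ (r / R) ^ 2 * (4 * (1 - b ^ 2) * (1 + u) * U) * (1 - z ^ 2) := by
          gcongr; exact i3.trans i4
      _ = (1 - b ^ 2) * (4 * u * (1 + u) * (1 - z ^ 2)) := by rw [← hx2]; ring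
      _ ≤ _ := by gcongr

end Out
end BQ

namespace BQ
open Real

lemma pw_case1 (E b g p t : ℝ) (hE : 0 ≤ E) (hb : b ^ 2 ≤ E) (hg0 : 0 ≤ g)
    (hg : E + g ≤ 1) : sqrt ((E * p) ^ 2 + (b * t) ^ 2) + g * p ≤ sqrt (p ^ 2 + t ^ 2) := by
  set ρ := sqrt (p ^ 2 + t ^ 2) with hρ
  have hρ2 : ρ ^ 2 = p ^ 2 + t ^ 2 := sq_sqrt (by positivity)
  have hρ0 : 0 ≤ ρ := sqrt_nonneg _
  have hpρ : |p| ≤ ρ := abs_le_sqrt (by nlinarith [sq_nonneg t])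
  have hp := abs_le.1 hpρ
  have hE1 : E ≤ 1 := by linarith
  have hb2 : (b * t) ^ 2 ≤ E * t ^ 2 := by rw [mul_pow]; gcongr
  have hnn : 0 ≤ ρ - g * p := by
    have : g * p ≤ 1 * ρ := by
      rcases le_or_gt 0 p with h | h
      · apply mul_le_mul (by linarith) hp.2 h (by norm_num)
      · nlinarith
    linarith
  have : sqrt ((E * p) ^ 2 + (b * t) ^ 2) ≤ ρ - g * p := by
    rw [sqrt_le_left hnn]
    rcases le_or_gt 0 p with h | h
    · have h1 : ρ - (1 - E) * p ≤ ρ - g * p := by nlinarith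
      have h2 : 0 ≤ ρ - (1 - E) * p := by nlinarith
      have h3 : (ρ - (1 - E) * p) ^ 2 ≤ (ρ - g * p) ^ 2 := by gcongr
      have h4 : 0 ≤ (1 - E) * (ρ - p) ^ 2 := by apply mul_nonneg <;> [linarith; positivity]
      nlinarith
    · have h1 : ρ ≤ ρ - g * p := by nlinarith
      have h3 : ρ ^ 2 ≤ (ρ - g * p) ^ 2 := by gcongr
      have h4 : E * t ^ 2 ≤ 1 * t ^ 2 := by gcongr
      have h5 : E ^ 2 ≤ 1 := by nlinarith
      have h6 : E ^ 2 * p ^ 2 ≤ 1 * p ^ 2 := by gcongr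
      rw [mul_pow]
      linarith
  linarith

lemma pw_case2 (z b g p t : ℝ) (hz0 : 0 < z) (hz : z < 1) (hb0 : 0 < b) (hb : b < 1) (hg0 : 0 ≤ g)
    (hg : g ^ 2 ≤ (1 - b ^ 2) * (1 - z ^ 2)) :
    sqrt ((b * z * p) ^ 2 + (b * t) ^ 2) + g * p ≤ sqrt (p ^ 2 + t ^ 2) := by
  set ρ := sqrt (p ^ 2 + t ^ 2) with hρ
  have hρ2 : ρ ^ 2 = p ^ 2 + t ^ 2 := sq_sqrt (by positivity)
  have hρ0 : 0 ≤ ρ := sqrt_nonneg _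
  have hpρ : |p| ≤ ρ := abs_le_sqrt (by nlinarith [sq_nonneg t])
  have hp := abs_le.1 hpρ
  have hb2 : 0 < 1 - b ^ 2 := by nlinarith
  have hz2 : 0 < 1 - z ^ 2 := by nlinarith
  have hg1 : g ≤ 1 := by
    have : (1 - b ^ 2) * (1 - z ^ 2) ≤ 1 * 1 := by gcongr <;> nlinarith
    nlinarith
  have hnn : 0 ≤ ρ - g * p := by
    have : g * p ≤ 1 * ρ := by
      rcases le_or_gt 0 p with h | h
      · apply mul_le_mul (by linarith) hp.2 h (by norm_num)
      · nlinarith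
    linarith
  have : sqrt ((b * z * p) ^ 2 + (b * t) ^ 2) ≤ ρ - g * p := by
    rw [sqrt_le_left hnn]
    have h1 : g ^ 2 * p ^ 2 ≤ (1 - b ^ 2) * (1 - z ^ 2) * p ^ 2 := by gcongr
    -- multiply by (1 - b^2)
    have h2 : 0 ≤ (1 - b ^ 2) * ((ρ - g * p) ^ 2 - ((b * z * p) ^ 2 + (b * t) ^ 2)) := by
      have t2 : t ^ 2 = ρ ^ 2 - p ^ 2 := by linarith
      have e : (1 - b ^ 2) * ((ρ - g * p) ^ 2 - ((b * z * p) ^ 2 + (b * t) ^ 2)) =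
        ((1 - b ^ 2) * ρ - g * p) ^ 2 + b ^ 2 * ((1 - b ^ 2) * (1 - z ^ 2) * p ^ 2 - g ^ 2 * p ^ 2) := by
        rw [mul_pow b t, t2]; ring
      rw [e]
      have : 0 ≤ b ^ 2 * ((1 - b ^ 2) * (1 - z ^ 2) * p ^ 2 - g ^ 2 * p ^ 2) :=
        mul_nonneg (by positivity) (by linarith)
      positivity
    have := nonneg_of_mul_nonneg_right h2 hb2
    linarith
  linarith

namespace Out
variable {n : ℕ} {k R : ℝ} {φ Z : ℝ → ℝ}

lemma key_ineq (b z l u U D x n s t r R : ℝ) (hn : 0 ≤ n) (hs : 0 ≤ s) (ht : 0 ≤ t) (hs2 : s ^ 2 = 1 - b ^ 2)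
    (ht2 : t ^ 2 = 1 - z ^ 2) (hzl : z * l = 1) (hl : 1 ≤ l) (hzb : z ^ 2 ≤ b ^ 2) (hu : 0 ≤ u)
    (hr : 0 < r) (hR : 0 < R) (hx : x = r / R) (hux : U * x ^ 2 = u)
    (h1 : x * (D + 2 * U) * t ≤ s * (1 - z + 2 * u)) (h2 : R * t ≤ r * s) :
    x * (n * D + 2 * (n + 4) * U) * (s * t) ≤ (n + 2 * (n + 4) * u) * (s ^ 2 * t ^ 2) +
      (b ^ 2 * (l - 1) * t ^ 2 + z ^ 2 * (2 * (n + 4) * u - (n + 1) * (l - 1)) * s ^ 2) := by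
  have e : (n + 2 * (n + 4) * u) * (s ^ 2 * t ^ 2) +
      (b ^ 2 * (l - 1) * t ^ 2 + z ^ 2 * (2 * (n + 4) * u - (n + 1) * (l - 1)) * s ^ 2) =
      s ^ 2 * (2 * (n + 4) * u + n * (1 - z)) + (l - 1) * (b ^ 2 - z ^ 2) := by
    rw [ht2]
    have hb : b ^ 2 = 1 - s ^ 2 := by linarith
    rw [hb]
    linear_combination (-n * s ^ 2 * z) * hzl
  rw [e]
  have a1 : 0 ≤ (l - 1) * (b ^ 2 - z ^ 2) := mul_nonneg (by linarith) (by linarith)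
  have a2 : n * s * (x * (D + 2 * U) * t) ≤ n * s * (s * (1 - z + 2 * u)) := by gcongr
  have xt : U * x * t ≤ u * s := by
    have hx0 : 0 < x := by rw [hx]; positivity
    have : t ≤ x * s := by
      rw [hx, div_mul_eq_mul_div, le_div_iff₀ hR]; linarith
    have hU : 0 ≤ U := by
      by_contra hc
      have : U * x ^ 2 < 0 := mul_neg_of_neg_of_pos (by linarith) (by positivity)
      linarith
    calc U * x * t ≤ U * x * (x * s) := by gcongr
      _ = u * s := by rw [← hux]; ring
  have a3 : 8 * s * (U * x * t) ≤ 8 * s * (u * s) := by gcongr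
  nlinarith

lemma I2 (h : Out n k R φ Z) (r : ℝ) (hr : R ≤ r) (hbl : 1 < bb k R φ r * la n k R φ r) :
    Z r ≤ exp ((n + 4) * (k * r ^ 2)) * r ^ n *
      (sqrt (1 - bb k R φ r ^ 2) * sqrt (1 - ((la n k R φ r)⁻¹) ^ 2)) := by
  have hR := h.hR
  have hk := h.hk
  have cb : ContinuousOn (fun x => bb k R φ x * la n k R φ x) (Icc R r) := fun x hx =>
    ((h.dbb x hx.1).continuousAt.mul (h.dla x hx.1).continuousAt).continuousWithinAt
  have hcomp : IsCompact {x ∈ Icc R r | bb k R φ x * la n k R φ x ≤ 1} := by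
    have : {x ∈ Icc R r | bb k R φ x * la n k R φ x ≤ 1} =
      Icc R r ∩ (fun x => bb k R φ x * la n k R φ x) ⁻¹' Iic 1 := rfl
    rw [this]
    exact isCompact_Icc.of_isClosed_subset (cb.preimage_isClosed_of_isClosed isClosed_Icc isClosed_Iic)
      inter_subset_left
  have hRS : bb k R φ R * la n k R φ R ≤ 1 := by
    rw [h.bb_R, h.la_R]
    have := sq_exp (k * R ^ 2) (h.upos R le_rfl).le
    linarith
  obtain ⟨s, ⟨⟨hs1, hs2⟩, hs3⟩, hsm⟩ := hcomp.exists_isGreatest ⟨R, ⟨le_rfl, hr⟩, hRS⟩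
  have hseq : bb k R φ s * la n k R φ s = 1 := by
    obtain ⟨x, hx, hx1⟩ := intermediate_value_Icc hs2 (cb.mono (Icc_subset_Icc_left hs1)) ⟨hs3, hbl.le⟩
    have hx2 : x ≤ s := hsm ⟨⟨hs1.trans hx.1, hx.2⟩, hx1.le⟩
    have : x = s := le_antisymm hx2 hx.1
    rw [← this]; exact hx1
  have hgt : ∀ x, s < x → x ≤ r → 1 < bb k R φ x * la n k R φ x := by
    intro x hx hxr
    by_contra hc
    exact absurd (hsm ⟨⟨hs1.trans hx.le, hxr⟩, not_lt.1 hc⟩) (not_le.2 hx)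
  have lap : ∀ x, R ≤ x → 1 < la n k R φ x := fun x hx => by
    have := h.la_ge x hx; have := h.upos x hx; linarith
  have z1 : ∀ x, R ≤ x → 0 < 1 - ((la n k R φ x)⁻¹) ^ 2 := fun x hx => by
    have h1 := lap x hx
    have h2 : (la n k R φ x)⁻¹ < 1 := inv_lt_one_of_one_lt₀ h1
    have h3 : 0 < (la n k R φ x)⁻¹ := by positivity
    nlinarith
  have b1 : ∀ x, R ≤ x → 0 < 1 - bb k R φ x ^ 2 := fun x hx => by
    have h1 := h.bb_lt x hx
    have h3 := h.bb_pos x hx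
    nlinarith
  set C := ((n * (1 - (1 + 2 * (k * R ^ 2)) * exp (-(4 * (k * R ^ 2)))) +
    2 * (n + 4) * (k * R ^ 2)) / R) with hC
  have key := mono_of_hasDeriv (fun x => exp ((n + 4) * (k * x ^ 2)) * x ^ n *
      (sqrt (1 - bb k R φ x ^ 2) * sqrt (1 - ((la n k R φ x)⁻¹) ^ 2)) - Z x)
    (fun x => exp ((n + 4) * (k * x ^ 2)) * x ^ n / (x * (sqrt (1 - bb k R φ x ^ 2) * sqrt (1 - ((la n k R φ x)⁻¹) ^ 2))) *
      (((n + 2 * (n + 4) * (k * x ^ 2)) * (sqrt (1 - bb k R φ x ^ 2) ^ 2 * sqrt (1 - ((la n k R φ x)⁻¹) ^ 2) ^ 2) +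
        (bb k R φ x ^ 2 * (la n k R φ x - 1) * sqrt (1 - ((la n k R φ x)⁻¹) ^ 2) ^ 2 + ((la n k R φ x)⁻¹) ^ 2 * 
          (2 * (n + 4) * (k * x ^ 2) - (n + 1) * (la n k R φ x - 1)) * sqrt (1 - bb k R φ x ^ 2) ^ 2))
        - C * x * (sqrt (1 - bb k R φ x ^ 2) * sqrt (1 - ((la n k R φ x)⁻¹) ^ 2)))) s r hs2
    (by
      intro x hx
      have hRx := hs1.trans hx.1
      have := (h.dbb x hRx).continuousAt
      have := (h.dla x hRx).continuousAt
      have := (h.dZ x hRx).continuousAt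
      have : la n k R φ x ≠ 0 := by have := lap x hRx; positivity
      apply ContinuousAt.continuousWithinAt
      fun_prop (disch := assumption))
    (by
      intro x hx
      have hRx := hs1.trans hx.1.le
      have hx0 : 0 < x := hR.trans_le hRx
      have hl := lap x hRx
      have hl0 : la n k R φ x ≠ 0 := by positivity
      have p1 := sqrt_pos.2 (b1 x hRx)
      have p2 := sqrt_pos.2 (z1 x hRx)
      obtain ⟨m, rfl⟩ : ∃ m, n = m + 1 := ⟨n - 1, by have := h.hn; omega⟩
      have d1 := (((h.dbb x hRx).pow 2).const_sub 1).sqrt (b1 x hRx).ne'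
      have d2 := ((((h.dla x hRx).inv hl0).pow 2).const_sub 1).sqrt (z1 x hRx).ne'
      convert! (((dexp ((m + 1 : ℕ) + 4) k x).mul ((hasDerivAt_id x).pow (m + 1))).mul (d1.mul d2)).sub (h.dZ x hRx) using 1
      simp only [Pi.inv_apply, Pi.pow_apply, Pi.mul_apply, id]
      rw [hC]
      generalize sqrt (1 - bb k R φ x ^ 2) = S at *
      generalize sqrt (1 - (la (m + 1) k R φ x)⁻¹ ^ 2) = T at *
      generalize la (m + 1) k R φ x = l at *
      generalize bb k R φ x = b at *
      push_cast
      simp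
      field_simp
      ring)
    (by
      intro x hx
      have hRx := hs1.trans hx.1.le
      have hx0 : 0 < x := hR.trans_le hRx
      have hl := lap x hRx
      have p1 := sqrt_pos.2 (b1 x hRx)
      have p2 := sqrt_pos.2 (z1 x hRx)
      have hbl' := hgt x hx.1 hx.2.le
      have np := h.n_part x hRx hbl'
      have ag := h.a_ge x hRx
      have hu := h.upos x hRx
      have hU := h.upos R le_rfl
      have hD0 : 0 ≤ dd k R := by have := D_nonneg _ hU.le; rw [dd]; linarith
      have hzz : 0 < (la n k R φ x)⁻¹ := by positivity
      have hz1 : (la n k R φ x)⁻¹ < 1 := inv_lt_one_of_one_lt₀ hl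
      have hzl : (la n k R φ x)⁻¹ * la n k R φ x = 1 := inv_mul_cancel₀ (by positivity)
      have hbpos := h.bb_pos x hRx
      have hzb : (la n k R φ x)⁻¹ ≤ bb k R φ x := by
        rw [inv_eq_one_div, div_le_iff₀ (by positivity)]; exact hbl'.le
      apply mul_nonneg (by positivity)
      have := key_ineq (bb k R φ x) (la n k R φ x)⁻¹ (la n k R φ x) (k * x ^ 2) (k * R ^ 2) (dd k R) (x / R) n
        (sqrt (1 - bb k R φ x ^ 2)) (sqrt (1 - ((la n k R φ x)⁻¹) ^ 2)) x R (by positivity) p1.le p2.le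
        (sq_sqrt (b1 x hRx).le) (sq_sqrt (z1 x hRx).le) hzl hl.le (by gcongr)
        hu.le hx0 hR rfl (by field_simp) (by
          refine le_of_pow_le_pow_left₀ (n := 2) (by norm_num) (by apply mul_nonneg p1.le; linarith) ?_
          rw [mul_pow, mul_pow, mul_pow, sq_sqrt (b1 x hRx).le, sq_sqrt (z1 x hRx).le]
          exact np) (by
          refine le_of_pow_le_pow_left₀ (n := 2) (by norm_num) (by positivity) ?_
          rw [mul_pow, mul_pow, sq_sqrt (b1 x hRx).le, sq_sqrt (z1 x hRx).le]
          exact ag)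
      have e : C * x = x / R * (n * dd k R + 2 * (n + 4) * (k * R ^ 2)) := by
        rw [hC, dd]; field_simp
      rw [e]
      linarith)
  have e0 : 0 ≤ exp ((n + 4) * (k * s ^ 2)) * s ^ n *
      (sqrt (1 - bb k R φ s ^ 2) * sqrt (1 - ((la n k R φ s)⁻¹) ^ 2)) - Z s := by
    have hs0 : 0 < s := hR.trans_le hs1
    have hl := lap s hs1
    have hbz : (la n k R φ s)⁻¹ = bb k R φ s := by
      rw [inv_eq_one_div, div_eq_iff (by positivity)]; exact hseq.symm
    rw [hbz, mul_self_sqrt (b1 s hs1).le]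
    have i1 := h.I1 s hs1
    have hp := h.φp s hs1
    have : φ s ^ n = exp ((n + 4) * (k * s ^ 2)) * s ^ n * bb k R φ s ^ 2 := by
      have : bb k R φ s = la n k R φ s * (φ s ^ n / (exp ((n + 4) * (k * s ^ 2)) * s ^ n)) := by
        rw [bb, la]; field_simp; ring
      have h2 : bb k R φ s ^ 2 = φ s ^ n / (exp ((n + 4) * (k * s ^ 2)) * s ^ n) := by
        calc bb k R φ s ^ 2 = bb k R φ s * (la n k R φ s * (φ s ^ n / (exp ((n + 4) * (k * s ^ 2)) * s ^ n))) := by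
              rw [← this]; ring
          _ = (bb k R φ s * la n k R φ s) * (φ s ^ n / (exp ((n + 4) * (k * s ^ 2)) * s ^ n)) := by ring
          _ = _ := by rw [hseq, one_mul]
      rw [h2]; field_simp
    rw [this] at i1
    linarith
  linarith

/-- pointwise inequality outside -/
lemma pw (h : Out n k R φ Z) (hZ : ∀ r, R ≤ r → 0 ≤ Z r) (r : ℝ) (hr : R ≤ r) (p t : ℝ) :
    sqrt ((φ r ^ n / (r ^ n * exp ((n + 4) * (k * r ^ 2))) * p) ^ 2 + (gm k R * r / φ r * t) ^ 2) +
     Z r / (r ^ n * exp ((n + 4) * (k * r ^ 2))) * p ≤ sqrt (p ^ 2 + t ^ 2) := by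
  have hR := h.hR
  have hr0 : 0 < r := hR.trans_le hr
  have hp := h.φp r hr
  have hb := h.bb_pos r hr
  have hb1 := h.bb_lt r hr
  have hZr := hZ r hr
  have hu := h.upos r hr
  have hl : 1 < la n k R φ r := by have := h.la_ge r hr; linarith
  have e : bb k R φ r = la n k R φ r * (φ r ^ n / (r ^ n * exp ((n + 4) * (k * r ^ 2)))) := by
    rw [bb, la]; field_simp; ring
  have eb : gm k R * r / φ r = bb k R φ r := rfl
  rw [eb]
  rcases le_or_gt (bb k R φ r * la n k R φ r) 1 with hc | hc
  · apply pw_case1 _ _ _ _ _ (by positivity) _ (by positivity)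
    · rw [← add_div, div_le_one (by positivity)]
      have := h.I1 r hr; linarith
    · set E := φ r ^ n / (r ^ n * exp ((n + 4) * (k * r ^ 2))) with hE
      have hE0 : 0 < E := by positivity
      calc bb k R φ r ^ 2 = bb k R φ r * (la n k R φ r * E) := by rw [← e]; ring
        _ = (bb k R φ r * la n k R φ r) * E := by ring
        _ ≤ 1 * E := by gcongr
        _ = E := one_mul E
  · have e2 : φ r ^ n / (r ^ n * exp ((n + 4) * (k * r ^ 2))) = bb k R φ r * (la n k R φ r)⁻¹ := by
      rw [e]; field_simp
    rw [e2]
    have hz1 : (la n k R φ r)⁻¹ < 1 := inv_lt_one_of_one_lt₀ hl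
    have hz0 : 0 < (la n k R φ r)⁻¹ := by positivity
    apply pw_case2 _ _ _ _ _ hz0 hz1 hb hb1 (by positivity)
    have i2 := h.I2 r hr hc
    have : Z r / (r ^ n * exp ((n + 4) * (k * r ^ 2))) ≤ sqrt (1 - bb k R φ r ^ 2) * sqrt (1 - ((la n k R φ r)⁻¹) ^ 2) := by
      rw [div_le_iff₀ (by positivity)]; linarith
    calc _ ≤ (sqrt (1 - bb k R φ r ^ 2) * sqrt (1 - ((la n k R φ r)⁻¹) ^ 2)) ^ 2 := by gcongr
      _ = _ := by rw [mul_pow, sq_sqrt (one_sub_sq _ hb hb1), sq_sqrt (one_sub_sq _ hz0 hz1)]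

end Out
end BQ

namespace BQ
open Real

lemma glue {a b : ℝ → ℝ} {d R : ℝ} (ha : HasDerivAt a d R) (hb : HasDerivAt b d R) (hab : a R = b R) :
    HasDerivAt (fun r => if r ≤ R then a r else b r) d R := by
  rw [hasDerivAt_iff_isLittleO] at *
  rw [Asymptotics.isLittleO_iff] at *
  intro c hc
  filter_upwards [ha hc, hb hc] with x h1 h2
  simp only [le_refl, if_true]
  split_ifs
  · exact h1
  · rw [hab]; exact h2

noncomputable def Wf (n : ℕ) (k R r : ℝ) : ℝ := ∫ x in R..r, exp ((n + 4) * (k * x ^ 2)) * x ^ n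
noncomputable def KR (n : ℕ) (k R : ℝ) : ℝ := (n * dd k R + 2 * (n + 4) * (k * R ^ 2)) / R
noncomputable def phio (n : ℕ) (k R r : ℝ) : ℝ :=
  ((R * exp (k * R ^ 2)) ^ (n + 1) + (n + 1) * gm k R * Wf n k R r) ^ ((1 : ℝ) / (n + 1))
noncomputable def phi (n : ℕ) (k R r : ℝ) : ℝ :=
  if r ≤ R then r * exp (k * r ^ 2) else phio n k R r
noncomputable def Zo (n : ℕ) (k R r : ℝ) : ℝ :=
  R ^ n * (exp ((n + 4) * (k * R ^ 2)) - exp (n * (k * R ^ 2))) + KR n k R * Wf n k R r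
noncomputable def Zf (n : ℕ) (k R r : ℝ) : ℝ :=
  if r ≤ R then r ^ n * (exp ((n + 4) * (k * r ^ 2)) - exp (n * (k * r ^ 2))) else Zo n k R r
noncomputable def Jf (n : ℕ) (k R r : ℝ) : ℝ :=
  if r ≤ R then exp ((n + 1) * (k * r ^ 2)) * (1 + 2 * (k * r ^ 2)) else
   gm k R * exp ((n + 4) * (k * r ^ 2))
noncomputable def qi (n : ℕ) (k r : ℝ) : ℝ := exp ((n + 4) * (k * r ^ 2)) *
  (n / r * (1 - (1 + 2 * (k * r ^ 2)) * exp (-(4 * (k * r ^ 2)))) + 2 * (n + 4) * (k * r))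
noncomputable def qf (n : ℕ) (k R r : ℝ) : ℝ :=
  if r ≤ R then qi n k r else KR n k R * exp ((n + 4) * (k * r ^ 2))

lemma dW (n : ℕ) (k R r : ℝ) : HasDerivAt (Wf n k R) (exp ((n + 4) * (k * r ^ 2)) * r ^ n) r := by
  have hc : Continuous (fun x : ℝ => exp ((n + 4) * (k * x ^ 2)) * x ^ n) := by fun_prop
  exact intervalIntegral.integral_hasDerivAt_right (hc.intervalIntegrable _ _)
    (hc.stronglyMeasurableAtFilter _ _) hc.continuousAt

lemma W_nonneg (n : ℕ) (k R r : ℝ) (hR : 0 < R) (hr : R ≤ r) : 0 ≤ Wf n k R r := by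
  apply intervalIntegral.integral_nonneg hr
  intro u hu
  have : 0 ≤ u := hR.le.trans hu.1
  positivity

lemma gm_pos' (k R : ℝ) (hk : 0 < k) : 0 < gm k R := by rw [gm]; positivity

lemma phio_pow (n : ℕ) (k R r : ℝ) (hk : 0 < k) (hR : 0 < R) (hr : R ≤ r) :
    0 < phio n k R r ∧ phio n k R r ^ (n + 1) =
      (R * exp (k * R ^ 2)) ^ (n + 1) + (n + 1) * gm k R * Wf n k R r := by
  have h1 := W_nonneg n k R r hR hr
  have h2 := gm_pos' k R hk
  have hp : 0 < (R * exp (k * R ^ 2)) ^ (n + 1) + (n + 1) * gm k R * Wf n k R r := by positivity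
  refine ⟨rpow_pos_of_pos hp _, ?_⟩
  rw [phio, ← rpow_natCast, ← rpow_mul hp.le]
  have : (1 : ℝ) / (n + 1) * ((n + 1 : ℕ) : ℝ) = 1 := by push_cast; field_simp
  rw [this, rpow_one]

lemma dphio (n : ℕ) (k R r : ℝ) (hk : 0 < k) (hR : 0 < R) (hr : R ≤ r) :
    HasDerivAt (phio n k R) (gm k R * exp ((n + 4) * (k * r ^ 2)) * r ^ n / phio n k R r ^ n) r := by
  obtain ⟨h1, h2⟩ := phio_pow n k R r hk hR hr
  have hp : 0 < (R * exp (k * R ^ 2)) ^ (n + 1) + (n + 1) * gm k R * Wf n k R r := by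
    rw [← h2]; positivity
  have := (((dW n k R r).const_mul ((n + 1) * gm k R)).const_add ((R * exp (k * R ^ 2)) ^ (n + 1))).rpow_const
    (p := (1 : ℝ) / (n + 1)) (Or.inl hp.ne')
  convert! this using 1
  rw [rpow_sub_one hp.ne']
  change _ = _ * _ * (phio n k R r / _)
  rw [← h2]
  field_simp
  ring

lemma phio_R (n : ℕ) (k R : ℝ) (hR : 0 < R) : phio n k R R = R * exp (k * R ^ 2) := by
  rw [phio, Wf, intervalIntegral.integral_same, mul_zero, add_zero, ← rpow_natCast,
    ← rpow_mul (by positivity)]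
  have : ((n + 1 : ℕ) : ℝ) * ((1 : ℝ) / (n + 1)) = 1 := by push_cast; field_simp
  rw [this, rpow_one]

lemma Zo_R (n : ℕ) (k R : ℝ) : Zo n k R R =
    R ^ n * (exp ((n + 4) * (k * R ^ 2)) - exp (n * (k * R ^ 2))) := by
  rw [Zo, Wf, intervalIntegral.integral_same, mul_zero, add_zero]

lemma dphii (k r : ℝ) : HasDerivAt (fun r => r * exp (k * r ^ 2))
    (exp (k * r ^ 2) * (1 + 2 * (k * r ^ 2))) r := by
  have := (hasDerivAt_id r).mul (du k r).exp
  convert! this using 1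
  simp; ring

lemma dZi (n : ℕ) (hn : 1 ≤ n) (k r : ℝ) (hr : 0 < r) :
    HasDerivAt (fun r => r ^ n * (exp ((n + 4) * (k * r ^ 2)) - exp (n * (k * r ^ 2))))
    (qi n k r * r ^ n) r := by
  have := ((hasDerivAt_id r).pow n).mul ((dexp (n + 4) k r).sub (dexp n k r))
  convert! this using 1
  have e : exp (n * (k * r ^ 2)) = exp ((n + 4) * (k * r ^ 2)) * exp (-(4 * (k * r ^ 2))) := by
    rw [← exp_add]; ring_nf
  obtain ⟨m, rfl⟩ : ∃ m, n = m + 1 := ⟨n - 1, by omega⟩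
  simp only [qi, e, id, Nat.add_sub_cancel, Pi.pow_apply, Pi.sub_apply]
  field_simp
  ring

lemma phi_J (n : ℕ) (k r : ℝ) (hr : 0 < r) : exp ((n + 1) * (k * r ^ 2)) * (1 + 2 * (k * r ^ 2)) * r ^ n /
    (r * exp (k * r ^ 2)) ^ n = exp (k * r ^ 2) * (1 + 2 * (k * r ^ 2)) := by
  have : exp ((n + 1) * (k * r ^ 2)) = exp (k * r ^ 2) ^ n * exp (k * r ^ 2) := by
    rw [← exp_nat_mul, ← exp_add]; ring_nf
  rw [this, mul_pow]; field_simp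

lemma J_R (n : ℕ) (k R : ℝ) : exp ((n + 1) * (k * R ^ 2)) * (1 + 2 * (k * R ^ 2)) =
   gm k R * exp ((n + 4) * (k * R ^ 2)) := by
  have : exp ((n + 1) * (k * R ^ 2)) = exp (-(3 * (k * R ^ 2))) * exp ((n + 4) * (k * R ^ 2)) := by
    rw [← exp_add]; ring_nf
  rw [this, gm]; ring

lemma q_R (n : ℕ) (k R : ℝ) (hR : 0 < R) : qi n k R = KR n k R * exp ((n + 4) * (k * R ^ 2)) := by
  rw [qi, KR, dd]; field_simp

lemma ev_le {a R : ℝ} (h : a < R) : ∀ᶠ x in nhds a, x ≤ R := by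
  filter_upwards [Iio_mem_nhds h] with x hx using le_of_lt hx
lemma ev_gt {a R : ℝ} (h : R < a) : ∀ᶠ x in nhds a, ¬ x ≤ R := by
  filter_upwards [Ioi_mem_nhds h] with x hx using not_le.2 hx

variable {n : ℕ} {k R : ℝ}

lemma phi_in {r : ℝ} (h : r ≤ R) : phi n k R r = r * exp (k * r ^ 2) := if_pos h
lemma phi_out (hR : 0 < R) {r : ℝ} (h : R ≤ r) : phi n k R r = phio n k R r := by
  rcases h.eq_or_lt with rfl | h
  · rw [phio_R _ _ _ hR, phi_in le_rfl]
  · exact if_neg (not_le.2 h)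
lemma Z_in {r : ℝ} (h : r ≤ R) : Zf n k R r = r ^ n * (exp ((n + 4) * (k * r ^ 2)) - exp (n * (k * r ^ 2))) :=
  if_pos h
lemma Z_out {r : ℝ} (h : R ≤ r) : Zf n k R r = Zo n k R r := by
  rcases h.eq_or_lt with rfl | h
  · rw [Zo_R, Z_in le_rfl]
  · exact if_neg (not_le.2 h)
lemma J_in {r : ℝ} (h : r ≤ R) : Jf n k R r = exp ((n + 1) * (k * r ^ 2)) * (1 + 2 * (k * r ^ 2)) := if_pos h
lemma J_out {r : ℝ} (h : R ≤ r) : Jf n k R r = gm k R * exp ((n + 4) * (k * r ^ 2)) := by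
  rcases h.eq_or_lt with rfl | h
  · rw [J_in le_rfl, J_R]
  · exact if_neg (not_le.2 h)
lemma q_in {r : ℝ} (h : r ≤ R) : qf n k R r = qi n k r := if_pos h
lemma q_out (hR : 0 < R) {r : ℝ} (h : R ≤ r) : qf n k R r = KR n k R * exp ((n + 4) * (k * r ^ 2)) := by
  rcases h.eq_or_lt with rfl | h
  · rw [q_in le_rfl, q_R _ _ _ hR]
  · exact if_neg (not_le.2 h)

lemma phi_pos (hk : 0 < k) (hR : 0 < R) {r : ℝ} (hr : 0 < r) : 0 < phi n k R r := by
  rcases le_total r R with h | h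
  · rw [phi_in h]; positivity
  · rw [phi_out hR h]; exact (phio_pow n k R r hk hR h).1

lemma dphi0 (hR : 0 < R) {r : ℝ} (h : r < R) :
    HasDerivAt (phi n k R) (exp (k * r ^ 2) * (1 + 2 * (k * r ^ 2))) r := by
  apply (dphii k r).congr_of_eventuallyEq
  filter_upwards [ev_le h] with x hx using phi_in hx

lemma dphi (hk : 0 < k) (hR : 0 < R) {r : ℝ} (hr : 0 < r) :
    HasDerivAt (phi n k R) (Jf n k R r * r ^ n / phi n k R r ^ n) r := by
  rcases lt_trichotomy r R with h | rfl | h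
  · rw [J_in h.le, phi_in h.le, phi_J _ _ _ hr]
    exact dphi0 hR h
  · rw [phi_in le_rfl]
    refine glue (b := phio n k r) ?_ ?_ (phio_R _ _ _ hr).symm
    · rw [J_in le_rfl, phi_J _ _ _ hr]; exact dphii k r
    · have := dphio n k r r hk hR le_rfl
      rwa [J_out le_rfl, ← phio_R n k r hr]
  · rw [J_out h.le, phi_out hR h.le]
    apply (dphio n k R r hk hR h.le).congr_of_eventuallyEq
    filter_upwards [ev_gt h] with x hx using if_neg hx

lemma dZ (hn : 1 ≤ n) (hR : 0 < R) {r : ℝ} (hr : 0 < r) :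
    HasDerivAt (Zf n k R) (qf n k R r * r ^ n) r := by
  have ho : ∀ r, HasDerivAt (Zo n k R) (KR n k R * exp ((n + 4) * (k * r ^ 2)) * r ^ n) r := by
    intro r
    have := ((dW n k R r).const_mul (KR n k R)).const_add (R ^ n * (exp ((n + 4) * (k * R ^ 2)) - exp (n * (k * R ^ 2))))
    convert! this using 1
    ring
  rcases lt_trichotomy r R with h | rfl | h
  · rw [q_in h.le]
    apply (dZi n hn k r hr).congr_of_eventuallyEq
    filter_upwards [ev_le h] with x hx using Z_in hx
  · refine glue (b := Zo n k r) ?_ ?_ (Zo_R _ _ _).symm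
    · rw [q_in le_rfl]; exact dZi n hn k r hr
    · rw [q_out hR le_rfl]; exact ho r
  · rw [q_out hR h.le]
    apply (ho r).congr_of_eventuallyEq
    filter_upwards [ev_gt h] with x hx using if_neg hx

lemma outI (hn : 1 ≤ n) (hk : 0 < k) (hR : 0 < R) : Out n k R (phi n k R) (Zf n k R) where
  hn := hn
  hk := hk
  hR := hR
  φR := phi_in le_rfl
  ZR := Z_in le_rfl
  φp r hr := phi_pos hk hR (hR.trans_le hr)
  dφ r hr := by
    have := dphi (n := n) hk hR (hR.trans_le hr)
    rw [J_out hr, gm] at this; exact this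
  dZ r hr := by
    have := dZ (k := k) hn hR (hR.trans_le hr)
    rw [q_out hR hr, KR, dd] at this; exact this

lemma qi_nonneg (hk : 0 < k) {r : ℝ} (hr : 0 ≤ r) : 0 ≤ qi n k r := by
  have := D_nonneg (k * r ^ 2) (by positivity)
  rw [qi]
  have : 0 ≤ 1 - (1 + 2 * (k * r ^ 2)) * exp (-(4 * (k * r ^ 2))) := by linarith
  positivity

lemma KR_nonneg (hk : 0 < k) (hR : 0 < R) : 0 ≤ KR n k R := by
  have := D_nonneg (k * R ^ 2) (by positivity)
  have : 0 ≤ dd k R := by rw [dd]; linarith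
  rw [KR]; positivity

lemma q_nonneg (hk : 0 < k) (hR : 0 < R) {r : ℝ} (hr : 0 ≤ r) : 0 ≤ qf n k R r := by
  rcases le_total r R with h | h
  · rw [q_in h]; exact qi_nonneg hk hr
  · rw [q_out hR h]; have := KR_nonneg (n := n) hk hR; positivity

lemma Z_nonneg (hk : 0 < k) (hR : 0 < R) {r : ℝ} (hr : 0 ≤ r) : 0 ≤ Zf n k R r := by
  have key : ∀ r : ℝ, 0 ≤ r → 0 ≤ r ^ n * (exp ((n + 4) * (k * r ^ 2)) - exp (n * (k * r ^ 2))) := by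
    intro r hr
    apply mul_nonneg (by positivity)
    rw [sub_nonneg]
    gcongr; linarith
  rcases le_total r R with h | h
  · rw [Z_in h]; exact key r hr
  · rw [Z_out h, Zo]
    have := key R hR.le
    have := W_nonneg n k R r hR h
    have := KR_nonneg (n := n) hk hR; positivity

lemma Z_small (hk : 0 < k) {r : ℝ} (hr : 0 ≤ r) (hrR : r ≤ R) :
    Zf n k R r ≤ 4 * k * exp ((n + 4) * (k * R ^ 2)) * r ^ (n + 2) := by
  rw [Z_in hrR]
  have h1 := add_one_le_exp (-(4 * (k * r ^ 2)))
  have e : exp (n * (k * r ^ 2)) = exp ((n + 4) * (k * r ^ 2)) * exp (-(4 * (k * r ^ 2))) := by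
    rw [← exp_add]; ring_nf
  have h2 : exp ((n + 4) * (k * r ^ 2)) - exp (n * (k * r ^ 2)) ≤ exp ((n + 4) * (k * r ^ 2)) * (4 * (k * r ^ 2)) := by
    rw [e]
    have := exp_pos ((n + 4) * (k * r ^ 2))
    nlinarith
  calc _ ≤ r ^ n * (exp ((n + 4) * (k * r ^ 2)) * (4 * (k * r ^ 2))) := by gcongr
    _ = 4 * k * exp ((n + 4) * (k * r ^ 2)) * r ^ (n + 2) := by ring
    _ ≤ _ := by gcongr

lemma q_bdd (hk : 0 < k) (hR : 0 < R) {r M : ℝ} (hr : 0 ≤ r) (hrM : r ≤ M) :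
    qf n k R r ≤ exp ((n + 4) * (k * M ^ 2)) * (KR n k R + (4 * n + 8) * (k * M)) := by
  have hM : 0 ≤ M := hr.trans hrM
  have hK := KR_nonneg (n := n) hk hR
  rcases le_total r R with h | h
  · rw [q_in h, qi]
    have h0 := D_nonneg (k * r ^ 2) (by positivity)
    have h1 := D_le (k * r ^ 2) (by positivity)
    rcases hr.eq_or_lt with rfl | hr
    · simp; positivity
    have : n / r * (1 - (1 + 2 * (k * r ^ 2)) * exp (-(4 * (k * r ^ 2)))) ≤ 2 * n * (k * M) := by
      calc _ ≤ n / r * (2 * (k * r ^ 2)) := by gcongr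
        _ = 2 * n * (k * r) := by field_simp
        _ ≤ _ := by gcongr
    have h3 : k * r ≤ k * M := by gcongr
    have h4 : n / r * (1 - (1 + 2 * (k * r ^ 2)) * exp (-(4 * (k * r ^ 2)))) + 2 * (n + 4) * (k * r) ≤
      KR n k R + (4 * n + 8) * (k * M) := by nlinarith
    gcongr
  · rw [q_out hR h, mul_comm]
    gcongr
    have : 0 ≤ (4 * n + 8) * (k * M) := by positivity
    linarith

lemma phi_ge' (hn : 1 ≤ n) (hk : 0 < k) (hR : 0 < R) {r : ℝ} (hr : 0 ≤ r) : r * exp (k * r ^ 2) ≤ phi n k R r := by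
  rcases le_total r R with h | h
  · rw [phi_in h]
  · exact (outI hn hk hR).F1 r h

lemma phi_ge (hn : 1 ≤ n) (hk : 0 < k) (hR : 0 < R) {r : ℝ} (hr : 0 ≤ r) : r ≤ phi n k R r := by
  refine le_trans ?_ (phi_ge' hn hk hR hr)
  have := one_le_exp (x := k * r ^ 2) (by positivity)
  nlinarith

lemma dphi_ge (hn : 1 ≤ n) (hk : 0 < k) (hR : 0 < R) {r : ℝ} (hr : 0 < r) :
    1 ≤ Jf n k R r * r ^ n / phi n k R r ^ n := by
  have h0 : (0:ℝ) ≤ k * r ^ 2 := by positivity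
  rcases le_total r R with h | h
  · rw [J_in h, phi_in h, phi_J _ _ _ hr]
    have := one_le_exp h0
    nlinarith
  · have h2 := (outI hn hk hR).F2 r h
    have h1 := phi_ge hn hk hR hr.le
    have hp := phi_pos (n := n) hk hR hr
    rw [J_out h, one_le_div (by positivity)]
    have h3 : r * phi n k R r ^ n ≤ r * (gm k R * exp ((n + 4) * (k * r ^ 2)) * r ^ n) := by
      calc r * phi n k R r ^ n ≤ phi n k R r * phi n k R r ^ n := by gcongr
        _ = 1 * phi n k R r ^ (n + 1) := by ring
        _ ≤ (1 + 2 * (k * r ^ 2)) * phi n k R r ^ (n + 1) := by gcongr; linarith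
        _ ≤ _ := h2
        _ = _ := by rw [gm]; ring
    exact le_of_mul_le_mul_left h3 hr

lemma phi_cont (hk : 0 < k) (hR : 0 < R) : Continuous (phi n k R) := by
  rw [continuous_iff_continuousAt]
  intro r
  rcases lt_or_ge r R with h | h
  · exact (dphi0 hR h).continuousAt
  · exact (dphi hk hR (hR.trans_le h)).continuousAt

lemma phi_exp (hn : 1 ≤ n) (hk : 0 < k) (hR : 0 < R) {r s : ℝ} (hr : 0 ≤ r) (hs : r ≤ s) :
    s - r ≤ phi n k R s - phi n k R r := by
  have := mono_of_hasDeriv (fun r => phi n k R r - r) (fun r => Jf n k R r * r ^ n / phi n k R r ^ n - 1) r s hs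
    ((phi_cont hk hR).sub continuous_id).continuousOn
    (fun x hx => (dphi hk hR (hr.trans_lt hx.1)).sub (hasDerivAt_id x))
    (fun x hx => sub_nonneg.2 (dphi_ge hn hk hR (hr.trans_lt hx.1)))
  linarith

lemma J_pos (hk : 0 < k) (r : ℝ) : 0 < Jf n k R r := by
  have := gm_pos' k R hk
  rw [Jf]; split_ifs <;> positivity

lemma J_meas : Measurable (Jf n k R) := by
  unfold Jf
  exact Measurable.ite measurableSet_Iic (by fun_prop) (by fun_prop)

lemma q_meas : Measurable (qf n k R) := by
  unfold qf qi
  exact Measurable.ite measurableSet_Iic (by fun_prop) (by fun_prop)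

lemma J_ge (hk : 0 < k) {r : ℝ} (hr : 0 ≤ r) : gm k R * exp ((n + 4) * (k * r ^ 2)) ≤ Jf n k R r := by
  rcases le_total r R with h | h
  · rw [J_in h, J_R, gm, gm]
    have : k * r ^ 2 ≤ k * R ^ 2 := by gcongr
    have := gam_anti (k * r ^ 2) (k * R ^ 2) (by positivity) this
    gcongr
  · rw [J_out h]

lemma pw_all (hn : 1 ≤ n) (hk : 0 < k) (hR : 0 < R) {r : ℝ} (hr : 0 < r) (p t : ℝ) :
    sqrt ((phi n k R r ^ n / (r ^ n * exp ((n + 4) * (k * r ^ 2))) * p) ^ 2 +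
      (Jf n k R r * r / (phi n k R r * exp ((n + 4) * (k * r ^ 2))) * t) ^ 2) +
     Zf n k R r / (r ^ n * exp ((n + 4) * (k * r ^ 2))) * p ≤ sqrt (p ^ 2 + t ^ 2) := by
  have hp := phi_pos (n := n) hk hR hr
  rcases le_total r R with h | h
  · rw [phi_in h, J_in h, Z_in h]
    have e1 : (r * exp (k * r ^ 2)) ^ n / (r ^ n * exp ((n + 4) * (k * r ^ 2))) = exp (-(4 * (k * r ^ 2))) := by
      have : exp ((n + 4) * (k * r ^ 2)) = exp (k * r ^ 2) ^ n * exp (4 * (k * r ^ 2)) := by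
        rw [← exp_nat_mul, ← exp_add]; ring_nf
      rw [this, mul_pow, exp_neg]; field_simp
    have e2 : exp ((n + 1) * (k * r ^ 2)) * (1 + 2 * (k * r ^ 2)) * r / (r * exp (k * r ^ 2) * exp ((n + 4) * (k * r ^ 2)))
       = (1 + 2 * (k * r ^ 2)) * exp (-(4 * (k * r ^ 2))) := by
      have : exp ((n + 1) * (k * r ^ 2)) = exp (-(4 * (k * r ^ 2))) * exp (k * r ^ 2) * exp ((n + 4) * (k * r ^ 2)) := by
        rw [← exp_add, ← exp_add]; ring_nf
      rw [this]; field_simp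
    have e3 : r ^ n * (exp ((n + 4) * (k * r ^ 2)) - exp (n * (k * r ^ 2))) / (r ^ n * exp ((n + 4) * (k * r ^ 2)))
       = 1 - exp (-(4 * (k * r ^ 2))) := by
      have : exp (n * (k * r ^ 2)) = exp (-(4 * (k * r ^ 2))) * exp ((n + 4) * (k * r ^ 2)) := by
        rw [← exp_add]; ring_nf
      rw [this]; field_simp
    rw [e1, e2, e3]
    have s := sq_exp (k * r ^ 2) (by positivity)
    have hE := exp_pos (-(4 * (k * r ^ 2)))
    have hE1 : exp (-(4 * (k * r ^ 2))) ≤ 1 := exp_le_one_iff.2 (by have : 0 ≤ k * r ^ 2 := by positivity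
                                                                    linarith)
    apply pw_case1 _ _ _ _ _ hE.le _ (by linarith) (by linarith)
    calc _ = (1 + 2 * (k * r ^ 2)) ^ 2 * exp (-(4 * (k * r ^ 2))) * exp (-(4 * (k * r ^ 2))) := by ring
      _ ≤ 1 * exp (-(4 * (k * r ^ 2))) := by gcongr
      _ = _ := one_mul _
  · have := (outI hn hk hR).pw (fun r hr => Z_nonneg hk hR (hR.le.trans hr)) r h p t
    have e : Jf n k R r * r / (phi n k R r * exp ((n + 4) * (k * r ^ 2))) = gm k R * r / phi n k R r := by
      rw [J_out h]; field_simp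
    rw [e]; exact this

noncomputable def HR (n : ℕ) (k R : ℝ) : ℝ := (n + 1) * gm k R / (R * exp (k * R ^ 2)) + KR n k R

lemma H_out (hR : 0 < R) {r : ℝ} (h : R ≤ r) : (n + 1) / (R * exp (k * R ^ 2)) * Jf n k R r + qf n k R r =
    HR n k R * exp ((n + 4) * (k * r ^ 2)) := by
  rw [J_out h, q_out hR h, HR]; ring

/-- strict inequality inside -/
lemma H_in (hn : 1 ≤ n) (hk : 0 < k) (hR : 0 < R) {r : ℝ} (hr : 0 < r) (h : r < R) :
    (n + 1) / (R * exp (k * R ^ 2)) * Jf n k R r + qf n k R r <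
    HR n k R * exp ((n + 4) * (k * r ^ 2)) := by
  set S := R * exp (k * R ^ 2) with hS
  have hS0 : 0 < S := by positivity
  let H : ℝ → ℝ := fun r => (n + 1) / S * ((1 + 2 * (k * r ^ 2)) * exp (-3 * (k * r ^ 2))) +
    (n * (1 - (1 + 2 * (k * r ^ 2)) * exp ((-4) * (k * r ^ 2))) / r + 2 * (n + 4) * k * r)
  have hmono : H r < H R := by
    have hd : ∀ x ∈ Icc r R, HasDerivAt H ((n + 1) / S * ((2 * (2 * (k * x))) * exp (-3 * (k * x ^ 2)) +
        (1 + 2 * (k * x ^ 2)) * (exp (-3 * (k * x ^ 2)) * (-3 * (2 * (k * x))))) +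
        ((n * (-((2 * (2 * (k * x))) * exp ((-4) * (k * x ^ 2)) +
        (1 + 2 * (k * x ^ 2)) * (exp ((-4) * (k * x ^ 2)) * (-4 * (2 * (k * x)))))) * x -
        n * (1 - (1 + 2 * (k * x ^ 2)) * exp ((-4) * (k * x ^ 2))) * 1) / x ^ 2 + 2 * (n + 4) * k * 1)) x := by
      intro x hx
      have hx0 : x ≠ 0 := (hr.trans_le hx.1).ne'
      have a1 := ((du k x).const_mul 2).const_add 1
      exact ((a1.mul (dexp (-3) k x)).const_mul _).add
        (((((a1.mul (dexp (-4) k x)).const_sub 1).const_mul (n:ℝ)).div (hasDerivAt_id x) hx0).add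
          ((hasDerivAt_id x).const_mul (2 * (n + 4) * k)))
    have := strictMonoOn_of_hasDerivWithinAt_pos (f := H) (convex_Icc r R)
      (fun x hx => (hd x hx).continuousAt.continuousWithinAt)
      (fun x hx => (hd x (interior_subset hx)).hasDerivWithinAt) ?_
    · exact this (left_mem_Icc.2 h.le) (right_mem_Icc.2 h.le) h
    · intro x hx
      rw [interior_Icc] at hx
      have hx0 : 0 < x := hr.trans hx.1
      have hxS : x / S ≤ exp (-(k * x ^ 2)) := by
        rw [div_le_iff₀ hS0, exp_neg, hS]
        have : x * exp (k * x ^ 2) ≤ R * exp (k * R ^ 2) := by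
          have := hx.2.le
          gcongr
        rw [inv_mul_eq_div, le_div_iff₀ (by positivity)]; exact this
      set u := k * x ^ 2 with hu
      have hu0 : 0 < u := by positivity
      have hD := D_le u hu0.le
      have e4 : exp ((-4) * u) = exp (-(4 * u)) := by ring_nf
      have e3 : exp (-u) * exp (-3 * u) = exp (-(4 * u)) := by rw [← exp_add]; ring_nf
      have e3' := exp_pos (-3 * u)
      have eu : exp (-(4 * u)) * (1 + 4 * u) ≤ 1 := by
        have h := add_one_le_exp (4 * u)
        have e : exp (-(4 * u)) * (exp (4 * u)) = 1 := by rw [← exp_add]; simp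
        have := exp_pos (-(4 * u))
        nlinarith
      rw [e4]
      have hE := exp_pos (-(4 * u))
      have hkx : k * x = u / x := by rw [hu]; field_simp
      have hn' : (1 : ℝ) ≤ n := by exact_mod_cast hn
      have main : 0 < x ^ 2 * ((n + 1) / S * ((2 * (2 * (k * x))) * exp (-3 * u) +
        (1 + 2 * u) * (exp (-3 * u) * (-3 * (2 * (k * x))))) +
        ((n * (-((2 * (2 * (k * x))) * exp (-(4 * u)) +
        (1 + 2 * u) * (exp (-(4 * u)) * (-4 * (2 * (k * x)))))) * x -
        n * (1 - (1 + 2 * u) * exp (-(4 * u))) * 1) / x ^ 2 + 2 * (n + 4) * k * 1)) := by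
        have eq1 : x ^ 2 * ((n + 1) / S * ((2 * (2 * (k * x))) * exp (-3 * u) +
          (1 + 2 * u) * (exp (-3 * u) * (-3 * (2 * (k * x))))) +
          ((n * (-((2 * (2 * (k * x))) * exp (-(4 * u)) +
          (1 + 2 * u) * (exp (-(4 * u)) * (-4 * (2 * (k * x)))))) * x -
          n * (1 - (1 + 2 * u) * exp (-(4 * u))) * 1) / x ^ 2 + 2 * (n + 4) * k * 1)) =
          -((n + 1) * (x / S * exp (-3 * u)) * (2 * u * (1 + 6 * u))) + (n * (2 * u * (exp (-(4 * u)) * (2 + 8 * u)))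
           - n * (1 - (1 + 2 * u) * exp (-(4 * u)))) + 2 * (n + 4) * u := by
          have hk2 : k = u / x ^ 2 := by rw [hu]; field_simp
          rw [hkx, hk2]
          field_simp
          ring
        rw [eq1]
        have b1 : x / S * exp (-3 * u) ≤ exp (-(4 * u)) := by rw [← e3]; gcongr
        have b2 : (n + 1) * (x / S * exp (-3 * u)) * (2 * u * (1 + 6 * u)) ≤
          (n + 1) * exp (-(4 * u)) * (2 * u * (1 + 6 * u)) := by gcongr
        have b3 : n * (1 - (1 + 2 * u) * exp (-(4 * u))) ≤ n * (2 * u) := by gcongr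
        have b4 : 0 ≤ exp (-(4 * u)) * u * ((n - 1) * (2 + 4 * u)) := by
          apply mul_nonneg (by positivity); apply mul_nonneg <;> linarith
        have b5 : 0 < u * (8 * (1 - exp (-(4 * u)) * u)) := by
          apply mul_pos hu0
          nlinarith
        nlinarith
      exact (pos_iff_pos_of_mul_pos main).1 (by positivity)
  have eH : ∀ r : ℝ, H r * exp ((n + 4) * (k * r ^ 2)) =
      (n + 1) / S * (exp ((n + 1) * (k * r ^ 2)) * (1 + 2 * (k * r ^ 2))) + qi n k r := by
    intro r
    have e1 : exp ((n + 1) * (k * r ^ 2)) = exp (-3 * (k * r ^ 2)) * exp ((n + 4) * (k * r ^ 2)) := by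
      rw [← exp_add]; ring_nf
    have e4 : exp ((-4) * (k * r ^ 2)) = exp (-(4 * (k * r ^ 2))) := by ring_nf
    simp only [H, qi]
    rw [e1, e4]
    ring
  rw [J_in h.le, q_in h.le, ← eH]
  have hH : H R = HR n k R := by
    have := eH R
    rw [← J_in (n := n) (k := k) le_rfl, ← q_in (R := R) le_rfl, H_out hR le_rfl] at this
    exact mul_right_cancel₀ (exp_ne_zero _) this
  rw [← hH]
  gcongr

end BQ

namespace BQ
open Real

abbrev Sp (n : ℕ) := EuclideanSpace ℝ (Fin (n + 1))

lemma dnorm {n : ℕ} (x : Sp n) (hx : x ≠ 0) : HasFDerivAt (fun y : Sp n => ‖y‖) ((1 / ‖x‖) • innerSL ℝ x) x := by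
  have hx' : 0 < ‖x‖ := norm_pos_iff.2 hx
  have h := (hasStrictFDerivAt_norm_sq x).hasFDerivAt.sqrt (by positivity)
  have e : (fun y : Sp n => sqrt (‖y‖ ^ 2)) = fun y => ‖y‖ := by
    ext y; exact sqrt_sq (norm_nonneg y)
  rw [e] at h
  convert! h using 1
  rw [sqrt_sq hx'.le]
  ext v
  simp
  field_simp

/-- scalar plus rank one -/
noncomputable def sro {n : ℕ} (x : Sp n) (a b : ℝ) : Sp n →L[ℝ] Sp n :=
  a • ContinuousLinearMap.id ℝ (Sp n) + b • (innerSL ℝ x).smulRight x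

lemma sro_apply {n : ℕ} (x v : Sp n) (a b : ℝ) : sro x a b v = a • v + (b * inner ℝ x v) • x := by
  simp [sro, smul_smul]

lemma sro_det {n : ℕ} (x : Sp n) (a b : ℝ) (ha : a ≠ 0) : (sro x a b).det = a ^ n * (a + b * ‖x‖ ^ 2) := by
  have e : (sro x a b : Sp n →ₗ[ℝ] Sp n) =
      a • LinearMap.transvection (innerSL ℝ x : Sp n →ₗ[ℝ] ℝ) ((b / a) • x) := by
    ext1 v
    simp only [ContinuousLinearMap.coe_coe, sro_apply, LinearMap.smul_apply, LinearMap.transvection.apply,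
      innerSL_apply_apply, smul_add, smul_smul]
    congr 2
    field_simp
  rw [ContinuousLinearMap.det, e, LinearMap.det_smul, LinearMap.transvection.det]
  simp only [finrank_euclideanSpace, Fintype.card_fin, map_smul, ContinuousLinearMap.coe_coe, innerSL_apply_apply,
    real_inner_self_eq_norm_sq, smul_eq_mul]
  rw [pow_succ]
  field_simp

lemma sro_comp {n : ℕ} (x : Sp n) (hx : x ≠ 0) (a b c : ℝ) (ha : a ≠ 0) (hc : c ≠ 0)
    (hb : a + b * ‖x‖ ^ 2 = c) (v : Sp n) :
    sro x a b (sro x a⁻¹ ((c⁻¹ - a⁻¹) / ‖x‖ ^ 2) v) = v := by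
  have hx' : 0 < ‖x‖ := norm_pos_iff.2 hx
  have hb' : b = (c - a) / ‖x‖ ^ 2 := by field_simp; linarith
  simp only [sro_apply, inner_add_right, inner_smul_right, real_inner_self_eq_norm_sq, smul_add, smul_smul]
  rw [add_assoc, ← add_smul, mul_inv_cancel₀ ha, one_smul]
  convert add_zero v
  rw [hb']
  convert zero_smul ℝ x
  field_simp
  ring

noncomputable def sroE {n : ℕ} (x : Sp n) (hx : x ≠ 0) (a b c : ℝ) (ha : a ≠ 0) (hc : c ≠ 0)
    (hb : a + b * ‖x‖ ^ 2 = c) : Sp n ≃L[ℝ] Sp n :=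
  ContinuousLinearEquiv.equivOfInverse (sro x a b) (sro x a⁻¹ ((c⁻¹ - a⁻¹) / ‖x‖ ^ 2))
    (by
      intro v
      have hx' : 0 < ‖x‖ := norm_pos_iff.2 hx
      have := sro_comp x hx a⁻¹ ((c⁻¹ - a⁻¹) / ‖x‖ ^ 2) c⁻¹ (inv_ne_zero ha) (inv_ne_zero hc) (by field_simp; ring) v
      rw [inv_inv, inv_inv] at this
      have e : b = (c - a) / ‖x‖ ^ 2 := by field_simp; linarith
      rw [e]; rwa [e] at *)
    (sro_comp x hx a b c ha hc hb)

noncomputable def Ph (n : ℕ) (k R : ℝ) (x : Sp n) : Sp n := (phi n k R ‖x‖ / ‖x‖) • x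

variable {n : ℕ} {k R : ℝ}

lemma phi_nonneg (hk : 0 < k) (hR : 0 < R) {r : ℝ} (hr : 0 ≤ r) : 0 ≤ phi n k R r := by
  rcases hr.eq_or_lt with rfl | hr
  · rw [phi_in hR.le, zero_mul]
  · exact (phi_pos hk hR hr).le

lemma Ph_norm (hk : 0 < k) (hR : 0 < R) (x : Sp n) : ‖Ph n k R x‖ = phi n k R ‖x‖ := by
  rcases eq_or_ne x 0 with rfl | hx
  · simp [Ph, phi_in hR.le]
  · have hx' : 0 < ‖x‖ := norm_pos_iff.2 hx
    have := phi_nonneg (n := n) hk hR hx'.le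
    rw [Ph, norm_smul, norm_eq_abs, abs_of_nonneg (by positivity)]
    field_simp

lemma Ph_expand (hn : 1 ≤ n) (hk : 0 < k) (hR : 0 < R) (x y : Sp n) :
    ‖x - y‖ ≤ ‖Ph n k R x - Ph n k R y‖ := by
  wlog hxy : ‖x‖ ≤ ‖y‖ generalizing x y
  · rw [norm_sub_rev, norm_sub_rev (Ph n k R x)]; exact this y x (le_of_not_ge hxy)
  rcases eq_or_ne x 0 with rfl | hx
  · have : Ph n k R 0 = 0 := by simp [Ph]
    rw [this, zero_sub, zero_sub, norm_neg, norm_neg, Ph_norm hk hR]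
    exact phi_ge hn hk hR (norm_nonneg y)
  have hx' : 0 < ‖x‖ := norm_pos_iff.2 hx
  have hy' : 0 < ‖y‖ := hx'.trans_le hxy
  have a1 := phi_ge hn hk hR hx'.le
  have b1 := phi_ge hn hk hR hy'.le
  have ab := phi_exp hn hk hR hx'.le hxy
  have hi := real_inner_le_norm x y
  apply le_of_pow_le_pow_left₀ (n := 2) (by norm_num) (norm_nonneg _)
  rw [norm_sub_sq_real, norm_sub_sq_real, Ph_norm hk hR, Ph_norm hk hR, Ph, Ph, inner_smul_left, inner_smul_right]
  simp only [conj_trivial]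
  set a := phi n k R ‖x‖
  set b := phi n k R ‖y‖
  set r := ‖x‖
  set s := ‖y‖
  have h1 : (1:ℝ) ≤ a / r * (b / s) := by
    have h1 : 1 ≤ a / r := by rw [one_le_div hx']; exact a1
    have h2 : 1 ≤ b / s := by rw [one_le_div hy']; exact b1
    nlinarith
  have h2 : a / r * (b / s) * (r * s) = a * b := by field_simp
  have h3 : 0 ≤ (a / r * (b / s) - 1) * (r * s - inner ℝ x y) := mul_nonneg (by linarith) (by linarith)
  have h4 : (s - r) ^ 2 ≤ (b - a) ^ 2 := by
    have : 0 ≤ s - r := by linarith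
    gcongr
  nlinarith

lemma Ph_inj (hn : 1 ≤ n) (hk : 0 < k) (hR : 0 < R) : Function.Injective (Ph n k R) := by
  intro x y h
  have := Ph_expand hn hk hR x y
  rw [h, sub_self, norm_zero] at this
  exact sub_eq_zero.1 (norm_le_zero_iff.1 this)

lemma Ph_surj (hn : 1 ≤ n) (hk : 0 < k) (hR : 0 < R) : Function.Surjective (Ph n k R) := by
  intro z
  rcases eq_or_ne z 0 with rfl | hz
  · exact ⟨0, by simp [Ph]⟩
  have hz' : 0 < ‖z‖ := norm_pos_iff.2 hz
  have h0 : phi n k R 0 = 0 := by rw [phi_in hR.le, zero_mul]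
  have := intermediate_value_Icc (f := phi n k R) hz'.le (phi_cont hk hR).continuousOn
  obtain ⟨t, ht, hte⟩ := this ⟨h0.le.trans hz'.le, phi_ge hn hk hR hz'.le⟩
  have ht0 : 0 < t := by
    rcases ht.1.eq_or_lt with h | h
    · rw [← h, h0] at hte; exact absurd hte hz'.ne
    · exact h
  refine ⟨(t / ‖z‖) • z, ?_⟩
  have hnorm : ‖(t / ‖z‖) • z‖ = t := by
    rw [norm_smul, norm_eq_abs, abs_of_pos (by positivity)]; field_simp
  rw [Ph, hnorm, hte, smul_smul]
  convert one_smul ℝ z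
  field_simp

noncomputable def Eq (n : ℕ) (k R : ℝ) (hn : 1 ≤ n) (hk : 0 < k) (hR : 0 < R) : Sp n ≃ Sp n :=
  Equiv.ofBijective (Ph n k R) ⟨Ph_inj hn hk hR, Ph_surj hn hk hR⟩

noncomputable def dph (n : ℕ) (k R r : ℝ) : ℝ := Jf n k R r * r ^ n / phi n k R r ^ n
noncomputable def DP (n : ℕ) (k R : ℝ) (x : Sp n) : Sp n →L[ℝ] Sp n :=
  sro x (phi n k R ‖x‖ / ‖x‖) ((dph n k R ‖x‖ - phi n k R ‖x‖ / ‖x‖) / ‖x‖ ^ 2)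

lemma dPh (hk : 0 < k) (hR : 0 < R) (x : Sp n) (hx : x ≠ 0) : HasFDerivAt (Ph n k R) (DP n k R x) x := by
  have hx' : 0 < ‖x‖ := norm_pos_iff.2 hx
  have h1 : HasDerivAt (fun r => phi n k R r / r) _ ‖x‖ := (dphi hk hR hx').div (hasDerivAt_id _) hx'.ne'
  have h2 := h1.comp_hasFDerivAt x (dnorm x hx)
  have h3 := h2.smul (hasFDerivAt_id x)
  convert! h3 using 1
  ext1 v
  simp only [DP, sro_apply, dph]
  simp only [ContinuousLinearMap.add_apply, ContinuousLinearMap.smul_apply, ContinuousLinearMap.smulRight_apply,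
    innerSL_apply_apply, smul_eq_mul, id, Function.comp, ContinuousLinearMap.id_apply]
  congr 2
  field_simp

lemma DP_det (hk : 0 < k) (hR : 0 < R) (x : Sp n) (hx : x ≠ 0) : (DP n k R x).det = Jf n k R ‖x‖ := by
  have hx' : 0 < ‖x‖ := norm_pos_iff.2 hx
  have hp := phi_pos (n := n) hk hR hx'
  rw [DP, sro_det _ _ _ (by positivity), dph, div_pow]
  field_simp
  ring

noncomputable def IP (n : ℕ) (k R : ℝ) (x : Sp n) : Sp n →L[ℝ] Sp n :=
  sro x (phi n k R ‖x‖ / ‖x‖)⁻¹ (((dph n k R ‖x‖)⁻¹ - (phi n k R ‖x‖ / ‖x‖)⁻¹) / ‖x‖ ^ 2)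

lemma Eq_lip (hn : 1 ≤ n) (hk : 0 < k) (hR : 0 < R) : LipschitzWith 1 (Eq n k R hn hk hR).symm := by
  apply LipschitzWith.of_dist_le_mul
  intro x y
  have := Ph_expand hn hk hR ((Eq n k R hn hk hR).symm x) ((Eq n k R hn hk hR).symm y)
  change _ ≤ ‖(Eq n k R hn hk hR) _ - (Eq n k R hn hk hR) _‖ at this
  rw [Equiv.apply_symm_apply, Equiv.apply_symm_apply] at this
  rw [dist_eq_norm, dist_eq_norm]; simpa using this

lemma dph_pos (hk : 0 < k) (hR : 0 < R) {r : ℝ} (hr : 0 < r) : 0 < dph n k R r := by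
  have := J_pos (n := n) (R := R) hk r
  have := phi_pos (n := n) hk hR hr
  rw [dph]; positivity

lemma dEq (hn : 1 ≤ n) (hk : 0 < k) (hR : 0 < R) (x : Sp n) (hx : x ≠ 0) :
    HasFDerivAt (Eq n k R hn hk hR).symm (IP n k R x) (Ph n k R x) := by
  have hx' : 0 < ‖x‖ := norm_pos_iff.2 hx
  have hp := phi_pos (n := n) hk hR hx'
  have hd := dph_pos (n := n) hk hR hx'
  have e : (Eq n k R hn hk hR).symm (Ph n k R x) = x := (Eq n k R hn hk hR).symm_apply_apply x
  have := HasFDerivAt.of_local_left_inverse (g := (Eq n k R hn hk hR).symm) (f := Ph n k R) (a := Ph n k R x)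
    (f' := sroE x hx (phi n k R ‖x‖ / ‖x‖) ((dph n k R ‖x‖ - phi n k R ‖x‖ / ‖x‖) / ‖x‖ ^ 2) (dph n k R ‖x‖)
      (by positivity) hd.ne' (by field_simp; ring)) (Eq_lip hn hk hR).continuous.continuousAt
    (by rw [e]; exact dPh hk hR x hx) (Eventually.of_forall fun y => (Eq n k R hn hk hR).apply_symm_apply y)
  exact this

/-- pointwise estimate -/
lemma pw_vec (hn : 1 ≤ n) (hk : 0 < k) (hR : 0 < R) (x : Sp n) (hx : x ≠ 0) (L : Sp n →L[ℝ] ℝ) :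
    Jf n k R ‖x‖ * ‖L.comp (IP n k R x)‖ ≤ exp ((n + 4) * (k * ‖x‖ ^ 2)) * ‖L‖ +
      Zf n k R ‖x‖ / ‖x‖ ^ (n + 1) * L x := by
  have hx' : 0 < ‖x‖ := norm_pos_iff.2 hx
  have hp := phi_pos (n := n) hk hR hx'
  have hd := dph_pos (n := n) hk hR hx'
  have hJ := J_pos (n := n) (R := R) hk ‖x‖
  set ξ := (InnerProductSpace.toDual ℝ (Sp n)).symm L with hξ
  have hL : ∀ v, L v = inner ℝ ξ v := fun v => by rw [hξ, InnerProductSpace.toDual_symm_apply]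
  have hLn : ‖L‖ = ‖ξ‖ := by rw [hξ, LinearIsometryEquiv.norm_map]
  set m := phi n k R ‖x‖ / ‖x‖ with hm
  have hm0 : 0 < m := by positivity
  set d := dph n k R ‖x‖ with hdd
  set r := ‖x‖ with hr
  set p := -(L x / r) with hpd
  have hip : (inner ℝ ξ x) = - (r * p) := by rw [← hL, hpd]; field_simp
  have hpξ : p ^ 2 ≤ ‖ξ‖ ^ 2 := by
    have h1 := abs_real_inner_le_norm ξ x
    rw [hip, abs_neg, abs_mul, abs_of_pos hx', ← hr, mul_comm] at h1
    have h2 : |p| ≤ ‖ξ‖ := le_of_mul_le_mul_right h1 hx'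
    calc p ^ 2 = |p| ^ 2 := (sq_abs p).symm
      _ ≤ _ := by gcongr
  set t := sqrt (‖ξ‖ ^ 2 - p ^ 2) with ht
  have ht2 : t ^ 2 = ‖ξ‖ ^ 2 - p ^ 2 := sq_sqrt (by linarith)
  set η := m⁻¹ • ξ + ((d⁻¹ - m⁻¹) / r ^ 2 * inner ℝ ξ x) • x with hη
  have hLc : L.comp (IP n k R x) = innerSL ℝ η := by
    ext1 v
    simp only [ContinuousLinearMap.comp_apply, IP, sro_apply, hL, inner_add_right, inner_smul_right,
      innerSL_apply_apply, hη, inner_add_left, inner_smul_left, conj_trivial]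
    ring
  have hη2 : ‖η‖ ^ 2 = (d⁻¹ * p) ^ 2 + (m⁻¹ * t) ^ 2 := by
    rw [hη, norm_add_sq_real, norm_smul, norm_smul, inner_smul_left, inner_smul_right, hip, ← hr,
      mul_pow, mul_pow, norm_eq_abs, norm_eq_abs, sq_abs, sq_abs, mul_pow m⁻¹ t, ht2]
    simp only [conj_trivial]
    field_simp
    ring
  rw [hLc, innerSL_apply_norm, hLn]
  have h := pw_all hn hk hR hx' p t
  have e1 : sqrt (p ^ 2 + t ^ 2) = ‖ξ‖ := by rw [ht2]; rw [add_sub_cancel]; exact sqrt_sq (norm_nonneg _)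
  set f := exp ((n + 4) * (k * r ^ 2)) with hf
  have hf0 : 0 < f := exp_pos _
  have e2 : sqrt ((phi n k R r ^ n / (r ^ n * f) * p) ^ 2 + (Jf n k R r * r / (phi n k R r * f) * t) ^ 2) =
      Jf n k R r / f * ‖η‖ := by
    rw [← sqrt_sq (show 0 ≤ Jf n k R r / f * ‖η‖ by positivity), mul_pow (Jf n k R r / f), hη2]
    congr 1
    have a1 : d⁻¹ = phi n k R r ^ n / (r ^ n * Jf n k R r) := by rw [hdd, dph, inv_div]; ring
    have a2 : m⁻¹ = r / phi n k R r := by rw [hm, inv_div]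
    rw [a1, a2]
    field_simp
  rw [e1, e2] at h
  have h' := mul_le_mul_of_nonneg_left h hf0.le
  have e3 : f * (Jf n k R r / f * ‖η‖ + Zf n k R r / (r ^ n * f) * p) =
     Jf n k R r * ‖η‖ - Zf n k R r / r ^ (n + 1) * L x := by
    rw [hpd]; field_simp; ring
  rw [e3] at h'
  linarith

end BQ

namespace BQ
open Real

variable {n : ℕ} {k R : ℝ}

noncomputable def wf (n : ℕ) (k R r : ℝ) : ℝ := Zf n k R r / r ^ (n + 1)

lemma wf_nonneg (hk : 0 < k) (hR : 0 < R) {r : ℝ} (hr : 0 ≤ r) : 0 ≤ wf n k R r := by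
  have := Z_nonneg (n := n) hk hR hr
  rw [wf]; positivity

lemma wf_meas : Measurable (wf n k R) := by
  have h1 : Measurable (Zo n k R) := by
    have : Continuous (Wf n k R) := by
      rw [continuous_iff_continuousAt]; exact fun r => (dW n k R r).continuousAt
    unfold Zo; exact (by fun_prop : Continuous _).measurable
  have h2 : Measurable (Zf n k R) := by
    unfold Zf
    exact Measurable.ite measurableSet_Iic (by fun_prop) h1
  exact h2.div (by fun_prop)

lemma wf_small (hk : 0 < k) {r : ℝ} (hr : 0 ≤ r) (hrR : r ≤ R) :
    wf n k R r ≤ 4 * k * exp ((n + 4) * (k * R ^ 2)) * r := by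
  rcases hr.eq_or_lt with rfl | hr'
  · simp [wf]
  · rw [wf, div_le_iff₀ (by positivity)]
    refine (Z_small hk hr hrR).trans_eq (by ring)

lemma wf_bdd (hn : 1 ≤ n) (hk : 0 < k) (hR : 0 < R) (M : ℝ) : ∃ C, 0 ≤ C ∧ ∀ r, 0 ≤ r → r ≤ M → wf n k R r ≤ C := by
  refine ⟨4 * k * exp ((n + 4) * (k * R ^ 2)) * R + exp ((n + 4) * (k * M ^ 2)) / R, by positivity, ?_⟩
  intro r hr hrM
  rcases le_total r R with h | h
  · calc _ ≤ 4 * k * exp ((n + 4) * (k * R ^ 2)) * r := wf_small hk hr h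
      _ ≤ 4 * k * exp ((n + 4) * (k * R ^ 2)) * R := by gcongr
      _ ≤ _ := by have : 0 ≤ exp ((n + 4) * (k * M ^ 2)) / R := by positivity
                  linarith
  · have h1 := (outI hn hk hR).I1 r h
    have hr0 := hR.trans_le h
    have h2 := phi_pos (n := n) hk hR hr0
    have h3 : 0 < phi n k R r ^ n := by positivity
    have h4 : wf n k R r ≤ exp ((n + 4) * (k * r ^ 2)) / r := by
      rw [wf, div_le_iff₀ (by positivity)]
      have : exp ((n + 4) * (k * r ^ 2)) / r * r ^ (n + 1) = exp ((n + 4) * (k * r ^ 2)) * r ^ n := by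
        field_simp; ring
      linarith
    calc _ ≤ _ := h4
      _ ≤ exp ((n + 4) * (k * M ^ 2)) / R := by gcongr
      _ ≤ _ := by have : 0 ≤ 4 * k * exp ((n + 4) * (k * R ^ 2)) * R := by positivity
                  linarith

noncomputable def gi (n : ℕ) (k R : ℝ) (i : Fin (n + 1)) (x : Sp n) : ℝ :=
  wf n k R ‖x‖ + x i ^ 2 * (qf n k R ‖x‖ - (n + 1) * wf n k R ‖x‖) / ‖x‖ ^ 2

lemma dw (hn : 1 ≤ n) (hR : 0 < R) {r : ℝ} (hr : 0 < r) :
    HasDerivAt (wf n k R) ((qf n k R r - (n + 1) * wf n k R r) / r) r := by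
  have := (dZ (k := k) hn hR hr).div ((hasDerivAt_id r).pow (n + 1)) (by simp; positivity)
  convert! this using 1
  simp [wf]
  field_simp
  ring

lemma dX (hn : 1 ≤ n) (hk : 0 < k) (hR : 0 < R) (i : Fin (n + 1)) (x : Sp n) :
    HasLineDerivAt ℝ (fun x : Sp n => wf n k R ‖x‖ * x i) (gi n k R i x) x (EuclideanSpace.single i 1) := by
  rcases eq_or_ne x 0 with rfl | hx
  · have e0 : gi n k R i 0 = 0 := by simp [gi, wf]
    rw [e0, HasLineDerivAt]
    have e1 : (fun t : ℝ => wf n k R ‖(0 : Sp n) + t • EuclideanSpace.single i (1:ℝ)‖ *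
        ((0 : Sp n) + t • EuclideanSpace.single i (1:ℝ)) i) = fun t => wf n k R |t| * t := by
      ext t
      simp [norm_smul]
    rw [e1, hasDerivAt_iff_isLittleO]
    simp only [abs_zero, mul_zero, sub_zero, smul_zero]
    have : (fun t : ℝ => wf n k R |t| * t) =O[nhds 0] fun t => t ^ 2 := by
      apply Asymptotics.IsBigO.of_bound (4 * k * exp ((n + 4) * (k * R ^ 2)))
      filter_upwards [Metric.closedBall_mem_nhds (0 : ℝ) hR] with t ht
      have ht' : |t| ≤ R := by simpa using ht
      rw [norm_mul, norm_eq_abs, norm_eq_abs, norm_eq_abs, abs_of_nonneg (wf_nonneg hk hR (abs_nonneg t)),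
        abs_pow]
      have := mul_le_mul_of_nonneg_right (wf_small (n := n) hk (abs_nonneg t) ht') (abs_nonneg t)
      refine this.trans_eq (by ring)
    refine this.trans_isLittleO ?_
    exact Asymptotics.isLittleO_pow_id (by norm_num)
  · have hx' : 0 < ‖x‖ := norm_pos_iff.2 hx
    have h2 := ((dw (k := k) hn hR hx').comp_hasFDerivAt x (dnorm x hx)).mul
      ((EuclideanSpace.proj (𝕜 := ℝ) i).hasFDerivAt (x := x))
    have h3 := h2.hasLineDerivAt (EuclideanSpace.single i 1)
    convert! h3 using 1
    simp [gi, EuclideanSpace.inner_single_right]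
    field_simp

lemma gi_sum (hR : 0 < R) (x : Sp n) : ∑ i, gi n k R i x = qf n k R ‖x‖ := by
  rcases eq_or_ne x 0 with rfl | hx
  · simp [gi, wf, q_in hR.le, qi]
  have hx' : 0 < ‖x‖ := norm_pos_iff.2 hx
  have : ∑ i, x i ^ 2 = ‖x‖ ^ 2 := by rw [EuclideanSpace.norm_sq_eq]; simp
  simp only [gi, mul_div_assoc]
  rw [Finset.sum_add_distrib, ← Finset.sum_mul, this]
  simp
  field_simp
  ring

lemma coord_le (x : Sp n) (i : Fin (n + 1)) : |x i| ≤ ‖x‖ := by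
  have := EuclideanSpace.norm_eq x
  have h2 := PiLp.norm_apply_le x i
  simpa using h2

lemma gi_bdd (hn : 1 ≤ n) (hk : 0 < k) (hR : 0 < R) (M : ℝ) : ∃ C, 0 ≤ C ∧ ∀ (i : Fin (n + 1)) (x : Sp n), ‖x‖ ≤ M →
    |gi n k R i x| ≤ C := by
  obtain ⟨C, hC0, hC⟩ := wf_bdd hn hk hR M
  refine ⟨C + (exp ((n + 4) * (k * M ^ 2)) * |KR n k R + (4 * n + 8) * (k * M)| + (n + 1) * C), by positivity, ?_⟩
  intro i x hx
  have h1 := hC ‖x‖ (norm_nonneg x) hx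
  have h2 := wf_nonneg (n := n) hk hR (norm_nonneg x)
  have h3 := q_bdd (n := n) hk hR (norm_nonneg x) hx
  have h3' : exp ((n + 4) * (k * M ^ 2)) * (KR n k R + (4 * n + 8) * (k * M)) ≤
    exp ((n + 4) * (k * M ^ 2)) * |KR n k R + (4 * n + 8) * (k * M)| := by gcongr; exact le_abs_self _
  have h4 := q_nonneg (n := n) hk hR (norm_nonneg x)
  have h5 : |x i ^ 2 / ‖x‖ ^ 2| ≤ 1 := by
    rw [abs_of_nonneg (by positivity)]
    apply div_le_one_of_le₀ _ (by positivity)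
    rw [← sq_abs]
    have := coord_le x i
    gcongr
  have h6 : |qf n k R ‖x‖ - (n + 1) * wf n k R ‖x‖| ≤
    exp ((n + 4) * (k * M ^ 2)) * |KR n k R + (4 * n + 8) * (k * M)| + (n + 1) * C := by
    have : (n + 1) * wf n k R ‖x‖ ≤ (n + 1) * C := by gcongr
    have h7 : 0 ≤ (n + 1) * wf n k R ‖x‖ := by positivity
    rw [abs_le]; constructor <;> nlinarith
  have e : gi n k R i x = wf n k R ‖x‖ + (x i ^ 2 / ‖x‖ ^ 2) * (qf n k R ‖x‖ - (n + 1) * wf n k R ‖x‖) := by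
    rw [gi]; ring
  rw [e]
  calc _ ≤ |wf n k R ‖x‖| + |x i ^ 2 / ‖x‖ ^ 2| * |qf n k R ‖x‖ - (n + 1) * wf n k R ‖x‖| := by
        rw [← abs_mul]; exact abs_add_le _ _
    _ ≤ C + 1 * (exp ((n + 4) * (k * M ^ 2)) * |KR n k R + (4 * n + 8) * (k * M)| + (n + 1) * C) := by
        rw [abs_of_nonneg h2]; gcongr
    _ = _ := by rw [one_mul]

lemma int_of_bdd (h g : Sp n → ℝ) (hh : Integrable h) (hg : Measurable g) (C : ℝ)
    (hC : ∀ x, h x ≠ 0 → |g x| ≤ C) : Integrable (fun x => h x * g x) := by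
  apply (hh.norm.mul_const C).mono' (hh.1.mul hg.aestronglyMeasurable)
  refine Eventually.of_forall fun x => ?_
  rw [Pi.mul_apply, norm_mul]
  by_cases hx : h x = 0
  · simp [hx]
  · have := hC x hx
    simp only [norm_eq_abs]
    gcongr

lemma gi_meas (i : Fin (n + 1)) : Measurable (gi n k R i) := by
  have h1 : Measurable fun x : Sp n => wf n k R ‖x‖ := wf_meas.comp measurable_norm
  have h2 : Measurable fun x : Sp n => qf n k R ‖x‖ := q_meas.comp measurable_norm
  unfold gi
  fun_prop

lemma ibp (hn : 1 ≤ n) (hk : 0 < k) (hR : 0 < R) (h : Sp n → ℝ) (hC : ContDiff ℝ 1 h) (hs : HasCompactSupport h) :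
    Integrable (fun x => h x * qf n k R ‖x‖) ∧ Integrable (fun x => wf n k R ‖x‖ * fderiv ℝ h x x) ∧
    ∫ x, h x * qf n k R ‖x‖ = - ∫ x, wf n k R ‖x‖ * fderiv ℝ h x x := by
  obtain ⟨M, hM⟩ := hs.isBounded.exists_norm_le
  have hh : Integrable h := hC.continuous.integrable_of_hasCompactSupport hs
  have hhM : ∀ x, h x ≠ 0 → ‖x‖ ≤ M := fun x hx => hM x (subset_tsupport h hx)
  obtain ⟨Cg, -, hCg⟩ := gi_bdd (n := n) hn hk hR M
  obtain ⟨Cw, hCw0, hCw⟩ := wf_bdd (n := n) hn hk hR M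
  have hcd : Continuous (fderiv ℝ h) := hC.continuous_fderiv (by norm_num)
  have hds : HasCompactSupport (fderiv ℝ h) := hs.fderiv ℝ
  have hwm : Measurable fun x : Sp n => wf n k R ‖x‖ := wf_meas.comp measurable_norm
  have i1 : ∀ i, Integrable (fun x => h x * gi n k R i x) := fun i =>
    int_of_bdd h _ hh (gi_meas i) Cg (fun x hx => hCg i x (hhM x hx))
  have hd : ∀ i : Fin (n + 1), Integrable (fun x => fderiv ℝ h x (EuclideanSpace.single i 1)) := by
    intro i
    apply Continuous.integrable_of_hasCompactSupport (by fun_prop)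
    exact hds.comp_left (g := fun L : Sp n →L[ℝ] ℝ => L (EuclideanSpace.single i 1)) (by simp)
  have hdM : ∀ (i : Fin (n + 1)) x, fderiv ℝ h x (EuclideanSpace.single i 1) ≠ 0 → ‖x‖ ≤ M := by
    intro i x hx
    apply hM x
    apply support_fderiv_subset ℝ
    intro h0
    rw [h0] at hx; simp at hx
  have bX : ∀ (i : Fin (n + 1)) (x : Sp n), ‖x‖ ≤ M → |wf n k R ‖x‖ * x i| ≤ Cw * M := by
    intro i x hx
    rw [abs_mul, abs_of_nonneg (wf_nonneg hk hR (norm_nonneg x))]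
    have h1 := hCw ‖x‖ (norm_nonneg x) hx
    have h2 := (coord_le x i).trans hx
    gcongr
  have i2 : ∀ i : Fin (n + 1), Integrable (fun x => fderiv ℝ h x (EuclideanSpace.single i 1) * (wf n k R ‖x‖ * x i)) :=
    fun i => int_of_bdd _ _ (hd i) (by fun_prop) (Cw * M) (fun x hx => bX i x (hdM i x hx))
  have i3 : ∀ i : Fin (n + 1), Integrable (fun x => h x * (wf n k R ‖x‖ * x i)) :=
    fun i => int_of_bdd _ _ hh (by fun_prop) (Cw * M) (fun x hx => bX i x (hhM x hx))
  have key : ∀ i : Fin (n + 1), ∫ x, h x * gi n k R i x =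
      - ∫ x, fderiv ℝ h x (EuclideanSpace.single i 1) * (wf n k R ‖x‖ * x i) := by
    intro i
    exact integral_bilinear_hasLineDerivAt_right_eq_neg_left_of_integrable (B := ContinuousLinearMap.mul ℝ ℝ)
      (f := h) (g := fun x : Sp n => wf n k R ‖x‖ * x i) (v := EuclideanSpace.single i 1)
      (i2 i) (i1 i) (i3 i)
      (fun x _ => ((hC.differentiable (by norm_num)) x).hasFDerivAt.hasLineDerivAt _)
      (fun x _ => dX hn hk hR i x)
  have e1 : (fun x => h x * qf n k R ‖x‖) = fun x => ∑ i, h x * gi n k R i x := by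
    ext x; rw [← Finset.mul_sum, gi_sum hR]
  have e2 : (fun x => wf n k R ‖x‖ * fderiv ℝ h x x) =
      fun x => ∑ i, fderiv ℝ h x (EuclideanSpace.single i 1) * (wf n k R ‖x‖ * x i) := by
    ext x
    have hx : x = ∑ i, x i • EuclideanSpace.single i (1 : ℝ) := by
      ext j
      simp [Finset.sum_apply, Pi.single_apply]
    conv_lhs => rw [hx, map_sum]
    rw [← hx, Finset.mul_sum]
    congr with i
    rw [map_smul, smul_eq_mul]; ring
  refine ⟨?_, ?_, ?_⟩
  · rw [e1]; exact integrable_finsetSum _ fun i _ => i1 i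
  · rw [e2]; exact integrable_finsetSum _ fun i _ => i2 i
  · rw [e1, e2, integral_finsetSum _ fun i _ => i1 i, integral_finsetSum _ fun i _ => i2 i,
      ← Finset.sum_neg_distrib]
    exact Finset.sum_congr rfl fun i _ => key i

end BQ

namespace BQ
open Real

variable {n : ℕ} {k R : ℝ}

noncomputable def Jm (n : ℕ) (k R : ℝ) (A : Set (Sp n)) : ENNReal := ∫⁻ x in A, ENNReal.ofReal (Jf n k R ‖x‖)

lemma ae_ne (n : ℕ) : ∀ᵐ x : Sp n, x ≠ 0 := by
  rw [ae_iff]; simp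

lemma vol_Ph (hn : 1 ≤ n) (hk : 0 < k) (hR : 0 < R) (A : Set (Sp n)) (hA : MeasurableSet A) :
    volume (Ph n k R '' A) = Jm n k R A := by
  have hA' : MeasurableSet (A \ {0}) := hA.diff (measurableSet_singleton 0)
  have h := lintegral_abs_det_fderiv_eq_addHaar_image volume hA' (f := Ph n k R) (f' := DP n k R)
    (fun x hx => (dPh hk hR x hx.2).hasFDerivWithinAt) (Ph_inj hn hk hR).injOn
  have e1 : volume (Ph n k R '' A) = volume (Ph n k R '' (A \ {0})) := by
    rw [image_sdiff (Ph_inj hn hk hR), image_singleton, measure_sdiff_null (measure_singleton _)]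
  rw [e1, ← h, Jm, setLIntegral_congr (sdiff_null_ae_eq_self (s := A) (measure_singleton (0 : Sp n))).symm]
  apply setLIntegral_congr_fun hA'
  intro x hx
  simp only
  rw [DP_det hk hR x hx.2, abs_of_pos (J_pos hk _)]

theorem star (hn : 1 ≤ n) (hk : 0 < k) (hR : 0 < R) (h : Sp n → ℝ) (hC : ContDiff ℝ 1 h)
    (hs : HasCompactSupport h) (h0 : ∀ x, 0 ≤ h x) :
    (∫⁻ t in Ioi (0:ℝ), ENNReal.ofReal (isoC n) * (Jm n k R {x | t < h x}) ^ ((n:ℝ) / (n + 1))) +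
      ∫⁻ x, ENNReal.ofReal (h x * qf n k R ‖x‖) ≤
    ∫⁻ x, ENNReal.ofReal (exp ((n + 4) * (k * ‖x‖ ^ 2)) * ‖fderiv ℝ h x‖) := by
  set Ψ := (Eq n k R hn hk hR).symm with hΨ
  have hΨP : ∀ y, Ph n k R (Ψ y) = y := fun y => (Eq n k R hn hk hR).apply_symm_apply y
  have hPΨ : ∀ x, Ψ (Ph n k R x) = x := fun y => (Eq n k R hn hk hR).symm_apply_apply y
  obtain ⟨L, hL⟩ := hC.lipschitzWith_of_hasCompactSupport hs (by norm_num)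
  obtain ⟨M, hM⟩ := hs.isBounded.exists_norm_le
  have hdf : Differentiable ℝ h := hC.differentiable (by norm_num)
  have Ph0 : Ph n k R 0 = 0 := by simp [Ph]
  have sob := sobolev n hn (h ∘ Ψ) L (by simpa using hL.comp (Eq_lip hn hk hR)) (fun y => h0 _)
    (phi n k R (|M| + 1)) (by
      intro y hy
      by_contra hne
      have h1 : ‖Ψ y‖ ≤ |M| := (hM _ (subset_tsupport h hne)).trans (le_abs_self M)
      have h2 : phi n k R ‖Ψ y‖ = ‖y‖ := by rw [← Ph_norm hk hR, hΨP]
      have h3 := phi_exp hn hk hR (norm_nonneg (Ψ y)) (h1.trans (by linarith : |M| ≤ |M| + 1))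
      linarith) (fun y => (fderiv ℝ h (Ψ y)).comp (IP n k R (Ψ y))) (by
      filter_upwards [ae_ne n] with y hy
      have hx : Ψ y ≠ 0 := by
        intro h
        have := hΨP y
        rw [h, Ph0] at this; exact hy this.symm
      have := dEq hn hk hR (Ψ y) hx
      rw [hΨP] at this
      exact (hdf (Ψ y)).hasFDerivAt.comp y this)
  have eset : ∀ t : ℝ, volume {y | t < (h ∘ Ψ) y} = Jm n k R {x | t < h x} := by
    intro t
    rw [← vol_Ph hn hk hR _ (measurableSet_lt measurable_const hC.continuous.measurable)]
    congr 1
    ext y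
    simp only [Set.mem_ofPred_eq, mem_image, Function.comp]
    constructor
    · intro hy; exact ⟨Ψ y, hy, hΨP y⟩
    · rintro ⟨x, hx, rfl⟩; rwa [hPΨ]
  simp only [eset] at sob
  -- change of variables
  have cv : ∫⁻ y, ENNReal.ofReal ‖(fderiv ℝ h (Ψ y)).comp (IP n k R (Ψ y))‖ =
      ∫⁻ x, ENNReal.ofReal (Jf n k R ‖x‖ * ‖(fderiv ℝ h x).comp (IP n k R x)‖) := by
    have hm : MeasurableSet ({0}ᶜ : Set (Sp n)) := (measurableSet_singleton 0).compl
    have := lintegral_image_eq_lintegral_abs_det_fderiv_mul volume hm (f := Ph n k R) (f' := DP n k R)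
      (fun x hx => (dPh hk hR x hx).hasFDerivWithinAt) (Ph_inj hn hk hR).injOn
      (fun y => ENNReal.ofReal ‖(fderiv ℝ h (Ψ y)).comp (IP n k R (Ψ y))‖)
    have him : Ph n k R '' {0}ᶜ = {0}ᶜ := by
      rw [image_compl_eq ⟨Ph_inj hn hk hR, Ph_surj hn hk hR⟩, image_singleton, Ph0]
    have hr : (volume : Measure (Sp n)).restrict {0}ᶜ = volume := by
      rw [Measure.restrict_eq_self_of_ae_mem]; exact ae_ne n
    rw [him, hr] at this
    rw [this]
    apply lintegral_congr_ae
    filter_upwards [ae_ne n] with x hx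
    rw [DP_det hk hR x hx, hPΨ, abs_of_pos (J_pos hk _), ENNReal.ofReal_mul (J_pos hk _).le]
  rw [cv] at sob
  obtain ⟨iq, iw, hibp⟩ := ibp hn hk hR h hC hs
  have iF : Integrable (fun x : Sp n => exp ((n + 4) * (k * ‖x‖ ^ 2)) * ‖fderiv ℝ h x‖) := by
    have hcd : Continuous (fderiv ℝ h) := hC.continuous_fderiv (by norm_num)
    apply Continuous.integrable_of_hasCompactSupport (by fun_prop)
    exact (hs.fderiv ℝ).norm.mul_left
  have b1 : ∫⁻ x, ENNReal.ofReal (Jf n k R ‖x‖ * ‖(fderiv ℝ h x).comp (IP n k R x)‖) ≤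
      ∫⁻ x, ENNReal.ofReal (exp ((n + 4) * (k * ‖x‖ ^ 2)) * ‖fderiv ℝ h x‖ + wf n k R ‖x‖ * fderiv ℝ h x x) := by
    apply lintegral_mono_ae
    filter_upwards [ae_ne n] with x hx
    exact ENNReal.ofReal_le_ofReal (pw_vec hn hk hR x hx _)
  have nn : 0 ≤ᵐ[volume] fun x : Sp n => exp ((n + 4) * (k * ‖x‖ ^ 2)) * ‖fderiv ℝ h x‖ + wf n k R ‖x‖ * fderiv ℝ h x x := by
    filter_upwards [ae_ne n] with x hx
    refine le_trans ?_ (pw_vec hn hk hR x hx _)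
    have := J_pos (n := n) (R := R) hk ‖x‖
    positivity
  have nq : 0 ≤ fun x : Sp n => h x * qf n k R ‖x‖ :=
    fun x => mul_nonneg (h0 x) (q_nonneg hk hR (norm_nonneg x))
  have nF : 0 ≤ fun x : Sp n => exp ((n + 4) * (k * ‖x‖ ^ 2)) * ‖fderiv ℝ h x‖ :=
    fun x => mul_nonneg (exp_pos _).le (norm_nonneg _)
  have eA : ENNReal.ofReal (∫ x, (exp ((n + 4) * (k * ‖x‖ ^ 2)) * ‖fderiv ℝ h x‖ + wf n k R ‖x‖ * fderiv ℝ h x x)) =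
      ∫⁻ x, ENNReal.ofReal (exp ((n + 4) * (k * ‖x‖ ^ 2)) * ‖fderiv ℝ h x‖ + wf n k R ‖x‖ * fderiv ℝ h x x) :=
    ofReal_integral_eq_lintegral_ofReal (iF.add iw) nn
  calc _ ≤ (∫⁻ x, ENNReal.ofReal (exp ((n + 4) * (k * ‖x‖ ^ 2)) * ‖fderiv ℝ h x‖ + wf n k R ‖x‖ * fderiv ℝ h x x))
        + ∫⁻ x, ENNReal.ofReal (h x * qf n k R ‖x‖) := by gcongr; exact sob.trans b1
    _ = ENNReal.ofReal (∫ x, (exp ((n + 4) * (k * ‖x‖ ^ 2)) * ‖fderiv ℝ h x‖ + wf n k R ‖x‖ * fderiv ℝ h x x)) +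
        ENNReal.ofReal (∫ x, h x * qf n k R ‖x‖) := by
        rw [eA, ofReal_integral_eq_lintegral_ofReal iq (Eventually.of_forall nq)]
    _ = ENNReal.ofReal (∫ x, exp ((n + 4) * (k * ‖x‖ ^ 2)) * ‖fderiv ℝ h x‖) := by
        rw [← ENNReal.ofReal_add (integral_nonneg_of_ae nn) (integral_nonneg nq), integral_add iF iw, hibp]
        congr 1; ring
    _ = _ := ofReal_integral_eq_lintegral_ofReal iF (Eventually.of_forall nF)

end BQ

namespace BQ
open Real
open scoped MeasureTheory

lemma finrank_perp {n : ℕ} (ν : Sp n) (hν : ‖ν‖ = 1) : Module.finrank ℝ (ℝ ∙ ν)ᗮ = n := by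
  haveI : Fact (Module.finrank ℝ (Sp n) = n + 1) := ⟨by simp⟩
  exact Submodule.finrank_orthogonal_span_singleton (by intro h; simp [h] at hν)

lemma proj_le {n : ℕ} (ν : Sp n) (hν : ‖ν‖ = 1) (A : Set (Sp n)) :
    volume ((ℝ ∙ ν)ᗮ.orthogonalProjectionOnto '' A) ≤ μHE[n] A := by
  have h1 : (volume : Measure (ℝ ∙ ν)ᗮ) = μHE[n] := by
    rw [← InnerProductSpace.euclideanHausdorffMeasure_eq_volume, finrank_perp ν hν]
  rw [h1]
  simp only [Measure.euclideanHausdorffMeasure_def, Measure.smul_apply]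
  gcongr
  have hl : LipschitzWith 1 ((ℝ ∙ ν)ᗮ.orthogonalProjectionOnto : Sp n → (ℝ ∙ ν)ᗮ) := by
    have := ((ℝ ∙ ν)ᗮ.orthogonalProjectionOnto).lipschitz
    refine this.weaken ?_
    exact (Submodule.orthogonalProjectionOnto_norm_le _)
  simpa using hl.hausdorffMeasure_image_le (d := (n : ℝ)) (by positivity) A

lemma slab {n : ℕ} (ν : Sp n) (hν : ‖ν‖ = 1) (A : Set (Sp n)) (a η t : ℝ) (hη : 0 < η) (ht : 0 ≤ t)
    (hA : ∀ x ∈ A, a ≤ inner ℝ ν x ∧ inner ℝ ν x < a + η) :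
    volume {x : Sp n | ∃ s ∈ Icc 0 t, x + s • ν ∈ A} ≤ ENNReal.ofReal (t + η) * μHE[n] A := by
  set e := (ℝ ∙ ν).measurableEquivProd (0 : Sp n)
  have me : MeasurePreserving e volume (volume.prod volume) := by
    have := (ℝ ∙ ν).measurePreserving_measurableEquivProd (0 : Sp n)
    rwa [InnerProductSpace.euclideanHausdorffMeasure_eq_volume] at this
  set T := toMeasurable volume ((ℝ ∙ ν)ᗮ.orthogonalProjectionOnto '' A)
  set u := LinearIsometryEquiv.toSpanUnitSingleton (𝕜 := ℝ) ν hν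
  set I : Set (ℝ ∙ ν) := u.symm ⁻¹' (Icc (a - t) (a + η))
  have hI : volume I = ENNReal.ofReal (t + η) := by
    rw [(u.symm.measurePreserving).measure_preimage measurableSet_Icc.nullMeasurableSet, Real.volume_Icc]
    congr 1; ring
  have hsub : {x : Sp n | ∃ s ∈ Icc 0 t, x + s • ν ∈ A} ⊆ e ⁻¹' (I ×ˢ T) := by
    rintro x ⟨s, hs, hx⟩
    have hxe : e x = ((ℝ ∙ ν).orthogonalProjectionOnto x, (ℝ ∙ ν)ᗮ.orthogonalProjectionOnto x) := by
      simp [e, Submodule.measurableEquivProd_apply]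
    have hp : (ℝ ∙ ν)ᗮ.orthogonalProjectionOnto (x + s • ν) = (ℝ ∙ ν)ᗮ.orthogonalProjectionOnto x := by
      rw [map_add, map_smul]
      have : (ℝ ∙ ν)ᗮ.orthogonalProjectionOnto ν = 0 := by
        rw [Submodule.orthogonalProjectionOnto_eq_zero_iff]
        exact Submodule.le_orthogonal_orthogonal _ (Submodule.mem_span_singleton_self ν)
      rw [this]; simp
    have hq : u.symm ((ℝ ∙ ν).orthogonalProjectionOnto x) = inner ℝ ν x := by
      rw [LinearIsometryEquiv.symm_apply_eq]
      apply Subtype.ext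
      rw [← Submodule.starProjection_apply, Submodule.starProjection_unit_singleton ℝ hν]
      rfl
    rw [mem_preimage, hxe]
    refine ⟨?_, subset_toMeasurable _ _ ?_⟩
    · change u.symm _ ∈ Icc _ _
      simp only
      rw [hq]
      have := hA _ hx
      rw [inner_add_right, inner_smul_right, real_inner_self_eq_norm_sq, hν] at this
      constructor <;> linarith [hs.1, hs.2]
    · simp only
      rw [← hp]; exact mem_image_of_mem _ hx
  calc _ ≤ volume (e ⁻¹' (I ×ˢ T)) := measure_mono hsub
    _ = volume I * volume T := by
      rw [me.measure_preimage, Measure.prod_prod]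
      exact ((measurableSet_Icc.preimage u.symm.continuous.measurable).prod (measurableSet_toMeasurable _ _)).nullMeasurableSet
    _ ≤ _ := by
      rw [hI, measure_toMeasurable]
      gcongr; exact proj_le ν hν A

lemma slab_all {n : ℕ} (ν : Sp n) (hν : ‖ν‖ = 1) (A : Set (Sp n)) (t : ℝ) (ht : 0 < t) :
    volume {x : Sp n | ∃ s ∈ Icc 0 t, x + s • ν ∈ A} ≤ ENNReal.ofReal t * μHE[n] A := by
  have key : ∀ η : ℝ, 0 < η → volume {x : Sp n | ∃ s ∈ Icc 0 t, x + s • ν ∈ A} ≤ ENNReal.ofReal (t + η) * μHE[n] A := by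
    intro η hη
    set L : ℤ → Set (Sp n) := fun k => {x | ⌊inner ℝ ν x / η⌋ = k}
    have hLm : ∀ k, MeasurableSet (L k) := fun k => by
      have : Measurable fun x : Sp n => ⌊inner ℝ ν x / η⌋ :=
        Int.measurable_floor.comp ((continuous_const.inner continuous_id).div_const _).measurable
      exact this (measurableSet_singleton k)
    have hsub : {x : Sp n | ∃ s ∈ Icc 0 t, x + s • ν ∈ A} ⊆
        ⋃ k, {x : Sp n | ∃ s ∈ Icc 0 t, x + s • ν ∈ L k ∩ A} := by
      rintro x ⟨s, hs, hx⟩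
      exact mem_iUnion.2 ⟨_, s, hs, rfl, hx⟩
    calc _ ≤ ∑' k, volume {x : Sp n | ∃ s ∈ Icc 0 t, x + s • ν ∈ L k ∩ A} :=
          (measure_mono hsub).trans (measure_iUnion_le _)
      _ ≤ ∑' k, ENNReal.ofReal (t + η) * (μHE[n]).restrict A (L k) := by
          gcongr with k
          rw [Measure.restrict_apply (hLm k)]
          apply slab ν hν _ (k * η) η t hη ht.le
          rintro x ⟨hx, -⟩
          have : ⌊inner ℝ ν x / η⌋ = k := hx
          rw [Int.floor_eq_iff, le_div_iff₀ hη, div_lt_iff₀ hη] at this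
          exact ⟨this.1, by linarith [this.2]⟩
      _ = _ := by
          rw [ENNReal.tsum_mul_left, ← measure_iUnion _ hLm]
          · have : (⋃ k, L k) = univ := by
              ext x; simp [L]
            rw [this, Measure.restrict_apply_univ]
          · intro i j hij
            rw [Function.onFun, Set.disjoint_left]
            intro x hi hj
            exact hij (hi.symm.trans hj)
  by_cases hA : μHE[n] A = ⊤
  · rw [hA, ENNReal.mul_top (by simpa using ht)]; exact le_top
  · have hlim : Tendsto (fun η : ℝ => ENNReal.ofReal (t + η) * μHE[n] A) (nhdsWithin 0 (Ioi 0)) (nhds (ENNReal.ofReal (t + 0) * μHE[n] A)) := by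
      apply ENNReal.Tendsto.mul_const _ (Or.inr hA)
      apply ENNReal.tendsto_ofReal
      exact (tendsto_const_nhds.add tendsto_id).mono_left nhdsWithin_le_nhds
    rw [add_zero] at hlim
    apply ge_of_tendsto hlim
    filter_upwards [self_mem_nhdsWithin] with η hη using key η hη

lemma sub_of_frontier {n : ℕ} {Ω T : Set (Sp n)} (hpre : IsPreconnected T) (hd : ∀ y ∈ T, y ∉ frontier Ω)
    {a b : Sp n} (ha : a ∈ T) (hb : b ∈ T) (haΩ : a ∈ Ω) : b ∈ Ω := by
  by_contra hbΩ
  have hc : T ⊆ interior Ω ∪ (closure Ω)ᶜ := by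
    intro y hy
    have := hd y hy
    rw [frontier, mem_diff] at this
    by_cases h : y ∈ closure Ω
    · left; by_contra h'; exact this ⟨h, h'⟩
    · right; exact h
  have h1 : (T ∩ interior Ω).Nonempty := by
    refine ⟨a, ha, ?_⟩
    rcases hc ha with h | h
    · exact h
    · exact absurd (subset_closure haΩ) h
  have h2 : (T ∩ (closure Ω)ᶜ).Nonempty := by
    refine ⟨b, hb, ?_⟩
    rcases hc hb with h | h
    · exact absurd (interior_subset h) hbΩ
    · exact h
  obtain ⟨z, -, hz1, hz2⟩ := hpre _ _ isOpen_interior isClosed_closure.isOpen_compl hc h1 h2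
  exact hz2 (subset_closure (interior_subset hz1))

lemma cross {n : ℕ} {Ω : Set (Sp n)} {x : Sp n} {v : Sp n} (h : ¬ (x ∈ Ω ↔ x + v ∈ Ω)) :
    ∃ s ∈ Icc (0:ℝ) 1, x + s • v ∈ frontier Ω := by
  by_contra hc
  push Not at hc
  apply h
  have hpre : IsPreconnected ((fun s : ℝ => x + s • v) '' Icc 0 1) :=
    isPreconnected_Icc.image _ (by fun_prop)
  have hm0 : x ∈ ((fun s : ℝ => x + s • v) '' Icc 0 1) := ⟨0, by simp, by simp⟩
  have hm1 : x + v ∈ ((fun s : ℝ => x + s • v) '' Icc 0 1) := ⟨1, by simp, by simp⟩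
  have hd : ∀ y ∈ ((fun s : ℝ => x + s • v) '' Icc 0 1), y ∉ frontier Ω := by
    rintro _ ⟨s, hs, rfl⟩ hy
    exact hc s hs hy
  exact ⟨fun hx => sub_of_frontier hpre hd hm0 hm1 hx, fun hx => sub_of_frontier hpre hd hm1 hm0 hx⟩

lemma gg {n : ℕ} (Ω : Set (Sp n)) (v : Sp n) (hv : v ≠ 0) (g : Sp n → ℝ) (hg : Continuous g) (g0 : ∀ x, 0 ≤ g x)
    (δ : ℝ) (hδ : 0 ≤ δ) (hm : ∀ y w, ‖w‖ ≤ ‖v‖ → g (y + w) ≤ g y + δ) :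
    ∫⁻ x in {x | ¬ (x ∈ Ω ↔ x + v ∈ Ω)}, ENNReal.ofReal (g x) ≤
      ENNReal.ofReal ‖v‖ * ∫⁻ y in frontier Ω, ENNReal.ofReal (g y + δ) ∂(μHE[n]) := by
  have hv' : 0 < ‖v‖ := norm_pos_iff.2 hv
  set D := {x | ¬ (x ∈ Ω ↔ x + v ∈ Ω)}
  rw [lintegral_eq_lintegral_meas_lt _ (Eventually.of_forall g0) hg.measurable.aemeasurable,
    lintegral_eq_lintegral_meas_lt _ (Eventually.of_forall fun x => add_nonneg (g0 x) hδ) (by fun_prop),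
    ← lintegral_const_mul' _ _ ENNReal.ofReal_ne_top]
  refine lintegral_mono fun u => ?_
  rw [Measure.restrict_apply (isOpen_lt continuous_const hg).measurableSet,
    Measure.restrict_apply (isOpen_lt continuous_const (by fun_prop)).measurableSet]
  set ν := ‖v‖⁻¹ • v
  have hν : ‖ν‖ = 1 := by rw [norm_smul, norm_inv, norm_norm, inv_mul_cancel₀ hv'.ne']
  have hvν : v = ‖v‖ • ν := by rw [smul_smul, mul_inv_cancel₀ hv'.ne', one_smul]
  refine le_trans (measure_mono ?_) (slab_all ν hν _ ‖v‖ hv')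
  rintro x ⟨hx1, hx2⟩
  obtain ⟨s, hs, hsx⟩ := cross hx2
  refine ⟨s * ‖v‖, ⟨by have := hs.1; positivity, by nlinarith [hs.2]⟩, ?_, ?_⟩
  · have h1 : x + (s * ‖v‖) • ν = x + s • v := by rw [mul_smul, ← hvν]
    rw [h1]
    have h2 := hm (x + s • v) (-(s • v)) (by
      rw [norm_neg, norm_smul, Real.norm_of_nonneg hs.1]; nlinarith [hs.2])
    rw [add_neg_cancel_right] at h2
    exact lt_of_lt_of_le hx1 h2
  · rw [mul_smul, ← hvν]; exact hsx

end BQ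

namespace BQ
open Real
open scoped MeasureTheory Convolution

noncomputable def mo {n : ℕ} (φ : ContDiffBump (0 : Sp n)) (Ω : Set (Sp n)) : Sp n → ℝ :=
  (φ.normed volume) ⋆[ContinuousLinearMap.lsmul ℝ ℝ, volume] (Ω.indicator fun _ => (1 : ℝ))

lemma ind_li {n : ℕ} {Ω : Set (Sp n)} (hΩ : MeasurableSet Ω) :
    LocallyIntegrable (Ω.indicator fun _ => (1 : ℝ)) (volume : Measure (Sp n)) :=
  (locallyIntegrable_const 1).indicator hΩ

lemma mo_contDiff {n : ℕ} (φ : ContDiffBump (0 : Sp n)) {Ω : Set (Sp n)} (hΩ : MeasurableSet Ω) :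
    ContDiff ℝ 1 (mo φ Ω) :=
  HasCompactSupport.contDiff_convolution_left _ φ.hasCompactSupport_normed (φ.contDiff_normed (n := 1)) (ind_li hΩ)

lemma mo_eq {n : ℕ} (φ : ContDiffBump (0 : Sp n)) (Ω : Set (Sp n)) (x : Sp n) :
    mo φ Ω x = ∫ t, φ.normed volume (x - t) * Ω.indicator (fun _ => (1 : ℝ)) t := by
  simp only [mo]
  rw [convolution_eq_swap]; rfl

lemma mo_int {n : ℕ} (φ : ContDiffBump (0 : Sp n)) {Ω : Set (Sp n)} (hΩ : MeasurableSet Ω) (x : Sp n) :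
    Integrable fun t => φ.normed volume (x - t) * Ω.indicator (fun _ => (1 : ℝ)) t := by
  have h1 : Integrable fun t => φ.normed volume (x - t) :=
    (φ.integrable_normed (μ := (volume : Measure (Sp n)))).comp_sub_left x
  refine h1.mul_bdd (c := 1) ((measurable_const.indicator hΩ).aestronglyMeasurable) (Eventually.of_forall fun t => ?_)
  by_cases h : t ∈ Ω <;> simp [h]

lemma mo_nonneg {n : ℕ} (φ : ContDiffBump (0 : Sp n)) (Ω : Set (Sp n)) (x : Sp n) : 0 ≤ mo φ Ω x := by
  rw [mo_eq]
  refine integral_nonneg fun t => mul_nonneg (φ.nonneg_normed _) (indicator_nonneg (fun _ _ => zero_le_one) _)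

lemma mo_lint {n : ℕ} (φ : ContDiffBump (0 : Sp n)) {Ω : Set (Sp n)} (hΩ : MeasurableSet Ω) (x : Sp n) :
    ENNReal.ofReal (mo φ Ω x) = ∫⁻ t in Ω, ENNReal.ofReal (φ.normed volume (x - t)) := by
  rw [mo_eq, ofReal_integral_eq_lintegral_ofReal (mo_int φ hΩ x)
    (Eventually.of_forall fun t => mul_nonneg (φ.nonneg_normed _) (indicator_nonneg (fun _ _ => zero_le_one) _)),
    ← lintegral_indicator hΩ]
  congr 1; ext t
  by_cases h : t ∈ Ω <;> simp [h]

lemma mo_one {n : ℕ} (φ : ContDiffBump (0 : Sp n)) {Ω : Set (Sp n)} (x : Sp n) (h : Metric.ball x φ.rOut ⊆ Ω) :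
    mo φ Ω x = 1 := by
  have hx : x ∈ Ω := h (Metric.mem_ball_self φ.rOut_pos)
  rw [mo, ContDiffBump.normed_convolution_eq_right]
  · simp [hx]
  · intro y hy; simp [hx, h hy]

lemma mo_sub {n : ℕ} (φ : ContDiffBump (0 : Sp n)) {Ω : Set (Sp n)} (hΩ : MeasurableSet Ω) (x v : Sp n) :
    ‖mo φ Ω (x + v) - mo φ Ω x‖ₑ ≤ ∫⁻ z in {z | ¬ (z ∈ Ω ↔ z + v ∈ Ω)}, ENNReal.ofReal (φ.normed volume (x - z)) := by
  have hD : MeasurableSet {z | ¬ (z ∈ Ω ↔ z + v ∈ Ω)} := by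
    have h2 : MeasurableSet {z | z + v ∈ Ω} := (measurable_add_const v) hΩ
    have : {z | ¬ (z ∈ Ω ↔ z + v ∈ Ω)} = Ω ∆ {z | z + v ∈ Ω} := by
      ext z
      simp only [Set.mem_ofPred_eq, Set.mem_symmDiff]
      tauto
    rw [this]; exact hΩ.symmDiff h2
  have e1 : mo φ Ω (x + v) = ∫ z, φ.normed volume (x - z) * Ω.indicator (fun _ => (1 : ℝ)) (z + v) := by
    rw [mo_eq, ← integral_add_right_eq_self _ v]
    congr 1; ext z
    rw [add_sub_add_right_eq_sub]
  have i1 : Integrable fun z => φ.normed volume (x - z) * Ω.indicator (fun _ => (1 : ℝ)) (z + v) := by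
    have := (mo_int φ hΩ (x + v)).comp_add_right v
    simpa only [add_sub_add_right_eq_sub] using this
  rw [e1, mo_eq, ← integral_sub i1 (mo_int φ hΩ x)]
  refine (enorm_integral_le_lintegral_enorm _).trans ?_
  rw [← lintegral_indicator hD]
  refine lintegral_mono fun z => ?_
  have h0 := φ.nonneg_normed (μ := (volume : Measure (Sp n))) (x - z)
  by_cases h1 : z ∈ Ω <;> by_cases h2 : z + v ∈ Ω <;>
    simp [h1, h2, indicator, Real.enorm_eq_ofReal h0]

lemma mo_grad {n : ℕ} (φ : ContDiffBump (0 : Sp n)) {Ω : Set (Sp n)} (hΩ : MeasurableSet Ω)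
    (hfin : μHE[n] (frontier Ω) ≠ ⊤) (x : Sp n) :
    ENNReal.ofReal ‖fderiv ℝ (mo φ Ω) x‖ ≤ ∫⁻ y in frontier Ω, ENNReal.ofReal (φ.normed volume (x - y)) ∂(μHE[n]) := by
  set ρ := φ.normed (volume : Measure (Sp n))
  have hρ : Continuous ρ := φ.continuous_normed
  have hu : UniformContinuous ρ := φ.hasCompactSupport_normed.uniformContinuous_of_continuous hρ
  have key : ∀ δ : ℝ, 0 < δ → ENNReal.ofReal ‖fderiv ℝ (mo φ Ω) x‖ ≤
      (∫⁻ y in frontier Ω, ENNReal.ofReal (ρ (x - y)) ∂(μHE[n])) + ENNReal.ofReal δ * μHE[n] (frontier Ω) := by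
    intro δ hδ
    have eC : ∫⁻ y in frontier Ω, ENNReal.ofReal (ρ (x - y) + δ) ∂(μHE[n]) =
      (∫⁻ y in frontier Ω, ENNReal.ofReal (ρ (x - y)) ∂(μHE[n])) + ENNReal.ofReal δ * μHE[n] (frontier Ω) := by
      rw [← setLIntegral_const, ← lintegral_add_right _ measurable_const]
      congr 1; ext y
      exact ENNReal.ofReal_add (φ.nonneg_normed _) hδ.le
    rw [← eC]
    set C := ∫⁻ y in frontier Ω, ENNReal.ofReal (ρ (x - y) + δ) ∂(μHE[n])
    by_cases hC : C = ⊤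
    · rw [hC]; exact le_top
    rw [← ENNReal.ofReal_toReal hC]
    apply ENNReal.ofReal_le_ofReal
    apply norm_fderiv_le_of_lip' ℝ ENNReal.toReal_nonneg
    obtain ⟨r, hr, hru⟩ := Metric.uniformContinuous_iff.1 hu δ hδ
    filter_upwards [Metric.ball_mem_nhds x hr] with x' hx'
    by_cases hxx : x' = x
    · simp [hxx]
    have hv : x' - x ≠ 0 := sub_ne_zero.2 hxx
    have h1 := mo_sub φ hΩ x (x' - x)
    rw [add_sub_cancel] at h1
    have h2 := h1.trans (gg Ω (x' - x) hv (fun z => ρ (x - z)) (by fun_prop) (fun z => φ.nonneg_normed _) δ hδ.le (by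
      intro y w hw
      have hw' : ‖w‖ < r := lt_of_le_of_lt hw (by rwa [Metric.mem_ball, dist_eq_norm] at hx')
      have := hru (a := x - (y + w)) (b := x - y) (by rw [dist_eq_norm]; simpa using hw')
      rw [Real.dist_eq] at this
      linarith [(abs_lt.1 this).2]))
    have h3 := ENNReal.toReal_mono (ENNReal.mul_ne_top ENNReal.ofReal_ne_top hC) h2
    rw [ENNReal.toReal_mul, ENNReal.toReal_ofReal (norm_nonneg _), toReal_enorm] at h3
    linarith
  have hlim : Tendsto (fun δ : ℝ => (∫⁻ y in frontier Ω, ENNReal.ofReal (ρ (x - y)) ∂(μHE[n])) + ENNReal.ofReal δ * μHE[n] (frontier Ω))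
      (nhdsWithin 0 (Ioi 0)) (nhds ((∫⁻ y in frontier Ω, ENNReal.ofReal (ρ (x - y)) ∂(μHE[n])) + ENNReal.ofReal 0 * μHE[n] (frontier Ω))) := by
    apply tendsto_const_nhds.add
    apply ENNReal.Tendsto.mul_const _ (Or.inr hfin)
    apply ENNReal.tendsto_ofReal
    exact tendsto_id.mono_left nhdsWithin_le_nhds
  rw [ENNReal.ofReal_zero, zero_mul, add_zero] at hlim
  apply ge_of_tendsto hlim
  filter_upwards [self_mem_nhdsWithin] with η hη using key η hη

lemma conv_le {n : ℕ} (φ : ContDiffBump (0 : Sp n)) (G : Sp n → ℝ) (δ : ℝ)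
    (hm : ∀ y w, ‖w‖ ≤ φ.rOut → G (y + w) ≤ G y + δ) (y : Sp n) :
    ∫⁻ x, ENNReal.ofReal (G x) * ENNReal.ofReal (φ.normed volume (x - y)) ≤ ENNReal.ofReal (G y + δ) := by
  have h1 : ∫⁻ x, ENNReal.ofReal (φ.normed (volume : Measure (Sp n)) (x - y)) = 1 := by
    rw [← ofReal_integral_eq_lintegral_ofReal ((φ.integrable_normed).comp_sub_right y) (Eventually.of_forall fun x => φ.nonneg_normed _),
      integral_sub_right_eq_self, φ.integral_normed, ENNReal.ofReal_one]
  calc _ ≤ ∫⁻ x, ENNReal.ofReal (G y + δ) * ENNReal.ofReal (φ.normed (volume : Measure (Sp n)) (x - y)) := by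
        refine lintegral_mono fun x => ?_
        by_cases hx : ‖x - y‖ ≤ φ.rOut
        · have := hm y (x - y) hx
          rw [add_sub_cancel] at this
          dsimp only
          gcongr
        · have : φ.normed (volume : Measure (Sp n)) (x - y) = 0 := by
            rw [← Function.notMem_support, φ.support_normed_eq, Metric.mem_ball, dist_zero_right]
            exact fun h => hx h.le
          simp [this]
    _ = _ := by rw [lintegral_const_mul' _ _ ENNReal.ofReal_ne_top, h1, mul_one]

lemma conv_le2 {n : ℕ} (φ : ContDiffBump (0 : Sp n)) (G : Sp n → ℝ) (hG : Continuous G) (δ : ℝ)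
    (hm : ∀ y w, ‖w‖ ≤ φ.rOut → G (y + w) ≤ G y + δ) (μ : Measure (Sp n)) [SFinite μ] :
    ∫⁻ x, ENNReal.ofReal (G x) * ∫⁻ y, ENNReal.ofReal (φ.normed volume (x - y)) ∂μ ≤ ∫⁻ y, ENNReal.ofReal (G y + δ) ∂μ := by
  have hρ : Continuous (φ.normed (volume : Measure (Sp n))) := φ.continuous_normed
  simp_rw [← lintegral_const_mul' _ _ (ENNReal.ofReal_ne_top (r := G _))]
  rw [lintegral_lintegral_swap]
  · exact lintegral_mono fun y => conv_le φ G δ hm y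
  · apply Measurable.aemeasurable
    have : Continuous (Function.uncurry fun (x y : Sp n) => (φ.normed (volume : Measure (Sp n)) (x - y))) := by fun_prop
    exact ((hG.comp continuous_fst).measurable.ennreal_ofReal).mul this.measurable.ennreal_ofReal

lemma modulus {n : ℕ} (G : Sp n → ℝ) (hG : Continuous G) (hs : HasCompactSupport G) (δ : ℝ) (hδ : 0 < δ) :
    ∃ r > 0, ∀ y w, ‖w‖ ≤ r → G (y + w) ≤ G y + δ := by
  obtain ⟨r, hr, h⟩ := Metric.uniformContinuous_iff.1 (hs.uniformContinuous_of_continuous hG) δ hδ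
  refine ⟨r / 2, by positivity, fun y w hw => ?_⟩
  have := h (a := y + w) (b := y) (by rw [dist_eq_norm, add_sub_cancel_left]; linarith)
  rw [Real.dist_eq] at this
  linarith [(abs_lt.1 this).2]

lemma approx {n : ℕ} {Ω : Set (Sp n)} (hΩ : MeasurableSet Ω) (hfin : μHE[n] (frontier Ω) ≠ ⊤)
    (F χ : Sp n → ℝ) (hF : Continuous F) (F0 : ∀ x, 0 ≤ F x) (hχ : ContDiff ℝ 1 χ) (hs : HasCompactSupport χ)
    (χ0 : ∀ x, 0 ≤ χ x) (δ ε : ℝ) (hδ : 0 < δ) (hε : 0 < ε) :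
    ∃ h : Sp n → ℝ, ContDiff ℝ 1 h ∧ HasCompactSupport h ∧ (∀ x, 0 ≤ h x) ∧
      (∀ x, Metric.ball x ε ⊆ Ω → h x = χ x) ∧
      ∫⁻ x, ENNReal.ofReal (F x * ‖fderiv ℝ h x‖) ≤ (∫⁻ y in frontier Ω, ENNReal.ofReal (F y * χ y + δ) ∂(μHE[n])) +
        ∫⁻ y in Ω, ENNReal.ofReal (F y * ‖fderiv ℝ χ y‖ + δ) := by
  have hdc : Continuous (fderiv ℝ χ) := hχ.continuous_fderiv (by norm_num)
  obtain ⟨r1, hr1, h1⟩ := modulus (fun x => F x * χ x) (by have := hχ.continuous; fun_prop) hs.mul_left δ hδ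
  obtain ⟨r2, hr2, h2⟩ := modulus (fun x => F x * ‖fderiv ℝ χ x‖) (by fun_prop) (hs.fderiv ℝ).norm.mul_left δ hδ
  set r := min ε (min r1 r2)
  have hr : 0 < r := lt_min hε (lt_min hr1 hr2)
  let φ : ContDiffBump (0 : Sp n) := ⟨r / 2, r, by positivity, by linarith⟩
  have hφ : φ.rOut = r := rfl
  have hmc := mo_contDiff φ hΩ
  have := Fact.mk hfin.lt_top
  have hsf : IsFiniteMeasure ((μHE[n] : Measure (Sp n)).restrict (frontier Ω)) := inferInstance
  refine ⟨fun x => mo φ Ω x * χ x, hmc.mul hχ, hs.mul_left, fun x => mul_nonneg (mo_nonneg _ _ _) (χ0 x), ?_, ?_⟩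
  · intro x hx
    simp only
    rw [mo_one, one_mul]
    exact (Metric.ball_subset_ball (by rw [hφ]; exact min_le_left _ _)).trans hx
  · have hb : ∀ x, ENNReal.ofReal (F x * ‖fderiv ℝ (fun x => mo φ Ω x * χ x) x‖) ≤
        ENNReal.ofReal (F x * χ x) * (∫⁻ y in frontier Ω, ENNReal.ofReal (φ.normed volume (x - y)) ∂(μHE[n])) +
        ENNReal.ofReal (F x * ‖fderiv ℝ χ x‖) * ∫⁻ y in Ω, ENNReal.ofReal (φ.normed volume (x - y)) := by
      intro x
      rw [fderiv_fun_mul (hmc.differentiable (by norm_num) x) (hχ.differentiable (by norm_num) x)]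
      have hn : ‖mo φ Ω x • fderiv ℝ χ x + χ x • fderiv ℝ (mo φ Ω) x‖ ≤ mo φ Ω x * ‖fderiv ℝ χ x‖ + χ x * ‖fderiv ℝ (mo φ Ω) x‖ := by
        refine (norm_add_le _ _).trans ?_
        rw [norm_smul, norm_smul, Real.norm_of_nonneg (mo_nonneg _ _ _), Real.norm_of_nonneg (χ0 x)]
      rw [← mo_lint φ hΩ]
      calc _ ≤ ENNReal.ofReal ((F x * χ x) * ‖fderiv ℝ (mo φ Ω) x‖ + F x * ‖fderiv ℝ χ x‖ * mo φ Ω x) := by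
            apply ENNReal.ofReal_le_ofReal
            have := mul_le_mul_of_nonneg_left hn (F0 x)
            linarith
        _ = ENNReal.ofReal (F x * χ x) * ENNReal.ofReal ‖fderiv ℝ (mo φ Ω) x‖ + ENNReal.ofReal (F x * ‖fderiv ℝ χ x‖) * ENNReal.ofReal (mo φ Ω x) := by
            have a1 := F0 x
            have a2 := χ0 x
            have a3 := mo_nonneg φ Ω x
            rw [ENNReal.ofReal_add (by positivity) (by positivity), ENNReal.ofReal_mul (by positivity), ENNReal.ofReal_mul (p := F x * ‖fderiv ℝ χ x‖) (by positivity)]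
        _ ≤ _ := by gcongr; exact mo_grad φ hΩ hfin x
    refine (lintegral_mono hb).trans ?_
    have hρ : Continuous (φ.normed (volume : Measure (Sp n))) := φ.continuous_normed
    rw [lintegral_add_right]
    · refine add_le_add ?_ ?_
      · exact conv_le2 φ (fun x => F x * χ x) (by have := hχ.continuous; fun_prop) δ
          (fun y w hw => h1 y w (hw.trans ((min_le_right _ _).trans (min_le_left _ _)))) _
      · exact conv_le2 φ (fun x => F x * ‖fderiv ℝ χ x‖) (by fun_prop) δ
          (fun y w hw => h2 y w (hw.trans ((min_le_right _ _).trans (min_le_right _ _)))) _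
    · simp_rw [← mo_lint φ hΩ]
      have := hmc.continuous
      have m1 : Continuous fun x => F x * ‖fderiv ℝ χ x‖ := by fun_prop
      exact m1.measurable.ennreal_ofReal.mul this.measurable.ennreal_ofReal

end BQ

namespace BQ
open Real
open scoped MeasureTheory

lemma tend_set {n : ℕ} (A : ℕ → Set (Sp n)) (hA : Monotone A) (g : Sp n → ENNReal) :
    Tendsto (fun m => ∫⁻ x in A m, g x) atTop (nhds (∫⁻ x in ⋃ m, A m, g x)) := by
  rw [setLIntegral_iUnion_of_directed g hA.directed_le]
  exact tendsto_atTop_iSup fun i j h => lintegral_mono_set (hA h)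

noncomputable def Am {n : ℕ} (Ω : Set (Sp n)) (m : ℕ) : Set (Sp n) :=
  (Metric.thickening (1 / ((m : ℝ) + 1)) Ωᶜ)ᶜ ∩ Metric.closedBall 0 ((m : ℝ) + 1)

lemma Am_mono {n : ℕ} (Ω : Set (Sp n)) : Monotone (Am Ω) := by
  intro i j h
  have h' : (i : ℝ) ≤ j := by exact_mod_cast h
  apply inter_subset_inter
  · exact compl_subset_compl.2 (Metric.thickening_mono (by gcongr) _)
  · exact Metric.closedBall_subset_closedBall (by linarith)

lemma Am_meas {n : ℕ} (Ω : Set (Sp n)) (m : ℕ) : MeasurableSet (Am Ω m) :=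
  (Metric.isOpen_thickening.measurableSet.compl).inter Metric.isClosed_closedBall.measurableSet

lemma Am_ball {n : ℕ} (Ω : Set (Sp n)) (m : ℕ) (x : Sp n) (hx : x ∈ Am Ω m) : Metric.ball x (1 / ((m : ℝ) + 1)) ⊆ Ω := by
  intro y hy
  by_contra h
  exact hx.1 (Metric.mem_thickening_iff.2 ⟨y, h, by rw [dist_comm]; exact hy⟩)

lemma Am_union {n : ℕ} (Ω : Set (Sp n)) (hΩ : IsOpen Ω) : ⋃ m, Am Ω m = Ω := by
  ext x
  rw [mem_iUnion]
  constructor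
  · rintro ⟨m, hm⟩
    exact Am_ball Ω m x hm (Metric.mem_ball_self (by positivity))
  · intro hx
    obtain ⟨ε, hε, hb⟩ := Metric.isOpen_iff.1 hΩ x hx
    obtain ⟨m, hm⟩ := exists_nat_gt (max (1 / ε) ‖x‖)
    have h1 : 1 / ε < m := lt_of_le_of_lt (le_max_left _ _) hm
    have h2 : ‖x‖ < m := lt_of_le_of_lt (le_max_right _ _) hm
    refine ⟨m, ?_, ?_⟩
    · intro h
      obtain ⟨y, hy, hd⟩ := Metric.mem_thickening_iff.1 h
      apply hy
      apply hb
      rw [Metric.mem_ball, dist_comm]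
      refine hd.trans ?_
      rw [div_lt_iff₀ hε] at h1
      rw [div_lt_iff₀ (by positivity)]
      nlinarith
    · simp; linarith

lemma cutoff (n : ℕ) : ∃ C : ℝ, 0 ≤ C ∧ ∀ m : ℕ, ∃ χ : Sp n → ℝ, ContDiff ℝ 1 χ ∧ HasCompactSupport χ ∧ (∀ x, 0 ≤ χ x) ∧
    (∀ x, χ x ≤ 1) ∧ (∀ x ∈ Metric.closedBall (0 : Sp n) ((m : ℝ) + 1), χ x = 1) ∧ ∀ x, ‖fderiv ℝ χ x‖ ≤ C / ((m : ℝ) + 1) := by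
  let φ : ContDiffBump (0 : Sp n) := ⟨1, 2, by norm_num, by norm_num⟩
  obtain ⟨C, hC⟩ := ContDiff.lipschitzWith_of_hasCompactSupport φ.hasCompactSupport (φ.contDiff (n := 1)) (by norm_num)
  refine ⟨C, C.2, fun m => ⟨fun x => φ (((m : ℝ) + 1)⁻¹ • x), ?_, ?_, fun x => φ.nonneg, fun x => φ.le_one, ?_, ?_⟩⟩
  · exact (φ.contDiff (n := 1)).comp (contDiff_const_smul _)
  · exact φ.hasCompactSupport.comp_smul (by positivity)
  · intro x hx
    apply φ.one_of_mem_closedBall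
    rw [mem_closedBall_zero_iff] at hx ⊢
    rw [norm_smul, norm_inv, Real.norm_of_nonneg (by positivity), inv_mul_le_iff₀ (by positivity)]
    simpa [φ] using hx
  · intro x
    apply norm_fderiv_le_of_lip' ℝ (by have := C.2; positivity)
    refine Eventually.of_forall fun y => ?_
    have := hC.norm_sub_le (((m : ℝ) + 1)⁻¹ • y) (((m : ℝ) + 1)⁻¹ • x)
    rw [← smul_sub, norm_smul, norm_inv, Real.norm_of_nonneg (by positivity : (0:ℝ) ≤ (m : ℝ) + 1)] at this
    rw [div_mul_eq_mul_div, mul_div_assoc]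
    convert this using 2
    field_simp

lemma main_step {n : ℕ} (hn : 1 ≤ n) {k R : ℝ} (hk : 0 < k) (hR : 0 < R) {Ω : Set (Sp n)} (hΩ : IsOpen Ω)
    (hfin : μHE[n] (frontier Ω) ≠ ⊤) :
    ∃ C : ℝ, 0 ≤ C ∧ ∀ m : ℕ, ENNReal.ofReal (isoC n) * (Jm n k R (Am Ω m)) ^ ((n : ℝ) / (n + 1)) +
      (∫⁻ x in Am Ω m, ENNReal.ofReal (qf n k R ‖x‖)) ≤
      ((∫⁻ x in frontier Ω, ENNReal.ofReal (exp ((n + 4) * (k * ‖x‖ ^ 2))) ∂(μHE[n])) +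
        ENNReal.ofReal (1 / ((m : ℝ) + 1)) * μHE[n] (frontier Ω)) +
        ENNReal.ofReal ((C + 1) / ((m : ℝ) + 1)) * ∫⁻ x in Ω, ENNReal.ofReal (exp ((n + 4) * (k * ‖x‖ ^ 2))) := by
  obtain ⟨C, hC, H⟩ := cutoff n
  refine ⟨C, hC, fun m => ?_⟩
  obtain ⟨χ, c1, c2, c3, c4, c5, c6⟩ := H m
  have hm : (0 : ℝ) < (m : ℝ) + 1 := by positivity
  obtain ⟨h, h1, h2, h3, h4, h5⟩ := approx hΩ.measurableSet hfin (fun x => exp ((n + 4) * (k * ‖x‖ ^ 2))) χ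
    (by fun_prop) (fun x => (exp_pos _).le) c1 c2 c3 (1 / ((m : ℝ) + 1)) (1 / ((m : ℝ) + 1)) (by positivity) (by positivity)
  have hA : ∀ x ∈ Am Ω m, h x = 1 := fun x hx => by
    rw [h4 x (Am_ball Ω m x hx), c5 x hx.2]
  have hst := star hn hk hR h h1 h2 h3
  have l1 : ENNReal.ofReal (isoC n) * (Jm n k R (Am Ω m)) ^ ((n : ℝ) / (n + 1)) ≤
      ∫⁻ t in Ioi (0:ℝ), ENNReal.ofReal (isoC n) * (Jm n k R {x | t < h x}) ^ ((n:ℝ) / (n + 1)) := by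
    calc _ = ∫⁻ t in Ioo (0:ℝ) 1, ENNReal.ofReal (isoC n) * (Jm n k R (Am Ω m)) ^ ((n : ℝ) / (n + 1)) := by simp
      _ ≤ ∫⁻ t in Ioo (0:ℝ) 1, ENNReal.ofReal (isoC n) * (Jm n k R {x | t < h x}) ^ ((n:ℝ) / (n + 1)) := by
          apply setLIntegral_mono' measurableSet_Ioo
          intro t ht
          gcongr
          apply lintegral_mono_set
          intro x hx
          simp only [Set.mem_ofPred_eq]
          rw [hA x hx]; exact ht.2
      _ ≤ _ := lintegral_mono_set fun t ht => ht.1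
  have l2 : (∫⁻ x in Am Ω m, ENNReal.ofReal (qf n k R ‖x‖)) ≤ ∫⁻ x, ENNReal.ofReal (h x * qf n k R ‖x‖) := by
    calc _ = ∫⁻ x in Am Ω m, ENNReal.ofReal (h x * qf n k R ‖x‖) := by
          apply setLIntegral_congr_fun (Am_meas Ω m)
          intro x hx
          simp only
          rw [hA x hx, one_mul]
      _ ≤ _ := setLIntegral_le_lintegral _ _
  refine (add_le_add l1 l2).trans (hst.trans (h5.trans (add_le_add ?_ ?_)))
  · calc _ ≤ ∫⁻ x in frontier Ω, (ENNReal.ofReal (exp ((n + 4) * (k * ‖x‖ ^ 2))) + ENNReal.ofReal (1 / ((m : ℝ) + 1))) ∂(μHE[n]) := by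
          refine lintegral_mono fun x => ?_
          dsimp only
          rw [← ENNReal.ofReal_add (exp_pos _).le (by positivity)]
          apply ENNReal.ofReal_le_ofReal
          have := mul_le_mul_of_nonneg_left (c4 x) (exp_pos ((n + 4) * (k * ‖x‖ ^ 2))).le
          linarith
      _ = _ := by
          rw [lintegral_add_right _ measurable_const, setLIntegral_const]
  · rw [← lintegral_const_mul' _ _ ENNReal.ofReal_ne_top]
    refine lintegral_mono fun x => ?_
    dsimp only
    rw [← ENNReal.ofReal_mul (by positivity)]
    apply ENNReal.ofReal_le_ofReal
    have e1 : 1 ≤ exp ((n + 4) * (k * ‖x‖ ^ 2)) := one_le_exp (by positivity)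
    have := mul_le_mul_of_nonneg_left (c6 x) (exp_pos ((n + 4) * (k * ‖x‖ ^ 2))).le
    rw [add_div]
    generalize exp ((n + 4) * (k * ‖x‖ ^ 2)) = E at *
    have h6 : 1 / ((m:ℝ) + 1) * 1 ≤ 1 / ((m:ℝ) + 1) * E := by gcongr
    linarith

lemma main_lim {n : ℕ} (hn : 1 ≤ n) {k R : ℝ} (hk : 0 < k) (hR : 0 < R) {Ω : Set (Sp n)} (hΩ : IsOpen Ω)
    (hW : ∫⁻ x in Ω, ENNReal.ofReal (exp ((n + 4) * (k * ‖x‖ ^ 2))) ≠ ⊤) (hfin : μHE[n] (frontier Ω) ≠ ⊤) :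
    ENNReal.ofReal (isoC n) * (Jm n k R Ω) ^ ((n : ℝ) / (n + 1)) +
      (∫⁻ x in Ω, ENNReal.ofReal (qf n k R ‖x‖)) ≤
      ∫⁻ x in frontier Ω, ENNReal.ofReal (exp ((n + 4) * (k * ‖x‖ ^ 2))) ∂(μHE[n]) := by
  obtain ⟨C, hC, H⟩ := main_step hn hk hR hΩ hfin
  have t0 : ∀ a : ℝ, Tendsto (fun m : ℕ => ENNReal.ofReal (a / ((m : ℝ) + 1))) atTop (nhds 0) := by
    intro a
    rw [← ENNReal.ofReal_zero]
    apply ENNReal.tendsto_ofReal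
    exact (tendsto_const_nhds (x := a)).div_atTop (tendsto_atTop_add_const_right _ _ tendsto_natCast_atTop_atTop)
  have tR : Tendsto (fun m : ℕ => ((∫⁻ x in frontier Ω, ENNReal.ofReal (exp ((n + 4) * (k * ‖x‖ ^ 2))) ∂(μHE[n])) +
        ENNReal.ofReal (1 / ((m : ℝ) + 1)) * μHE[n] (frontier Ω)) +
        ENNReal.ofReal ((C + 1) / ((m : ℝ) + 1)) * ∫⁻ x in Ω, ENNReal.ofReal (exp ((n + 4) * (k * ‖x‖ ^ 2)))) atTop
      (nhds (((∫⁻ x in frontier Ω, ENNReal.ofReal (exp ((n + 4) * (k * ‖x‖ ^ 2))) ∂(μHE[n])) +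
        0 * μHE[n] (frontier Ω)) + 0 * ∫⁻ x in Ω, ENNReal.ofReal (exp ((n + 4) * (k * ‖x‖ ^ 2))))) :=
    (tendsto_const_nhds.add (ENNReal.Tendsto.mul_const (t0 1) (Or.inr hfin))).add
      (ENNReal.Tendsto.mul_const (t0 (C + 1)) (Or.inr hW))
  have tJ := tend_set (Am Ω) (Am_mono Ω) (fun x => ENNReal.ofReal (Jf n k R ‖x‖))
  have tq := tend_set (Am Ω) (Am_mono Ω) (fun x => ENNReal.ofReal (qf n k R ‖x‖))
  rw [Am_union Ω hΩ] at tJ tq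
  have tL := (ENNReal.Tendsto.const_mul ((ENNReal.continuous_rpow_const (y := (n : ℝ) / (n + 1))).continuousAt.tendsto.comp tJ)
    (Or.inr (ENNReal.ofReal_ne_top (r := isoC n)))).add tq
  have := le_of_tendsto_of_tendsto' tL tR H
  simpa [Jm] using this

end BQ

namespace BQ
open Real
open scoped MeasureTheory

noncomputable def bet (n : ℕ) : ℝ := √π ^ n / Gamma (n / 2 + 1)

lemma bet_pos (n : ℕ) : 0 < bet n := by
  have := Real.Gamma_pos_of_pos (show (0:ℝ) < (n:ℝ) / 2 + 1 by positivity)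
  unfold bet; positivity

lemma vol_disc {n : ℕ} (hn : 1 ≤ n) (p : Sp n) (hp : ‖p‖ = 1) (r : ℝ) (hr : 0 ≤ r) :
    volume (Metric.ball (0 : (ℝ ∙ p)ᗮ) r) = ENNReal.ofReal (r ^ n * bet n) := by
  have hf := finrank_perp p hp
  have : Nontrivial (ℝ ∙ p)ᗮ := Module.nontrivial_of_finrank_pos (R := ℝ) (by omega)
  rw [InnerProductSpace.volume_ball, hf, ENNReal.ofReal_mul (by positivity), ENNReal.ofReal_pow hr]
  rfl

lemma sq_lip {a b r : ℝ} (ha : 0 ≤ a) (hb : 0 ≤ b) (har : a < r) (hbr : b < r) (hr : r < 1) :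
    (√(1 - a ^ 2) - √(1 - b ^ 2)) ^ 2 * (1 - r ^ 2) ≤ r ^ 2 * (a - b) ^ 2 := by
  have hr0 : 0 < r := lt_of_le_of_lt ha har
  have hs : 0 ≤ 1 - r ^ 2 := by nlinarith
  have h1 : 1 - r ^ 2 ≤ 1 - a ^ 2 := by nlinarith
  have h2 : 1 - r ^ 2 ≤ 1 - b ^ 2 := by nlinarith
  have eA := sq_sqrt (hs.trans h1)
  have eB := sq_sqrt (hs.trans h2)
  have es := sq_sqrt hs
  have hA := sqrt_le_sqrt h1
  have hB := sqrt_le_sqrt h2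
  have s0 := sqrt_nonneg (1 - r ^ 2)
  generalize √(1 - a ^ 2) = A at *
  generalize √(1 - b ^ 2) = B at *
  generalize √(1 - r ^ 2) = s at *
  have e : (A - B) ^ 2 * (A + B) ^ 2 = (a - b) ^ 2 * (a + b) ^ 2 := by
    have : (A - B) * (A + B) = (b - a) * (a + b) := by linear_combination eA - eB
    rw [← mul_pow, this]; ring
  have g1 : 4 * (1 - r ^ 2) ≤ (A + B) ^ 2 := by rw [← es]; nlinarith
  have g2 : (a + b) ^ 2 ≤ 4 * r ^ 2 := by nlinarith
  have := mul_le_mul_of_nonneg_left g1 (sq_nonneg (A - B))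
  have := mul_le_mul_of_nonneg_left g2 (sq_nonneg (a - b))
  nlinarith

lemma inner_perp {n : ℕ} (p : Sp n) (w : (ℝ ∙ p)ᗮ) : inner ℝ p (w : Sp n) = 0 :=
  Submodule.mem_orthogonal_singleton_iff_inner_right.1 w.2

lemma nsq {n : ℕ} (p : Sp n) (hp : ‖p‖ = 1) (w : (ℝ ∙ p)ᗮ) (s : ℝ) : ‖(w : Sp n) + s • p‖ ^ 2 = ‖w‖ ^ 2 + s ^ 2 := by
  rw [norm_add_sq_real, inner_smul_right, real_inner_comm, inner_perp, norm_smul, hp]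
  simp

lemma cap {n : ℕ} (hn : 1 ≤ n) (p : Sp n) (hp : ‖p‖ = 1) (r : ℝ) (hr : 0 < r) (hr1 : r < 1) :
    μHE[n] (Metric.sphere (0 : Sp n) 1 ∩ Metric.ball p r) ≤ ENNReal.ofReal ((1 / √(1 - r ^ 2)) ^ n * (r ^ n * bet n)) := by
  set Γ : (ℝ ∙ p)ᗮ → Sp n := fun w => (w : Sp n) + √(1 - ‖w‖ ^ 2) • p
  have hs : 0 < 1 - r ^ 2 := by nlinarith
  have hL : LipschitzOnWith (1 / √(1 - r ^ 2)).toNNReal Γ (Metric.ball 0 r) := by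
    apply LipschitzOnWith.of_dist_le_mul
    intro w hw w' hw'
    rw [mem_ball_zero_iff] at hw hw'
    rw [coe_toNNReal _ (by positivity), dist_eq_norm, dist_eq_norm]
    have e : Γ w - Γ w' = ((w - w' : (ℝ ∙ p)ᗮ) : Sp n) + (√(1 - ‖w‖ ^ 2) - √(1 - ‖w'‖ ^ 2)) • p := by
      simp only [Γ, Submodule.coe_sub, sub_smul]; abel
    rw [← sq_le_sq₀ (norm_nonneg _) (by positivity), e, nsq p hp, mul_pow, div_pow, sq_sqrt hs.le, one_pow,
      div_mul_eq_mul_div, one_mul, le_div_iff₀ hs]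
    have h1 := sq_lip (norm_nonneg w) (norm_nonneg w') hw hw' hr1
    have h2 : (‖w‖ - ‖w'‖) ^ 2 ≤ ‖w - w'‖ ^ 2 := by
      rw [sq_le_sq, abs_of_nonneg (norm_nonneg (w - w'))]; exact abs_norm_sub_norm_le w w'
    nlinarith [mul_le_mul_of_nonneg_left h2 (sq_nonneg r)]
  have hsub : Metric.sphere (0 : Sp n) 1 ∩ Metric.ball p r ⊆ Γ '' (Metric.ball 0 r) := by
    rintro x ⟨hx1, hx2⟩
    rw [mem_sphere_zero_iff_norm] at hx1
    rw [Metric.mem_ball, dist_eq_norm] at hx2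
    set w := (ℝ ∙ p)ᗮ.orthogonalProjectionOnto x
    have hdec : x = (w : Sp n) + (inner ℝ p x) • p := by
      have := Submodule.starProjection_add_starProjection_orthogonal (K := ℝ ∙ p) x
      rw [Submodule.starProjection_unit_singleton ℝ hp] at this
      have e2 := Submodule.starProjection_apply (ℝ ∙ p)ᗮ x
      rw [e2, add_comm] at this
      exact this.symm
    have n1 : ‖w‖ ^ 2 + (inner ℝ p x) ^ 2 = 1 := by
      rw [← nsq p hp, ← hdec, hx1, one_pow]
    have n2 : ‖x - p‖ ^ 2 = 2 - 2 * inner ℝ p x := by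
      rw [norm_sub_sq_real, hx1, hp, real_inner_comm]; ring
    have n3 : ‖x - p‖ ^ 2 < r ^ 2 := by
      have := norm_nonneg (x - p); nlinarith
    have ip : 0 ≤ inner ℝ p x := by nlinarith
    refine ⟨w, ?_, ?_⟩
    · rw [mem_ball_zero_iff]
      apply lt_of_pow_lt_pow_left₀ 2 hr.le
      nlinarith [sq_nonneg (1 - inner ℝ p x)]
    · simp only [Γ]
      have : √(1 - ‖w‖ ^ 2) = inner ℝ p x := by
        rw [show 1 - ‖w‖ ^ 2 = (inner ℝ p x) ^ 2 by linarith, sqrt_sq ip]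
      rw [this, ← hdec]
  refine (measure_mono hsub).trans ?_
  have h1 : (volume : Measure (ℝ ∙ p)ᗮ) = μHE[n] := by
    rw [← InnerProductSpace.euclideanHausdorffMeasure_eq_volume, finrank_perp p hp]
  have h2 := hL.hausdorffMeasure_image_le (d := (n : ℝ)) (by positivity)
  rw [ENNReal.ofReal_mul (by positivity), ← vol_disc hn p hp r hr.le, h1]
  simp only [Measure.euclideanHausdorffMeasure_def, Measure.smul_apply]
  rw [ENNReal.smul_def, ENNReal.smul_def, smul_eq_mul, smul_eq_mul, mul_left_comm]
  gcongr
  refine h2.trans ?_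
  gcongr
  rw [ENNReal.rpow_natCast, ENNReal.ofReal_pow (by positivity)]
  rfl

lemma cone_real {r s m v τ : ℝ} (hr : 0 < r) (hr1 : r < 1) (hs0 : 0 < s) (hs1 : s < τ) (hτ : τ ^ 2 * (1 + r ^ 2) = 1)
    (hv0 : 0 ≤ v) (hv : v < r * s) (hm : 0 ≤ m) (N2 : m ^ 2 = v ^ 2 + s ^ 2) :
    m < 1 ∧ v ^ 2 + (s - m) ^ 2 < r ^ 2 * m ^ 2 := by
  have hv2 : v ^ 2 < (r * s) ^ 2 := pow_lt_pow_left₀ hv hv0 two_ne_zero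
  have hs2 : s ^ 2 < τ ^ 2 := pow_lt_pow_left₀ hs1 hs0.le two_ne_zero
  rw [mul_pow] at hv2
  have hms : m ^ 2 < s ^ 2 * (1 + r ^ 2) := by linarith
  have hr2 : r ^ 2 < 1 := by nlinarith
  have hm1 : m < 1 := by
    have : s ^ 2 * (1 + r ^ 2) < τ ^ 2 * (1 + r ^ 2) := by gcongr
    exact lt_of_pow_lt_pow_left₀ 2 zero_le_one (by linarith)
  have hmp : 0 < m := by
    apply lt_of_pow_lt_pow_left₀ 2 hm
    have : 0 < s ^ 2 := by positivity
    rw [N2]; nlinarith [sq_nonneg v]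
  refine ⟨hm1, ?_⟩
  have key : m * (1 - r ^ 2 / 2) < s := by
    apply lt_of_pow_lt_pow_left₀ 2 hs0.le
    rw [mul_pow]
    have r2 : 0 ≤ r ^ 2 := sq_nonneg r
    generalize r ^ 2 = a at *
    have c1 : (1 - a / 2) ^ 2 * (1 + a) ≤ 1 := by nlinarith [sq_nonneg a, mul_nonneg (sq_nonneg a) (sub_nonneg.2 hr2.le)]
    have c2 : 0 < (1 - a / 2) ^ 2 := by
      have : 0 < 1 - a / 2 := by linarith
      positivity
    have c3 := mul_lt_mul_of_pos_right hms c2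
    have c4 := mul_le_mul_of_nonneg_left c1 (sq_nonneg s)
    linarith
  have := mul_lt_mul_of_pos_left key hmp
  linarith

lemma cone_int {n : ℕ} {r τ : ℝ} (hr : 0 < r) (hτ : 0 < τ) :
    ∫⁻ s in Ioo 0 τ, ENNReal.ofReal ((r * s) ^ n * bet n) = ENNReal.ofReal (r ^ n * bet n * (τ ^ (n + 1) / (n + 1))) := by
  have hb := bet_pos n
  have hint : IntervalIntegrable (fun s : ℝ => (r * s) ^ n * bet n) volume 0 τ :=
    (by fun_prop : Continuous fun s : ℝ => (r * s) ^ n * bet n).intervalIntegrable _ _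
  have nn : 0 ≤ᵐ[volume.restrict (Ioc 0 τ)] fun s : ℝ => (r * s) ^ n * bet n := by
    filter_upwards [ae_restrict_mem measurableSet_Ioc] with s hs
    have := hs.1
    exact mul_nonneg (pow_nonneg (mul_nonneg hr.le this.le) _) hb.le
  rw [restrict_Ioo_eq_restrict_Ioc,
    ← ofReal_integral_eq_lintegral_ofReal ((intervalIntegrable_iff_integrableOn_Ioc_of_le hτ.le).1 hint) nn,
    ← intervalIntegral.integral_of_le hτ.le]
  congr 1
  simp_rw [mul_pow]
  rw [intervalIntegral.integral_mul_const, intervalIntegral.integral_const_mul, integral_pow, zero_pow (Nat.succ_ne_zero n), sub_zero]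
  ring

lemma cone_vol {n : ℕ} (hn : 1 ≤ n) (q : Sp n) (hq : ‖q‖ = 1) (r : ℝ) (hr : 0 < r) (hr1 : r < 1) :
    ENNReal.ofReal (r ^ n * bet n * ((1 / √(1 + r ^ 2)) ^ (n + 1) / (n + 1))) ≤
    volume {y : Sp n | ‖y‖ < 1 ∧ ‖y - ‖y‖ • q‖ < r * ‖y‖} := by
  set τ := 1 / √(1 + r ^ 2)
  have hτ : 0 < τ := by positivity
  have hτ2 : τ ^ 2 * (1 + r ^ 2) = 1 := by
    rw [div_pow, sq_sqrt (by positivity)]; field_simp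
  set e := (ℝ ∙ q).measurableEquivProd (0 : Sp n)
  have me : MeasurePreserving e volume (volume.prod volume) := by
    have := (ℝ ∙ q).measurePreserving_measurableEquivProd (0 : Sp n)
    rwa [InnerProductSpace.euclideanHausdorffMeasure_eq_volume] at this
  set u := LinearIsometryEquiv.toSpanUnitSingleton (𝕜 := ℝ) q hq
  set T : Set ((ℝ ∙ q) × (ℝ ∙ q)ᗮ) := {z | u.symm z.1 ∈ Ioo 0 τ ∧ ‖z.2‖ < r * u.symm z.1}
  have hTm : MeasurableSet T := by
    have hu : Continuous fun z : (ℝ ∙ q) × (ℝ ∙ q)ᗮ => u.symm z.1 := u.symm.continuous.comp continuous_fst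
    exact (measurableSet_Ioo.preimage hu.measurable).inter
      (isOpen_lt (continuous_snd.norm) (continuous_const.mul hu)).measurableSet
  have hsub : e ⁻¹' T ⊆ {y : Sp n | ‖y‖ < 1 ∧ ‖y - ‖y‖ • q‖ < r * ‖y‖} := by
    intro y hy
    obtain ⟨z, rfl⟩ := e.symm.surjective y
    rw [mem_preimage, e.apply_symm_apply] at hy
    obtain ⟨⟨hs0, hs1⟩, hv⟩ := hy
    obtain ⟨a, v⟩ := z
    simp only at hs0 hs1 hv
    set s := u.symm a
    have ha : (a : Sp n) = s • q := by
      have : u s = a := u.apply_symm_apply a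
      rw [← this]; rfl
    have he : e.symm (a, v) = (v : Sp n) + s • q := by
      simp only [e, Submodule.measurableEquivProd_symm_apply]
      rw [ha]; simp [add_comm]
    rw [he]
    simp only [Set.mem_ofPred_eq]
    have N2 := nsq q hq v s
    set m := ‖(v : Sp n) + s • q‖
    obtain ⟨k1, k2⟩ := cone_real hr hr1 hs0 hs1 hτ2 (norm_nonneg v) hv (norm_nonneg _) N2
    refine ⟨k1, ?_⟩
    apply lt_of_pow_lt_pow_left₀ 2 (mul_nonneg hr.le (norm_nonneg _))
    have e3 : (v : Sp n) + s • q - m • q = (v : Sp n) + (s - m) • q := by rw [sub_smul]; abel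
    rw [e3, nsq q hq, mul_pow]
    exact k2
  refine le_trans ?_ (measure_mono hsub)
  rw [me.measure_preimage hTm.nullMeasurableSet, Measure.prod_apply hTm]
  have hsec : ∀ a : (ℝ ∙ q), volume (Prod.mk a ⁻¹' T) = (fun s : ℝ => (Ioo 0 τ).indicator (fun s => ENNReal.ofReal ((r * s) ^ n * bet n)) s) (u.symm a) := by
    intro a
    by_cases h : u.symm a ∈ Ioo 0 τ
    · simp only [indicator_of_mem h]
      rw [← vol_disc hn q hq _ (by have := h.1; positivity)]
      congr 1
      ext v
      simp only [T, mem_preimage, Set.mem_ofPred_eq, mem_ball_zero_iff]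
      exact ⟨fun h' => h'.2, fun h' => ⟨h, h'⟩⟩
    · simp only [indicator_of_notMem h]
      have : Prod.mk a ⁻¹' T = ∅ := by
        ext v
        simp only [T, mem_preimage, Set.mem_ofPred_eq, mem_empty_iff_false, iff_false]
        exact fun h' => h h'.1
      rw [this, measure_empty]
  rw [lintegral_congr hsec, (u.symm.measurePreserving).lintegral_comp
    ((by fun_prop : Measurable fun s : ℝ => ENNReal.ofReal ((r * s) ^ n * bet n)).indicator measurableSet_Ioo),
    lintegral_indicator measurableSet_Ioo, cone_int hr hτ]

end BQ

namespace BQ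
open Real
open scoped MeasureTheory

lemma sphere_fin {n : ℕ} (hn : 1 ≤ n) : μHE[n] (Metric.sphere (0 : Sp n) 1) < ⊤ := by
  apply (isCompact_sphere (0 : Sp n) 1).measure_lt_top_of_nhdsWithin
  intro p hp
  rw [mem_sphere_zero_iff_norm] at hp
  refine ⟨_, inter_mem_nhdsWithin _ (Metric.ball_mem_nhds p (by norm_num : (0:ℝ) < 1 / 2)), ?_⟩
  exact lt_of_le_of_lt (cap hn p hp (1 / 2) (by norm_num) (by norm_num)) ENNReal.ofReal_lt_top

lemma sphere_avg {n : ℕ} (hn : 1 ≤ n) (r : ℝ) (hr : 0 < r) (hr1 : r < 1) :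
    ENNReal.ofReal (r ^ n * bet n * ((1 / √(1 + r ^ 2)) ^ (n + 1) / (n + 1))) * μHE[n] (Metric.sphere (0 : Sp n) 1) ≤
      ENNReal.ofReal ((1 / √(1 - r ^ 2)) ^ n * (r ^ n * bet n)) * ENNReal.ofReal (om n) := by
  set S := Metric.sphere (0 : Sp n) 1
  have := Fact.mk (sphere_fin hn)
  set μ := (μHE[n] : Measure (Sp n)).restrict S
  have hfin : IsFiniteMeasure μ := inferInstance
  set U : Set (Sp n × Sp n) := {z | ‖z.1‖ < 1 ∧ ‖z.1 - ‖z.1‖ • z.2‖ < r * ‖z.1‖}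
  have o1 : IsOpen {z : Sp n × Sp n | ‖z.1‖ < 1} := isOpen_lt (by fun_prop) (by fun_prop)
  have o2 : IsOpen {z : Sp n × Sp n | ‖z.1 - ‖z.1‖ • z.2‖ < r * ‖z.1‖} := isOpen_lt (by fun_prop) (by fun_prop)
  have hU : MeasurableSet U := (o1.inter o2).measurableSet
  have e1 := Measure.prod_apply (μ := (volume : Measure (Sp n))) (ν := μ) hU
  rw [Measure.prod_apply_symm hU] at e1
  have l : ENNReal.ofReal (r ^ n * bet n * ((1 / √(1 + r ^ 2)) ^ (n + 1) / (n + 1))) * μHE[n] S ≤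
      ∫⁻ q, volume ((fun y => (y, q)) ⁻¹' U) ∂μ := by
    rw [← setLIntegral_const]
    apply setLIntegral_mono' Metric.isClosed_sphere.measurableSet
    intro q hq
    exact cone_vol hn q (mem_sphere_zero_iff_norm.1 hq) r hr hr1
  have u : ∫⁻ y, μ (Prod.mk y ⁻¹' U) ≤ ENNReal.ofReal ((1 / √(1 - r ^ 2)) ^ n * (r ^ n * bet n)) * ENNReal.ofReal (om n) := by
    have hv : ENNReal.ofReal (om n) = volume (Metric.ball (0 : Sp n) 1) := by
      rw [vol_ball n 1 zero_le_one]; simp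
    rw [hv, ← setLIntegral_const, ← lintegral_indicator Metric.isOpen_ball.measurableSet]
    refine lintegral_mono fun y => ?_
    by_cases hy : y ∈ Metric.ball (0 : Sp n) 1
    · rw [indicator_of_mem hy, Measure.restrict_apply (measurable_prodMk_left hU)]
      by_cases hy0 : y = 0
      · have : Prod.mk y ⁻¹' U = ∅ := by
          ext q; simp [U, hy0]
        rw [this, empty_inter, measure_empty]; exact zero_le
      have hy' : 0 < ‖y‖ := norm_pos_iff.2 hy0
      have hp : ‖‖y‖⁻¹ • y‖ = 1 := by rw [norm_smul, norm_inv, norm_norm, inv_mul_cancel₀ hy'.ne']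
      refine le_trans (measure_mono ?_) (cap hn (‖y‖⁻¹ • y) hp r hr hr1)
      rintro q ⟨hq, hqS⟩
      refine ⟨hqS, ?_⟩
      have h2 : ‖y - ‖y‖ • q‖ < r * ‖y‖ := hq.2
      rw [Metric.mem_ball, dist_comm, dist_eq_norm]
      have : ‖y‖⁻¹ • y - q = ‖y‖⁻¹ • (y - ‖y‖ • q) := by
        rw [smul_sub, smul_smul, inv_mul_cancel₀ hy'.ne', one_smul]
      rw [this, norm_smul, norm_inv, norm_norm, inv_mul_lt_iff₀ hy']
      linarith
    · rw [indicator_of_notMem hy]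
      have : Prod.mk y ⁻¹' U = ∅ := by
        ext q
        simp only [U, mem_preimage, Set.mem_ofPred_eq, mem_empty_iff_false, iff_false]
        intro h
        exact hy (mem_ball_zero_iff.2 h.1)
      rw [this, measure_empty]
  exact l.trans (e1.le.trans u)

lemma sphere_one {n : ℕ} (hn : 1 ≤ n) : μHE[n] (Metric.sphere (0 : Sp n) 1) ≤ ENNReal.ofReal ((n + 1) * om n) := by
  have hf := (sphere_fin hn).ne
  have hb := bet_pos n
  rw [ENNReal.le_ofReal_iff_toReal_le hf (by have := om_pos n; positivity)]
  set m := (μHE[n] (Metric.sphere (0 : Sp n) 1)).toReal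
  have key : ∀ r : ℝ, r ∈ Ioo (0:ℝ) 1 → (1 / √(1 + r ^ 2)) ^ (n + 1) * m ≤ (1 / √(1 - r ^ 2)) ^ n * ((n + 1) * om n) := by
    intro r hr
    have h0 := hr.1
    have h := ENNReal.toReal_mono (by simp [ENNReal.mul_eq_top]) (sphere_avg hn r hr.1 hr.2)
    have := om_pos n
    rw [ENNReal.toReal_mul, ENNReal.toReal_mul, ENNReal.toReal_ofReal (by positivity), ENNReal.toReal_ofReal (by positivity),
      ENNReal.toReal_ofReal (by positivity)] at h
    have hc : 0 < r ^ n * bet n / (n + 1) := by positivity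
    refine le_of_mul_le_mul_left ?_ hc
    calc _ = r ^ n * bet n * ((1 / √(1 + r ^ 2)) ^ (n + 1) / (n + 1)) * m := by ring
      _ ≤ _ := h
      _ = _ := by field_simp
  have c1 : ContinuousAt (fun r : ℝ => (1 / √(1 + r ^ 2)) ^ (n + 1) * m) 0 := by
    apply ContinuousAt.mul _ continuousAt_const
    apply ContinuousAt.pow
    apply ContinuousAt.div continuousAt_const (by fun_prop) (by simp)
  have c2 : ContinuousAt (fun r : ℝ => (1 / √(1 - r ^ 2)) ^ n * ((n + 1) * om n)) 0 := by
    apply ContinuousAt.mul _ continuousAt_const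
    apply ContinuousAt.pow
    apply ContinuousAt.div continuousAt_const (by fun_prop) (by simp)
  have t1 := c1.tendsto.mono_left (nhdsWithin_le_nhds (s := Ioi 0))
  have t2 := c2.tendsto.mono_left (nhdsWithin_le_nhds (s := Ioi 0))
  have := le_of_tendsto_of_tendsto t1 t2 (by
    filter_upwards [Ioo_mem_nhdsGT (zero_lt_one (α := ℝ))] with r hr using key r hr)
  simpa using this

open scoped Pointwise in
lemma sphere_le {n : ℕ} (hn : 1 ≤ n) (R : ℝ) (hR : 0 < R) :
    μHE[n] (Metric.sphere (0 : Sp n) R) ≤ ENNReal.ofReal ((n + 1) * om n * R ^ n) := by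
  have e : Metric.sphere (0 : Sp n) R = R • Metric.sphere (0 : Sp n) 1 := by
    rw [smul_sphere' hR.ne']; simp [abs_of_pos hR]
  rw [e, Measure.euclideanHausdorffMeasure_smul₀ n hR.ne', mul_comm, ENNReal.ofReal_mul (by positivity), ENNReal.smul_def, smul_eq_mul]
  refine mul_le_mul' (le_of_eq ?_) (sphere_one hn)
  rw [ENNReal.ofReal_pow hR.le]
  push_cast
  congr 1
  rw [← Real.enorm_eq_ofReal hR.le]; rfl

end BQ

namespace BQ
open Real
open scoped MeasureTheory

variable {n : ℕ} {k R : ℝ}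

lemma Ph_ball (hn : 1 ≤ n) (hk : 0 < k) (hR : 0 < R) :
    Ph n k R '' Metric.ball 0 R = Metric.ball 0 (R * exp (k * R ^ 2)) := by
  have hS : phi n k R R = R * exp (k * R ^ 2) := phi_in le_rfl
  ext y
  rw [mem_image, mem_ball_zero_iff]
  constructor
  · rintro ⟨x, hx, rfl⟩
    rw [mem_ball_zero_iff] at hx
    rw [Ph_norm hk hR, ← hS]
    have := phi_exp hn hk hR (norm_nonneg x) hx.le
    linarith
  · intro hy
    obtain ⟨x, rfl⟩ := Ph_surj (k := k) (R := R) hn hk hR y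
    refine ⟨x, ?_, rfl⟩
    rw [mem_ball_zero_iff]
    rw [Ph_norm hk hR, ← hS] at hy
    by_contra h
    have := phi_exp hn hk hR hR.le (not_lt.1 h)
    linarith [not_lt.1 h]

lemma Jm_ball (hn : 1 ≤ n) (hk : 0 < k) (hR : 0 < R) :
    Jm n k R (Metric.ball 0 R) = ENNReal.ofReal (om n * (R * exp (k * R ^ 2)) ^ (n + 1)) := by
  rw [← vol_Ph hn hk hR _ Metric.isOpen_ball.measurableSet, Ph_ball hn hk hR, vol_ball n _ (by positivity)]

lemma q_int (hn : 1 ≤ n) (hk : 0 < k) (hR : 0 < R) :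
    ∫⁻ x in Metric.ball (0 : Sp n) R, ENNReal.ofReal (qf n k R ‖x‖) = ENNReal.ofReal ((n + 1) * om n * Zf n k R R) := by
  have hint : IntegrableOn (fun x : Sp n => qf n k R ‖x‖) (Metric.ball 0 R) := by
    refine Measure.integrableOn_of_bounded (M := exp ((n + 4) * (k * R ^ 2)) * (KR n k R + (4 * n + 8) * (k * R)))
      measure_ball_lt_top.ne (q_meas.comp measurable_norm).aestronglyMeasurable ?_
    · filter_upwards [ae_restrict_mem Metric.isOpen_ball.measurableSet] with x hx
      rw [norm_of_nonneg (q_nonneg hk hR (norm_nonneg x))]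
      exact q_bdd hk hR (norm_nonneg x) (mem_ball_zero_iff.1 hx).le
  rw [← ofReal_integral_eq_lintegral_ofReal hint (ae_of_all _ fun x => q_nonneg hk hR (norm_nonneg x))]
  congr 1
  have h1 := integral_fun_norm_addHaar (volume : Measure (Sp n)) (fun r => (Iio R).indicator (qf n k R) r)
  have e1 : ∫ x in Metric.ball (0 : Sp n) R, qf n k R ‖x‖ = ∫ x : Sp n, (Iio R).indicator (qf n k R) ‖x‖ := by
    rw [← integral_indicator Metric.isOpen_ball.measurableSet]
    congr 1
    ext x
    by_cases h : ‖x‖ < R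
    · rw [indicator_of_mem (mem_ball_zero_iff.2 h), indicator_of_mem (mem_Iio.2 h)]
    · rw [indicator_of_notMem (fun h' => h (mem_ball_zero_iff.1 h')), indicator_of_notMem (s := Iio R) (fun h' => h h')]
  have hv : (volume : Measure (Sp n)).real (Metric.ball 0 1) = om n := by
    rw [Measure.real, vol_ball n 1 zero_le_one, ENNReal.toReal_ofReal (by have := om_pos n; positivity)]; simp
  have hc : ContinuousOn (Zf n k R) (Icc 0 R) := by
    have : ContinuousOn (fun r : ℝ => r ^ n * (exp ((n + 4) * (k * r ^ 2)) - exp (n * (k * r ^ 2)))) (Icc 0 R) := by fun_prop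
    exact this.congr fun r hr => Z_in hr.2
  have hd : ∀ r ∈ Ioo 0 R, HasDerivAt (Zf n k R) (qf n k R r * r ^ n) r := fun r hr => dZ hn hR hr.1
  have e2 : ∫ r in (0:ℝ)..R, qf n k R r * r ^ n = Zf n k R R := by
    rw [intervalIntegral.integral_eq_sub_of_hasDerivAt_of_le hR.le hc hd]
    · rw [Z_in hR.le]; simp
    · rw [intervalIntegrable_iff_integrableOn_Ioc_of_le hR.le]
      exact intervalIntegral.integrableOn_deriv_of_nonneg hc hd
        (fun r hr => mul_nonneg (q_nonneg hk hR hr.1.le) (by have := hr.1; positivity))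
  have e3 : ∫ y in Ioi (0:ℝ), y ^ n • (Iio R).indicator (qf n k R) y = Zf n k R R := by
    rw [← e2, intervalIntegral.integral_of_le hR.le, integral_Ioc_eq_integral_Ioo,
      ← integral_indicator measurableSet_Ioi, ← integral_indicator measurableSet_Ioo]
    congr 1
    ext y
    by_cases h0 : 0 < y <;> by_cases h1 : y < R <;> simp [indicator, h0, h1, mul_comm]
  rw [e1, h1, finrank_euclideanSpace, Fintype.card_fin, hv, Nat.add_sub_cancel, e3]
  simp [mul_assoc]

end BQ

namespace BQ
open Real
open scoped MeasureTheory

variable {n : ℕ} {k R : ℝ}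

lemma chord (hR : 0 < R) (v : ENNReal) (hv : v ≤ ENNReal.ofReal (om n * R ^ (n + 1))) :
    ENNReal.ofReal ((n + 1) / R) * v ≤ ENNReal.ofReal (isoC n) * v ^ ((n:ℝ) / (n + 1)) := by
  have h0 := om_pos n
  have e : v = v ^ ((n:ℝ) / (n + 1)) * v ^ ((1:ℝ) / (n + 1)) := by
    rw [← ENNReal.rpow_add_of_nonneg _ _ (by positivity) (by positivity), ← add_div, div_self (by positivity), ENNReal.rpow_one]
  have h1 : v ^ ((1:ℝ) / (n + 1)) ≤ ENNReal.ofReal (om n ^ ((1:ℝ) / (n + 1)) * R) := by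
    refine (ENNReal.rpow_le_rpow hv (by positivity)).trans (le_of_eq ?_)
    rw [ENNReal.ofReal_rpow_of_pos (by positivity), mul_rpow h0.le (by positivity), ← rpow_natCast, ← rpow_mul hR.le]
    congr 3
    push_cast
    rw [mul_one_div, div_self (by positivity), rpow_one]
  calc ENNReal.ofReal ((n + 1) / R) * v = ENNReal.ofReal ((n + 1) / R) * v ^ ((1:ℝ) / (n + 1)) * v ^ ((n:ℝ) / (n + 1)) := by
        conv_lhs => rw [e]
        ring
    _ ≤ ENNReal.ofReal ((n + 1) / R) * ENNReal.ofReal (om n ^ ((1:ℝ) / (n + 1)) * R) * v ^ ((n:ℝ) / (n + 1)) := by gcongr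
    _ = _ := by
        rw [← ENNReal.ofReal_mul (by positivity), isoC]
        congr 2
        field_simp

/-- the calibration density -/
noncomputable def Gf (n : ℕ) (k R : ℝ) (x : Sp n) : ℝ :=
  (n + 1) / (R * exp (k * R ^ 2)) * Jf n k R ‖x‖ + qf n k R ‖x‖

lemma Gf_int (hk : 0 < k) (hR : 0 < R) (A : Set (Sp n)) : ∫⁻ x in A, ENNReal.ofReal (Gf n k R x) =
    ENNReal.ofReal ((n + 1) / (R * exp (k * R ^ 2))) * Jm n k R A + ∫⁻ x in A, ENNReal.ofReal (qf n k R ‖x‖) := by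
  have m1 : Measurable fun x : Sp n => ENNReal.ofReal (Jf n k R ‖x‖) := (J_meas.comp measurable_norm).ennreal_ofReal
  rw [Jm, ← lintegral_const_mul _ m1, ← lintegral_add_left (m1.const_mul _)]
  congr 1
  ext x
  rw [Gf, ENNReal.ofReal_add (mul_nonneg (by positivity) (J_pos hk _).le) (q_nonneg hk hR (norm_nonneg x)),
    ENNReal.ofReal_mul (by positivity)]

lemma Gf_ball (hn : 1 ≤ n) (hk : 0 < k) (hR : 0 < R) : ∫⁻ x in Metric.ball 0 R, ENNReal.ofReal (Gf n k R x) =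
    ENNReal.ofReal (exp ((n + 4) * (k * R ^ 2)) * ((n + 1) * om n * R ^ n)) := by
  have h0 := om_pos n
  have hZ := Z_nonneg (n := n) hk hR hR.le
  rw [Gf_int hk hR, Jm_ball hn hk hR, q_int hn hk hR, ← ENNReal.ofReal_mul (by positivity), ← ENNReal.ofReal_add (by positivity) (by positivity),
    Z_in le_rfl]
  congr 1
  have e : exp (n * (k * R ^ 2)) = exp (k * R ^ 2) ^ n := by rw [← exp_nat_mul]
  rw [e, pow_succ, mul_pow]
  field_simp
  ring

lemma swap {G F : Sp n → ENNReal} (Ω B : Set (Sp n)) (hΩ : MeasurableSet Ω) (hB : MeasurableSet B)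
    (hF : Measurable F) (c : ENNReal) (ho : ∀ x, x ∉ B → G x = c * F x)
    (hV : ∫⁻ x in Ω, F x = ∫⁻ x in B, F x) (hV' : ∫⁻ x in B, F x ≠ ⊤) :
    ∫⁻ x in B \ Ω, F x = ∫⁻ x in Ω \ B, F x ∧
    ∫⁻ x in Ω, G x = (∫⁻ x in Ω ∩ B, G x) + c * ∫⁻ x in B \ Ω, F x ∧
    ∫⁻ x in B, G x = (∫⁻ x in Ω ∩ B, G x) + ∫⁻ x in B \ Ω, G x := by
  have a1 := lintegral_inter_add_sdiff (μ := volume) F Ω hB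
  have a2 := lintegral_inter_add_sdiff (μ := volume) F B hΩ
  have a3 := lintegral_inter_add_sdiff (μ := volume) G Ω hB
  have a4 := lintegral_inter_add_sdiff (μ := volume) G B hΩ
  rw [inter_comm] at a2 a4
  have hfin : ∫⁻ x in Ω ∩ B, F x ≠ ⊤ := ne_top_of_le_ne_top hV' (lintegral_mono_set inter_subset_right)
  have e : ∫⁻ x in B \ Ω, F x = ∫⁻ x in Ω \ B, F x := by
    rw [← ENNReal.add_right_inj hfin, a2, a1, hV]
  refine ⟨e, ?_, a4.symm⟩
  rw [e, ← a3, ← lintegral_const_mul c hF]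
  congr 1
  exact setLIntegral_congr_fun (hΩ.diff hB) fun x hx => ho x hx.2

theorem core (hn : 1 ≤ n) (hk : 0 < k) (hR : 0 < R) (Ω : Set (Sp n)) (hΩ : IsOpen Ω)
    (hV : ∫⁻ x in Ω, ENNReal.ofReal (exp ((n + 4) * (k * ‖x‖ ^ 2))) =
      ∫⁻ x in Metric.ball (0 : Sp n) R, ENNReal.ofReal (exp ((n + 4) * (k * ‖x‖ ^ 2))))
    (hV' : ∫⁻ x in Metric.ball (0 : Sp n) R, ENNReal.ofReal (exp ((n + 4) * (k * ‖x‖ ^ 2))) ≠ ⊤)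
    (hfin : μHE[n] (frontier Ω) ≠ ⊤) :
    ENNReal.ofReal (exp ((n + 4) * (k * R ^ 2)) * ((n + 1) * om n * R ^ n)) ≤
      ∫⁻ x in frontier Ω, ENNReal.ofReal (exp ((n + 4) * (k * ‖x‖ ^ 2))) ∂(μHE[n]) ∧
    (∫⁻ x in frontier Ω, ENNReal.ofReal (exp ((n + 4) * (k * ‖x‖ ^ 2))) ∂(μHE[n]) ≤
      ENNReal.ofReal (exp ((n + 4) * (k * R ^ 2)) * ((n + 1) * om n * R ^ n)) →
      volume (Ω ∆ Metric.ball (0 : Sp n) R) = 0) := by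
  set B := Metric.ball (0 : Sp n) R with hBdef
  have hB : MeasurableSet B := Metric.isOpen_ball.measurableSet
  have hΩm := hΩ.measurableSet
  set F : Sp n → ENNReal := fun x => ENNReal.ofReal (exp ((n + 4) * (k * ‖x‖ ^ 2))) with hF
  have hFm : Measurable F := by fun_prop
  have hγ := gm_pos' k R hk
  have hH : 0 ≤ HR n k R := by
    have := KR_nonneg (n := n) hk hR
    rw [HR]; positivity
  have out : ∀ x, x ∉ B → R ≤ ‖x‖ := fun x hx => not_lt.1 fun h => hx (mem_ball_zero_iff.2 h)
  obtain ⟨s1, s2, s3⟩ := swap (G := fun x => ENNReal.ofReal (Jf n k R ‖x‖)) Ω B hΩm hB hFm (ENNReal.ofReal (gm k R))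
    (fun x hx => by rw [J_out (out x hx), ENNReal.ofReal_mul hγ.le]) hV hV'
  obtain ⟨-, t2, t3⟩ := swap (G := fun x => ENNReal.ofReal (Gf n k R x)) Ω B hΩm hB hFm (ENNReal.ofReal (HR n k R))
    (fun x hx => by rw [Gf, H_out hR (out x hx), ENNReal.ofReal_mul hH]) hV hV'
  have hJ : Jm n k R Ω ≤ Jm n k R B := by
    rw [Jm, Jm, s2, s3, ← lintegral_const_mul _ hFm]
    refine add_le_add le_rfl (lintegral_mono fun x => ?_)
    rw [hF, ← ENNReal.ofReal_mul hγ.le]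
    exact ENNReal.ofReal_le_ofReal (J_ge hk (norm_nonneg x))
  rw [Jm_ball hn hk hR] at hJ
  have hm := main_lim hn hk hR hΩ (by rw [hV]; exact hV') hfin
  have hG : ∫⁻ x in Ω, ENNReal.ofReal (Gf n k R x) ≤ ∫⁻ x in frontier Ω, F x ∂(μHE[n]) := by
    rw [Gf_int hk hR]
    exact (add_le_add (chord (by positivity) _ hJ) le_rfl).trans hm
  rw [← Gf_ball hn hk hR]
  have strict : ∀ᵐ x : Sp n, x ∈ B \ Ω → ENNReal.ofReal (Gf n k R x) < ENNReal.ofReal (HR n k R) * F x := by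
    filter_upwards [ae_ne n] with x hx hxB
    have h1 : 0 < ‖x‖ := norm_pos_iff.2 hx
    have h2 : ‖x‖ < R := mem_ball_zero_iff.1 hxB.1
    have h3 := H_in hn hk hR h1 h2
    rw [hF, ← ENNReal.ofReal_mul hH]
    refine (ENNReal.ofReal_lt_ofReal_iff (lt_of_le_of_lt ?_ h3)).2 h3
    have := J_pos (n := n) (R := R) hk ‖x‖
    have := q_nonneg (n := n) hk hR h1.le
    positivity
  have hle : ∫⁻ x in B \ Ω, ENNReal.ofReal (Gf n k R x) ≤ ENNReal.ofReal (HR n k R) * ∫⁻ x in B \ Ω, F x := by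
    rw [← lintegral_const_mul _ hFm]
    apply setLIntegral_mono_ae (hFm.const_mul _).aemeasurable
    filter_upwards [strict] with x hx hxB using (hx hxB).le
  have hGB : ∫⁻ x in B, ENNReal.ofReal (Gf n k R x) ≠ ⊤ := by
    rw [Gf_ball hn hk hR]; exact ENNReal.ofReal_ne_top
  constructor
  · refine le_trans ?_ hG
    rw [t2, t3]
    exact add_le_add le_rfl hle
  · intro h
    have h' := hG.trans h
    have hf1 : ∫⁻ x in Ω ∩ B, ENNReal.ofReal (Gf n k R x) ≠ ⊤ :=
      ne_top_of_le_ne_top hGB (lintegral_mono_set inter_subset_right)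
    have hf2 : ∫⁻ x in B \ Ω, ENNReal.ofReal (Gf n k R x) ≠ ⊤ :=
      ne_top_of_le_ne_top hGB (lintegral_mono_set sdiff_subset)
    rw [t2, t3, ENNReal.add_le_add_iff_left hf1, ← lintegral_const_mul _ hFm] at h'
    have z1 : volume (B \ Ω) = 0 := by
      by_contra hne
      exact absurd h' (not_le.2 (setLIntegral_strict_mono (hB.diff hΩm) hne (hFm.const_mul _) hf2 strict))
    have z2 : volume (Ω \ B) = 0 := by
      have e0 : ∫⁻ x in Ω \ B, F x = 0 := by rw [← s1]; exact setLIntegral_measure_zero _ _ z1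
      rw [lintegral_eq_zero_iff hFm, Filter.EventuallyEq, ae_restrict_iff' (hΩm.diff hB)] at e0
      rw [← nonpos_iff_eq_zero, ← ae_iff.1 e0]
      apply measure_mono
      intro x hx
      simp only [Set.mem_ofPred_eq, Classical.not_imp]
      refine ⟨hx, ?_⟩
      simp only [hF, Pi.zero_apply, ENNReal.ofReal_eq_zero, not_le]
      positivity
    rw [symmDiff_def]
    exact measure_union_null z2 z1

end BQ

/-- In `ℝ^{n+1}` with density `f(x) = exp(c|x|²)`, `c > 0`, the round
ball `B` about the origin of weighted volume `V` minimizes weighted perimeter among all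
open sets of weighted volume `V`, and it is the unique minimizer up to sets of Lebesgue
measure zero. -/
theorem balls_uniquely_minimize_exp_norm_sq_density
    (n : ℕ) (hn : 1 ≤ n) (c : ℝ) (hc : 0 < c)
    (f : EuclideanSpace ℝ (Fin (n + 1)) → ℝ)
    (hf : ∀ x : EuclideanSpace ℝ (Fin (n + 1)), f x = Real.exp (c * ‖x‖ ^ 2))
    (V : ℝ) (hV : 0 < V) (R : ℝ) (hR : 0 < R)
    (hvol : wvol f (Metric.ball (0 : EuclideanSpace ℝ (Fin (n + 1))) R)
      = ENNReal.ofReal V) :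
    ∀ Ω : Set (EuclideanSpace ℝ (Fin (n + 1))), IsOpen Ω →
      wvol f Ω = ENNReal.ofReal V →
      wper f (Metric.ball (0 : EuclideanSpace ℝ (Fin (n + 1))) R) ≤ wper f Ω ∧
      (wper f Ω = wper f (Metric.ball (0 : EuclideanSpace ℝ (Fin (n + 1))) R) →
        volume (Ω ∆ Metric.ball (0 : EuclideanSpace ℝ (Fin (n + 1))) R) = 0) := by
  intro Ω hΩ hΩV
  set k : ℝ := c / (n + 4) with hk'
  have hk : 0 < k := by positivity
  have hf' : ∀ x, f x = Real.exp ((n + 4) * (k * ‖x‖ ^ 2)) := by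
    intro x
    rw [hf, hk']
    congr 1
    field_simp
  have hfe : f = fun x => Real.exp ((n + 4) * (k * ‖x‖ ^ 2)) := funext hf'
  have hfront : frontier (Metric.ball (0 : EuclideanSpace ℝ (Fin (n + 1))) R) = Metric.sphere 0 R :=
    frontier_ball 0 hR.ne'
  obtain ⟨K, hK0, hK⟩ : ∃ K : NNReal, K ≠ 0 ∧ (Measure.euclideanHausdorffMeasure n : Measure (EuclideanSpace ℝ (Fin (n + 1)))) =
      K • (μH[n] : Measure (EuclideanSpace ℝ (Fin (n + 1)))) :=
    ⟨_, Measure.addHaarScalarFactor_volume_hausdorffMeasure_ne_zero n, Measure.euclideanHausdorffMeasure_def n⟩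
  have hK0' : (K : ENNReal) ≠ 0 := by exact_mod_cast hK0
  have hKt : (K : ENNReal) ≠ ⊤ := ENNReal.coe_ne_top
  have hint : ∀ A : Set (EuclideanSpace ℝ (Fin (n + 1))),
      ∫⁻ x in frontier A, ENNReal.ofReal (f x) ∂(Measure.euclideanHausdorffMeasure n) = K * wper f A := by
    intro A
    rw [hK, Measure.restrict_smul, lintegral_smul_measure, wper]
    rfl
  have hball : K * wper f (Metric.ball (0 : EuclideanSpace ℝ (Fin (n + 1))) R) ≤
      ENNReal.ofReal (Real.exp ((n + 4) * (k * R ^ 2)) * ((n + 1) * BQ.om n * R ^ n)) := by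
    rw [← hint, hfront, ENNReal.ofReal_mul (Real.exp_pos _).le]
    have : ∫⁻ x in Metric.sphere (0 : EuclideanSpace ℝ (Fin (n + 1))) R, ENNReal.ofReal (f x) ∂(Measure.euclideanHausdorffMeasure n) =
        ∫⁻ x in Metric.sphere (0 : EuclideanSpace ℝ (Fin (n + 1))) R,
          ENNReal.ofReal (Real.exp ((n + 4) * (k * R ^ 2))) ∂(Measure.euclideanHausdorffMeasure n) := by
      apply setLIntegral_congr_fun Metric.isClosed_sphere.measurableSet
      intro x hx
      simp only
      rw [hf', mem_sphere_zero_iff_norm.1 hx]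
    rw [this, setLIntegral_const]
    exact mul_le_mul_right (BQ.sphere_le hn R hR) _
  have cancel : ∀ {a b : ENNReal}, K * a ≤ K * b → a ≤ b := fun h => (ENNReal.mul_le_mul_iff_right hK0' hKt).1 h
  by_cases hfin : (Measure.euclideanHausdorffMeasure n : Measure (EuclideanSpace ℝ (Fin (n + 1)))) (frontier Ω) = ⊤
  · have htop : K * wper f Ω = ⊤ := by
      rw [← hint, eq_top_iff, ← hfin, ← setLIntegral_one]
      refine lintegral_mono fun x => ?_
      rw [← ENNReal.ofReal_one, hf]
      exact ENNReal.ofReal_le_ofReal (Real.one_le_exp (by positivity))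
    constructor
    · apply cancel
      rw [htop]; exact le_top
    · intro h
      rw [h] at htop
      rw [htop] at hball
      exact absurd (top_le_iff.1 hball) ENNReal.ofReal_ne_top
  · have hvB := hvol
    rw [← hΩV, wvol, wvol, hfe] at hvB
    rw [wvol, hfe] at hvol
    have := BQ.core hn hk hR Ω hΩ hvB.symm (by rw [hvol]; exact ENNReal.ofReal_ne_top) hfin
    have e := hint Ω
    rw [hfe] at e
    rw [e, ← hfe] at this
    refine ⟨cancel (hball.trans this.1), fun h => this.2 ?_⟩
    rw [h]; exact hball
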